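/- arXiv:math/0602252 — 4 statements merged into one kernel-verified Lean document; each statement's English description precedes it below -/
import Mathlib

section
/- Let R be a commutative Noetherian ring. If A is a nullity class in D_qc(R) that is closed under desuspension (M ∈ A implies s^{-1}M ∈ A), then φ(A) is a constant function, and the assignment A ↦ φ(A)(0) is an order-preserving bijection between the set of nullity classes in D_qc(R) closed under desuspension and the set of subsets of Spec R closed under specialization. -/
open CategoryTheory CategoryTheory.Limits CategoryTheory.Pretriangulated

universe w

section Defs

variable (R : Type) [CommRing R] [HasDerivedCategory.{w} (ModuleCat R)]

/-- The `n`-th homology (homological indexing, so that `H_n (s M) = H_{n-1} M` where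
`s = ⟦1⟧`) of an object of the derived category `D(R)` of `R`-modules. -/
noncomputable def Hh (n : ℤ) (M : DerivedCategory (ModuleCat R)) : ModuleCat R :=
  (DerivedCategory.homologyFunctor (ModuleCat R) (-n)).obj M

/-- The object `s^n M` of `D(R)` given by a module `M` concentrated in homological
degree `n`. -/
noncomputable def sdeg (n : ℤ) (M : ModuleCat R) : DerivedCategory (ModuleCat R) :=
  (DerivedCategory.singleFunctor (ModuleCat R) (-n)).obj M

/-- Membership in `D_qc(R)`: all homology modules are finitely generated over `R`,
and all but finitely many of them vanish. -/
def memDqc (M : DerivedCategory (ModuleCat R)) : Prop :=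
  (∀ n : ℤ, Module.Finite R ↥(Hh R n M)) ∧
    {n : ℤ | ¬ IsZero (Hh R n M)}.Finite

/-- A cocomplete preaisle in `D(R)`: a class of objects closed under isomorphism,
suspension (`s = ⟦1⟧`), extensions, and arbitrary coproducts. -/
structure IsCocompletePreaisle (S : Set (DerivedCategory (ModuleCat R))) : Prop where
  mem_of_iso : ∀ ⦃X Y : DerivedCategory (ModuleCat R)⦄, (X ≅ Y) → X ∈ S → Y ∈ S
  shift_mem : ∀ ⦃X : DerivedCategory (ModuleCat R)⦄, X ∈ S → X⟦(1 : ℤ)⟧ ∈ S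
  ext_mem : ∀ ⦃X Y Z : DerivedCategory (ModuleCat R)⦄ (f : X ⟶ Y) (g : Y ⟶ Z)
    (h : Z ⟶ X⟦(1 : ℤ)⟧),
    (Triangle.mk f g h ∈ distTriang (DerivedCategory (ModuleCat R))) →
    X ∈ S → Z ∈ S → Y ∈ S
  coproduct_mem : ∀ ⦃ι : Type⦄ (X : ι → DerivedCategory (ModuleCat R)) (c : Cofan X),
    IsColimit c → (∀ i, X i ∈ S) → c.pt ∈ S

end Defs

section Invariants

variable (R : Type) [CommRing R] [HasDerivedCategory.{w} (ModuleCat R)]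

/-- The invariant `φ`: for a class `A` of objects of `D_qc(R)` and `n : ℤ`,
`φ(A)(n)` is the set of primes `p` such that there are `M ∈ A` and
`q ∈ Ass H_n(M)` with `q ⊆ p`. -/
noncomputable def phi (A : Set (DerivedCategory (ModuleCat R))) (n : ℤ) :
    Set (PrimeSpectrum R) :=
  {p | ∃ M ∈ A, ∃ q ∈ associatedPrimes R ↥(Hh R n M), q ≤ p.asIdeal}

/-- `N(f)`: the intersection with `D_qc(R)` of the smallest cocomplete preaisle of
`D(R)` containing `s^n (R/p)` for every `n : ℤ` and every `p ∈ f(n)`. -/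
noncomputable def Nfun (f : ℤ → Set (PrimeSpectrum R)) :
    Set (DerivedCategory (ModuleCat R)) :=
  {M | memDqc R M ∧ ∀ S : Set (DerivedCategory (ModuleCat R)), IsCocompletePreaisle R S →
    (∀ (n : ℤ), ∀ p ∈ f n, sdeg R n (ModuleCat.of R (R ⧸ p.asIdeal)) ∈ S) → M ∈ S}

/-- A nullity class in `D_qc(R)`: the intersection of a cocomplete preaisle of `D(R)`
with `D_qc(R)`. -/
def IsNullityClass (A : Set (DerivedCategory (ModuleCat R))) : Prop :=
  ∃ U : Set (DerivedCategory (ModuleCat R)), IsCocompletePreaisle R U ∧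
    A = U ∩ {M | memDqc R M}

end Invariants

universe v u

section partA
namespace S16
variable {R : Type} [CommRing R]

instance instShapes : HasColimitsOfSize.{0, 0} (ModuleCat.{v} R) :=
  hasColimitsOfSizeShrink.{0, 0, v, v} (ModuleCat.{v} R)
instance instShape {J : Type} : HasCoproductsOfShape J (ModuleCat.{v} R) := inferInstance

open Classical in
lemma mod_coprod {J : Type} (X : J → ModuleCat.{v} R) (c : Cofan X) (hc : IsColimit c) (p : ∀ j, c.pt ⟶ X j)
    (hp : ∀ j, c.inj j ≫ p j = 𝟙 _) (hp' : ∀ i j, i ≠ j → c.inj i ≫ p j = 0) (z : c.pt) :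
    ∃ S : Finset J, z = ∑ j ∈ S, (p j ≫ c.inj j).hom z := by
  have key : ∀ T : Submodule R c.pt, (∀ j x, (c.inj j).hom x ∈ T) → T = ⊤ := by
    intro T hT
    have h0 : ModuleCat.ofHom T.mkQ = 0 := by
      refine Cofan.IsColimit.hom_ext hc _ _ fun j => ?_
      ext x
      simpa using hT j x
    have h1 : T.mkQ = 0 := by
      simpa using congrArg ModuleCat.Hom.hom h0
    simpa using congrArg LinearMap.ker h1
  have hz : z ∈ Submodule.span R {y | ∃ j x, y = (c.inj j).hom x} := by
    rw [key (Submodule.span R {y | ∃ j x, y = (c.inj j).hom x})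
      (fun j x => Submodule.subset_span ⟨j, x, rfl⟩)]; trivial
  have e1 : ∀ (j : J) x, (p j).hom ((c.inj j).hom x) = x := fun j x => by
    have := congrArg (fun f => f.hom x) (hp j); simpa using this
  have e2 : ∀ (i j : J) x, i ≠ j → (p j).hom ((c.inj i).hom x) = 0 := fun i j x h => by
    have := congrArg (fun f => f.hom x) (hp' i j h); simpa using this
  suffices ∃ S : Finset J, ∀ S', S ⊆ S' → z = ∑ j ∈ S', (p j ≫ c.inj j).hom z from
    ⟨_, this.choose_spec _ (subset_refl _)⟩
  induction hz using Submodule.span_induction with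
  | mem x h =>
    obtain ⟨j, x, rfl⟩ := h
    refine ⟨{j}, fun S' hS => ?_⟩
    rw [Finset.sum_eq_single j]
    · simp [e1]
    · intro b _ hb
      simp [e2 j b x hb.symm]
    · intro h; exact absurd (hS (by simp)) h
  | zero => exact ⟨∅, by simp⟩
  | add x y _ _ hx hy =>
    obtain ⟨S, hS⟩ := hx
    obtain ⟨T, hT⟩ := hy
    refine ⟨S ∪ T, fun S' h => ?_⟩
    simp only [map_add, Finset.sum_add_distrib]
    rw [← hS _ (Finset.union_subset_left h), ← hT _ (Finset.union_subset_right h)]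
  | smul a x _ hx =>
    obtain ⟨S, hS⟩ := hx
    refine ⟨S, fun S' h => ?_⟩
    simp only [map_smul, ← Finset.smul_sum]
    rw [← hS _ h]

abbrev Cpx (R : Type) [CommRing R] := CochainComplex (ModuleCat.{v} R) ℤ

open Classical in
lemma X_coprod {J : Type} (K : J → Cpx.{v} R) (n : ℤ) (z : (∐ K).X n) :
    ∃ S : Finset J, z = ∑ j ∈ S, ((Sigma.π K j ≫ Sigma.ι K j).f n).hom z := by
  have h := mod_coprod (fun j => (K j).X n) (Cofan.mk ((∐ K).X n) (fun j => (Sigma.ι K j).f n))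
    ((isColimitMapCoconeCofanMkEquiv (HomologicalComplex.eval _ _ n) _ _)
      (isColimitOfPreserves (HomologicalComplex.eval (ModuleCat.{v} R) (ComplexShape.up ℤ) n) (coproductIsCoproduct K)))
    (fun j => (Sigma.π K j).f n) ?_ ?_ z
  · simpa using h
  · intro j
    have : Sigma.ι K j ≫ Sigma.π K j = 𝟙 _ := by simp
    have := congrArg (fun f => HomologicalComplex.Hom.f f n) this
    rw [HomologicalComplex.comp_f] at this
    exact this
  · intro i j hij
    have : Sigma.ι K i ≫ Sigma.π K j = 0 := by simp [Sigma.ι_π_of_ne _ hij]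
    have := congrArg (fun f => f.f n) this
    simpa using this

open Classical in
lemma H_coprod {J : Type} (K : J → Cpx.{v} R) (n : ℤ) (x : (∐ K).homology n) :
    ∃ S : Finset J, x = ∑ j ∈ S, (HomologicalComplex.homologyMap (Sigma.π K j ≫ Sigma.ι K j) n).hom x := by
  have hepi : Function.Surjective ((∐ K).homologyπ n).hom :=
    (ModuleCat.epi_iff_surjective _).1 inferInstance
  have hmono : Function.Injective ((∐ K).iCycles n).hom :=
    (ModuleCat.mono_iff_injective _).1 inferInstance
  obtain ⟨y, rfl⟩ := hepi x
  obtain ⟨S, hS⟩ := X_coprod K n (((∐ K).iCycles n).hom y)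
  refine ⟨S, ?_⟩
  have hy : y = ∑ j ∈ S, (HomologicalComplex.cyclesMap (Sigma.π K j ≫ Sigma.ι K j) n).hom y := by
    apply hmono
    rw [hS, map_sum]
    refine Finset.sum_congr rfl fun j _ => ?_
    have := congrArg (fun f => f.hom y) (HomologicalComplex.cyclesMap_i (Sigma.π K j ≫ Sigma.ι K j) n)
    exact this.symm
  conv_lhs => rw [hy, map_sum]
  refine Finset.sum_congr rfl fun j _ => ?_
  have := congrArg (fun f => f.hom y) (HomologicalComplex.homologyπ_naturality (Sigma.π K j ≫ Sigma.ι K j) n)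
  exact this.symm

open Classical in
lemma quasiIso_sigma {J : Type} (K L : J → Cpx.{v} R) (s : ∀ j, K j ⟶ L j) (hs : ∀ j, QuasiIso (s j)) :
    QuasiIso (Limits.Sigma.map s) := by
  rw [quasiIso_iff]
  intro n
  rw [quasiIsoAt_iff_isIso_homologyMap]
  have hs' : ∀ j, IsIso (HomologicalComplex.homologyMap (s j) n) := fun j => inferInstance
  have : Mono (HomologicalComplex.homologyMap (Limits.Sigma.map s) n) := by
    rw [ModuleCat.mono_iff_injective, injective_iff_map_eq_zero]
    intro x hx
    obtain ⟨S, hS⟩ := H_coprod K n x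
    rw [hS]
    refine Finset.sum_eq_zero fun j _ => ?_
    have h1 : Limits.Sigma.map s ≫ Sigma.π L j = Sigma.π K j ≫ s j := by
      apply Limits.Sigma.hom_ext
      intro i
      by_cases h : i = j
      · subst h; simp
      · simp [Sigma.ι_π_of_ne_assoc _ h, Sigma.ι_π_of_ne _ h]
    have h2 : (HomologicalComplex.homologyMap (Sigma.π K j) n).hom x = 0 := by
      have : Function.Injective (HomologicalComplex.homologyMap (s j) n).hom :=
        (ModuleCat.mono_iff_injective _).1 inferInstance
      apply this
      rw [map_zero]
      have := congrArg (fun f : (∐ K ⟶ L j) => (HomologicalComplex.homologyMap f n).hom x) h1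
      simp only [HomologicalComplex.homologyMap_comp, ModuleCat.hom_comp, LinearMap.comp_apply, hx, map_zero] at this
      exact this.symm
    simp [HomologicalComplex.homologyMap_comp, h2]
  have : Epi (HomologicalComplex.homologyMap (Limits.Sigma.map s) n) := by
    rw [ModuleCat.epi_iff_surjective]
    intro x
    obtain ⟨S, hS⟩ := H_coprod L n x
    have : ∀ j, Function.Surjective (HomologicalComplex.homologyMap (s j) n).hom := fun j =>
        (ModuleCat.epi_iff_surjective _).1 inferInstance
    choose y hy using fun j => this j ((HomologicalComplex.homologyMap (Sigma.π L j) n).hom x)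
    refine ⟨∑ j ∈ S, (HomologicalComplex.homologyMap (Sigma.ι K j) n).hom (y j), ?_⟩
    rw [hS, map_sum]
    refine Finset.sum_congr rfl fun j _ => ?_
    have h1 : Sigma.ι K j ≫ Limits.Sigma.map s = s j ≫ Sigma.ι L j := by simp
    have := congrArg (fun f : (K j ⟶ ∐ L) => (HomologicalComplex.homologyMap f n).hom (y j)) h1
    simp only [HomologicalComplex.homologyMap_comp, ModuleCat.hom_comp, LinearMap.comp_apply, hy] at this ⊢
    exact this
  exact isIso_of_mono_of_epi _

end S16
end partA

section partB
namespace S16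
variable {R : Type} [CommRing R]

noncomputable def evalCofan {J : Type} (K : J → Cpx.{v} R) (n : ℤ) :
    IsColimit (Cofan.mk ((∐ K).X n) (fun j => (Sigma.ι K j).f n)) :=
  ((isColimitMapCoconeCofanMkEquiv (HomologicalComplex.eval _ _ n) _ _)
      (isColimitOfPreserves (HomologicalComplex.eval (ModuleCat.{v} R) (ComplexShape.up ℤ) n) (coproductIsCoproduct K)))

lemma eval_ext {J : Type} (K : J → Cpx.{v} R) (n : ℤ) {Y : ModuleCat.{v} R} (f g : (∐ K).X n ⟶ Y)
    (h : ∀ j, (Sigma.ι K j).f n ≫ f = (Sigma.ι K j).f n ≫ g) : f = g :=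
  Cofan.IsColimit.hom_ext (evalCofan K n) _ _ h

lemma eval_desc {J : Type} (K : J → Cpx.{v} R) (n : ℤ) {Y : ModuleCat.{v} R} (f : ∀ j, (K j).X n ⟶ Y) :
    ∃ g : (∐ K).X n ⟶ Y, ∀ j, (Sigma.ι K j).f n ≫ g = f j :=
  ⟨Cofan.IsColimit.desc (evalCofan K n) f, fun j => Cofan.IsColimit.fac (evalCofan K n) f j⟩

lemma homotopy_sigma {J : Type} (K : J → Cpx.{v} R) (L : Cpx.{v} R) (f : ∐ K ⟶ L)
    (h : ∀ j, Homotopy (Sigma.ι K j ≫ f) 0) : Nonempty (Homotopy f 0) := by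
  choose H hH using fun a b => eval_desc K a (fun j => (h j).hom a b)
  refine ⟨{ hom := H, zero := ?_, comm := ?_ }⟩
  · intro i j hij
    apply eval_ext
    intro k
    rw [hH, (h k).zero _ _ hij, comp_zero]
  · intro i
    apply eval_ext
    intro k
    have := (h k).comm i
    rw [HomologicalComplex.comp_f] at this
    rw [this, Preadditive.comp_add, Preadditive.comp_add]
    congr 1
    · congr 1
      · simp only [dNext, AddMonoidHom.mk'_apply]
        rw [← Category.assoc, HomologicalComplex.Hom.comm, Category.assoc, hH]
      · simp only [prevD, AddMonoidHom.mk'_apply]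
        rw [← Category.assoc, hH]

variable [HasDerivedCategory.{w} (ModuleCat.{v} R)]
open DerivedCategory

lemma Q_map_eq_zero {K L : Cpx.{v} R} (g : K ⟶ L) (h : Q.map g = 0) :
    ∃ (K' : Cpx.{v} R) (t : K' ⟶ K) (_ : QuasiIso t), Nonempty (Homotopy (t ≫ g) 0) := by
  have h1 : Qh.map ((HomotopyCategory.quotient _ _).map g) = Qh.map 0 := by
    rw [← cancel_mono ((quotientCompQhIso (ModuleCat.{v} R)).hom.app L), quotientCompQhIso_hom_naturality, h]
    simp
  rw [MorphismProperty.map_eq_iff_precomp Qh (HomotopyCategory.quasiIso (ModuleCat.{v} R) (ComplexShape.up ℤ))] at h1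
  obtain ⟨K', t, ht, e⟩ := h1
  obtain ⟨K', rfl⟩ := HomotopyCategory.quotient_obj_surjective K'
  obtain ⟨t, rfl⟩ := (HomotopyCategory.quotient _ _).map_surjective t
  refine ⟨K', t, ?_, ⟨HomotopyCategory.homotopyOfEq _ _ ?_⟩⟩
  · exact (HomotopyCategory.quotient_map_mem_quasiIso_iff t).1 ht
  · rw [Functor.map_comp, e]; simp

lemma Q_map_homotopy {K L : Cpx.{v} R} (g : K ⟶ L) (h : Homotopy g 0) : Q.map g = 0 := by
  have h1 := HomotopyCategory.eq_of_homotopy _ _ h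
  rw [← cancel_epi ((quotientCompQhIso (ModuleCat.{v} R)).hom.app K), ← quotientCompQhIso_hom_naturality, h1]
  simp

lemma Q_coprod {J : Type} (K : J → Cpx.{v} R) :
    Nonempty (IsColimit (Cofan.mk (Q.obj (∐ K)) (fun j => Q.map (Sigma.ι K j)))) := by
  have ex : ∀ (Y : DerivedCategory (ModuleCat.{v} R)) (φ : ∀ j, Q.obj (K j) ⟶ Y),
      ∃ ψ : Q.obj (∐ K) ⟶ Y, ∀ j, Q.map (Sigma.ι K j) ≫ ψ = φ j := by
    intro Y φ
    let L := Q.objPreimage Y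
    let e : Q.obj L ≅ Y := Q.objObjPreimageIso Y
    choose K' s hs g hg using fun j => right_fac (φ j ≫ e.inv)
    have hs' : ∀ j, QuasiIso (s j) := fun j => by rw [← isIso_Q_map_iff_quasiIso]; exact hs j
    have := quasiIso_sigma _ _ s hs'
    refine ⟨inv (Q.map (Limits.Sigma.map s)) ≫ Q.map (Limits.Sigma.desc g) ≫ e.hom, fun j => ?_⟩
    have h1 : Q.map (Sigma.ι K j) ≫ inv (Q.map (Limits.Sigma.map s)) =
        inv (Q.map (s j)) ≫ Q.map (Sigma.ι K' j) := by
      rw [IsIso.comp_inv_eq, Category.assoc, IsIso.eq_inv_comp, ← Q.map_comp, ← Q.map_comp]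
      simp
    rw [reassoc_of% h1, ← Q.map_comp_assoc, Limits.Sigma.ι_desc, ← Category.assoc, ← hg j]
    simp
  have un : ∀ (Y : DerivedCategory (ModuleCat.{v} R)) (ψ : Q.obj (∐ K) ⟶ Y),
      (∀ j, Q.map (Sigma.ι K j) ≫ ψ = 0) → ψ = 0 := by
    intro Y ψ h
    let L := Q.objPreimage Y
    let e : Q.obj L ≅ Y := Q.objObjPreimageIso Y
    obtain ⟨L', g, s, hs, hg⟩ := left_fac (ψ ≫ e.inv)
    have h1 : ∀ j, Q.map (Sigma.ι K j ≫ g) = 0 := by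
      intro j
      rw [← cancel_mono (inv (Q.map s)), Q.map_comp, Category.assoc, ← hg, reassoc_of% (h j)]
      simp
    choose K' t ht hh using fun j => Q_map_eq_zero _ (h1 j)
    have := quasiIso_sigma _ _ t ht
    have h2 : Q.map (Limits.Sigma.map t ≫ g) = 0 := by
      obtain ⟨H⟩ := homotopy_sigma _ _ (Limits.Sigma.map t ≫ g) (fun j =>
        (Homotopy.ofEq (by simp)).trans (hh j).some)
      exact Q_map_homotopy _ H
    rw [Q.map_comp, ← comp_zero, cancel_epi] at h2
    rw [← cancel_mono e.inv, hg, h2]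
    simp
  choose d hd using ex
  exact ⟨Cofan.IsColimit.mk _ (fun s => d s.pt s.inj) (fun s j => hd _ _ j) (fun s m hm => by
    rw [← sub_eq_zero]
    apply un
    intro j
    rw [Preadditive.comp_sub, hd]
    exact sub_eq_zero.2 (hm j))⟩

instance {J : Type} : HasCoproductsOfShape J (DerivedCategory (ModuleCat.{v} R)) := by
  constructor
  intro F
  have h : HasCoproduct (fun j => (Q (C := ModuleCat.{v} R)).obj (Q.objPreimage (F.obj ⟨j⟩))) :=
    ⟨⟨⟨_, (Q_coprod (fun j => Q.objPreimage (F.obj ⟨j⟩))).some⟩⟩⟩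
  exact hasColimit_of_iso (F := Discrete.functor (fun j => (Q (C := ModuleCat.{v} R)).obj (Q.objPreimage (F.obj ⟨j⟩))))
    (Discrete.natIso (fun ⟨j⟩ => (Q.objObjPreimageIso (F.obj ⟨j⟩)).symm))

abbrev DD (R : Type) [CommRing R] [HasDerivedCategory.{w} (ModuleCat.{v} R)] := DerivedCategory (ModuleCat.{v} R)
noncomputable abbrev HH (R : Type) [CommRing R] [HasDerivedCategory.{w} (ModuleCat.{v} R)] (n : ℤ) : DD.{w, v} R ⥤ ModuleCat.{v} R :=
  homologyFunctor (ModuleCat.{v} R) n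

noncomputable def Hη (n : ℤ) (L : Cpx.{v} R) : (HH.{w, v} R n).obj (Q.obj L) ≅ L.homology n :=
  (homologyFunctorFactors (ModuleCat.{v} R) n).app L

lemma Hη_nat (n : ℤ) {K L : Cpx.{v} R} (f : K ⟶ L) :
    (HH.{w, v} R n).map (Q.map f) ≫ (Hη n L).hom = (Hη n K).hom ≫ HomologicalComplex.homologyMap f n :=
  (homologyFunctorFactors (ModuleCat.{v} R) n).hom.naturality f

/-- joint surjectivity of homology of a coproduct -/
lemma joint_surj {J : Type} (X : J → DD.{w, v} R) (c : Cofan X) (hc : IsColimit c) (n : ℤ) (x : (HH.{w, v} R n).obj c.pt) :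
    ∃ (S : Finset J) (y : ∀ j, (HH.{w, v} R n).obj (X j)), x = ∑ j ∈ S, ((HH.{w, v} R n).map (c.inj j)).hom (y j) := by
  classical
  let K : J → Cpx.{v} R := fun j => Q.objPreimage (X j)
  let e : ∀ j, Q.obj (K j) ≅ X j := fun j => Q.objObjPreimageIso (X j)
  obtain ⟨hK⟩ := Q_coprod K
  let b : Q.obj (∐ K) ⟶ c.pt := Cofan.IsColimit.desc hK (fun j => (e j).hom ≫ c.inj j)
  let a : c.pt ⟶ Q.obj (∐ K) := Cofan.IsColimit.desc hc (fun j => (e j).inv ≫ Q.map (Sigma.ι K j))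
  have hb : ∀ j, Q.map (Sigma.ι K j) ≫ b = (e j).hom ≫ c.inj j := fun j => Cofan.IsColimit.fac hK _ j
  have ha : ∀ j, c.inj j ≫ a = (e j).inv ≫ Q.map (Sigma.ι K j) := fun j => Cofan.IsColimit.fac hc _ j
  have hab : a ≫ b = 𝟙 _ := by
    refine Cofan.IsColimit.hom_ext hc _ _ fun j => ?_
    rw [← Category.assoc, ha, Category.assoc, hb]; simp
  let η : ∀ L : Cpx.{v} R, (HH.{w, v} R n).obj (Q.obj L) ≅ L.homology n := Hη n
  let z : (∐ K).homology n := (η (∐ K)).hom.hom (((HH.{w, v} R n).map a).hom x)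
  obtain ⟨S, hS⟩ := H_coprod K n z
  refine ⟨S, fun j => ((HH.{w, v} R n).map (a ≫ Q.map (Sigma.π K j) ≫ (e j).hom)).hom x, ?_⟩
  have h1 : x = ((HH.{w, v} R n).map b).hom ((η (∐ K)).inv.hom z) := by
    have := congrArg (fun f => f.hom x) (show (HH.{w, v} R n).map a ≫ (η _).hom ≫ (η _).inv ≫ (HH.{w, v} R n).map b = 𝟙 _ by
      simp [← Functor.map_comp, hab])
    simpa [z] using this.symm
  conv_lhs => rw [h1, hS]
  rw [map_sum, map_sum]
  refine Finset.sum_congr rfl fun j _ => ?_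
  have h2 : (HH.{w, v} R n).map a ≫ (η _).hom ≫ HomologicalComplex.homologyMap (Sigma.π K j ≫ Sigma.ι K j) n ≫ (η _).inv ≫ (HH.{w, v} R n).map b
     = (HH.{w, v} R n).map (a ≫ Q.map (Sigma.π K j) ≫ (e j).hom) ≫ (HH.{w, v} R n).map (c.inj j) := by
    have := Hη_nat n (Sigma.π K j ≫ Sigma.ι K j)
    dsimp only [η]
    rw [← reassoc_of% this]
    rw [Iso.hom_inv_id_assoc, ← Functor.map_comp, ← Functor.map_comp, ← Functor.map_comp]
    congr 1
    rw [Q.map_comp, Category.assoc, hb]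
    simp
  have := congrArg (fun f => f.hom x) h2
  simpa [z] using this

end S16
end partB

section partC
namespace S16
set_option linter.unusedSectionVars false

section
variable {C : Type*} [Category C] [Preadditive C] [HasZeroObject C] [HasShift C ℤ]
  [∀ n : ℤ, (shiftFunctor C n).Additive] [Pretriangulated C]

noncomputable def shiftCofan {J : Type} (X : J → C) [HasCoproduct X] :
    IsColimit (Cofan.mk ((∐ X)⟦(1:ℤ)⟧) (fun j => (Sigma.ι X j)⟦(1:ℤ)⟧')) :=
  (isColimitMapCoconeCofanMkEquiv (shiftFunctor C (1:ℤ)) _ _)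
      (isColimitOfPreserves (shiftFunctor C (1:ℤ)) (coproductIsCoproduct X))

lemma sh_ext {J : Type} (X : J → C) [HasCoproduct X] {Y : C} (f g : (∐ X)⟦(1:ℤ)⟧ ⟶ Y)
    (h : ∀ j, (Sigma.ι X j)⟦(1:ℤ)⟧' ≫ f = (Sigma.ι X j)⟦(1:ℤ)⟧' ≫ g) : f = g :=
  Cofan.IsColimit.hom_ext (shiftCofan X) _ _ h

lemma sh_desc {J : Type} (X : J → C) [HasCoproduct X] {Y : C} (f : ∀ j, (X j)⟦(1:ℤ)⟧ ⟶ Y) :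
    ∃ g : (∐ X)⟦(1:ℤ)⟧ ⟶ Y, ∀ j, (Sigma.ι X j)⟦(1:ℤ)⟧' ≫ g = f j :=
  ⟨Cofan.IsColimit.desc (shiftCofan X) f, fun j => Cofan.IsColimit.fac (shiftCofan X) f j⟩

lemma tri_map {X Y Z X' Y' Z' : C} {f : X ⟶ Y} {g : Y ⟶ Z} {h : Z ⟶ X⟦(1:ℤ)⟧} {f' : X' ⟶ Y'} {g' : Y' ⟶ Z'} {h' : Z' ⟶ X'⟦(1:ℤ)⟧}
    (hT : Triangle.mk f g h ∈ distTriang C) (hT' : Triangle.mk f' g' h' ∈ distTriang C) (a : X ⟶ X') (b : Y ⟶ Y')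
    (comm : f ≫ b = a ≫ f') : ∃ c : Z ⟶ Z', g ≫ c = b ≫ g' ∧ h ≫ a⟦(1:ℤ)⟧' = c ≫ h' :=
  complete_distinguished_triangle_morphism _ _ hT hT' a b comm

lemma yo2 {X Y Z W : C} {f : X ⟶ Y} {g : Y ⟶ Z} {h : Z ⟶ X⟦(1:ℤ)⟧}
    (hT : Triangle.mk f g h ∈ distTriang C) (e : Y ⟶ W) (he : f ≫ e = 0) : ∃ k : Z ⟶ W, e = g ≫ k :=
  Triangle.yoneda_exact₂ _ hT e he
lemma yo3 {X Y Z W : C} {f : X ⟶ Y} {g : Y ⟶ Z} {h : Z ⟶ X⟦(1:ℤ)⟧}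
    (hT : Triangle.mk f g h ∈ distTriang C) (e : Z ⟶ W) (he : g ≫ e = 0) : ∃ k : X⟦(1:ℤ)⟧ ⟶ W, e = h ≫ k :=
  Triangle.yoneda_exact₃ _ hT e he
lemma yo4 {X Y Z W : C} {f : X ⟶ Y} {g : Y ⟶ Z} {h : Z ⟶ X⟦(1:ℤ)⟧}
    (hT : Triangle.mk f g h ∈ distTriang C) (e : X⟦(1:ℤ)⟧ ⟶ W) (he : h ≫ e = 0) : ∃ k : Y⟦(1:ℤ)⟧ ⟶ W, e = (-f⟦(1:ℤ)⟧') ≫ k :=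
  Triangle.yoneda_exact₃ _ (rot_of_distTriang _ hT) e he

lemma cone_sigma {J : Type} [HasCoproductsOfShape J C] (X Y Z : J → C) (f : ∀ j, X j ⟶ Y j)
    (g : ∀ j, Y j ⟶ Z j) (h : ∀ j, Z j ⟶ (X j)⟦(1:ℤ)⟧)
    (hT : ∀ j, Triangle.mk (f j) (g j) (h j) ∈ distTriang C)
    (W : C) (v : ∐ Y ⟶ W) (w : W ⟶ (∐ X)⟦(1:ℤ)⟧) (hW : Triangle.mk (Limits.Sigma.map f) v w ∈ distTriang C) :
    Nonempty (∐ Z ≅ W) := by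
  choose t ht1 ht2 using fun j => tri_map (hT j) hW (Sigma.ι X j) (Sigma.ι Y j)
    (Limits.Sigma.ι_map f j).symm
  let θ : ∐ Z ⟶ W := Limits.Sigma.desc t
  have hθ : ∀ j, Sigma.ι Z j ≫ θ = t j := fun j => by simp [θ]
  have vw : v ≫ w = 0 := comp_distTriang_mor_zero₂₃ _ hW
  have fv : Limits.Sigma.map f ≫ v = 0 := comp_distTriang_mor_zero₁₂ _ hW
  have wf : w ≫ (Limits.Sigma.map f)⟦(1:ℤ)⟧' = 0 := comp_distTriang_mor_zero₃₁ _ hW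
  suffices IsIso θ from ⟨asIso θ⟩
  refine isIso_of_coyoneda_map_bijective _ fun A => ⟨?_, ?_⟩
  · intro a b hab
    suffices ∀ e : W ⟶ A, θ ≫ e = 0 → e = 0 by
      rw [← sub_eq_zero]; apply this
      rw [Preadditive.comp_sub]; exact sub_eq_zero.2 hab
    intro e he
    have h1 : v ≫ e = 0 := by
      ext j
      rw [← Category.assoc, ← ht1, Category.assoc, ← hθ, Category.assoc, he]; simp
    obtain ⟨k, hk⟩ := yo3 hW e h1
    have h2 : ∀ j, h j ≫ (Sigma.ι X j)⟦(1:ℤ)⟧' ≫ k = 0 := fun j => by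
      rw [← Category.assoc, ht2, Category.assoc, ← hk, ← hθ, Category.assoc, he]; simp
    choose β hβ using fun j => yo4 (hT j) _ (h2 j)
    obtain ⟨B, hB⟩ := sh_desc Y β
    have h3 : k = - ((Limits.Sigma.map f)⟦(1:ℤ)⟧' ≫ B) := by
      apply sh_ext
      intro j
      rw [hβ, ← hB, Preadditive.comp_neg, Preadditive.neg_comp, ← Functor.map_comp_assoc, ← Functor.map_comp_assoc]
      simp
    rw [hk, h3, Preadditive.comp_neg, reassoc_of% wf]; simp
  · intro a
    obtain ⟨c, hc⟩ := yo2 hW (Limits.Sigma.map g ≫ a) (by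
      ext j
      have : f j ≫ g j = 0 := comp_distTriang_mor_zero₁₂ _ (hT j)
      simp [reassoc_of% this])
    choose d hd using fun j => yo3 (hT j) (Sigma.ι Z j ≫ (a - θ ≫ c)) (by
      have := congrArg (fun x => Sigma.ι Y j ≫ x) hc
      simp only [Limits.Sigma.ι_map_assoc] at this
      rw [Preadditive.comp_sub, Preadditive.comp_sub, this, ← Category.assoc (Sigma.ι Z j), hθ,
        reassoc_of% (ht1 j), sub_self])
    obtain ⟨D, hD⟩ := sh_desc X d
    refine ⟨c + w ≫ D, ?_⟩
    dsimp
    ext j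
    have := hd j
    rw [← hD, ← Category.assoc, ht2, Preadditive.comp_sub, sub_eq_iff_eq_add] at this
    rw [this, Preadditive.comp_add, Preadditive.comp_add, ← Category.assoc, ← Category.assoc (Sigma.ι Z j), hθ]
    simp [add_comm]

structure Loc (P : ObjectProperty C) : Prop where
  tri : P.IsTriangulated
  iso : P.IsClosedUnderIsomorphisms
  coprod : ∀ {J : Type} (X : J → C) (c : Cofan X), IsColimit c → (∀ j, P (X j)) → P c.pt

lemma Loc.ext₁ {P : ObjectProperty C} (h : Loc P) {X Y Z : C} {f : X ⟶ Y} {g : Y ⟶ Z} {k : Z ⟶ X⟦(1:ℤ)⟧}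
  (hT : Triangle.mk f g k ∈ distTriang C) (hY : P Y) (hZ : P Z) : P X :=
  have := h.tri; have := h.iso; P.ext_of_isTriangulatedClosed₁ _ hT hY hZ
lemma Loc.ext₂ {P : ObjectProperty C} (h : Loc P) {X Y Z : C} {f : X ⟶ Y} {g : Y ⟶ Z} {k : Z ⟶ X⟦(1:ℤ)⟧}
  (hT : Triangle.mk f g k ∈ distTriang C) (hX : P X) (hZ : P Z) : P Y :=
  have := h.tri; have := h.iso; P.ext_of_isTriangulatedClosed₂ _ hT hX hZ
lemma Loc.ext₃ {P : ObjectProperty C} (h : Loc P) {X Y Z : C} {f : X ⟶ Y} {g : Y ⟶ Z} {k : Z ⟶ X⟦(1:ℤ)⟧}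
  (hT : Triangle.mk f g k ∈ distTriang C) (hX : P X) (hY : P Y) : P Z :=
  have := h.tri; have := h.iso; P.ext_of_isTriangulatedClosed₃ _ hT hX hY
lemma Loc.of_iso {P : ObjectProperty C} (h : Loc P) {X Y : C} (e : X ≅ Y) (hX : P X) : P Y :=
  have := h.iso; P.prop_of_iso e hX
lemma Loc.shift {P : ObjectProperty C} (h : Loc P) {X : C} (hX : P X) (n : ℤ) : P (X⟦n⟧) :=
  have := h.tri; P.le_shift n _ hX
lemma Loc.zero {P : ObjectProperty C} (h : Loc P) {X : C} (hX : IsZero X) : P X :=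
  have := h.tri; have := h.iso; P.prop_of_isZero hX
lemma Loc.sigma {P : ObjectProperty C} (h : Loc P) {J : Type} (X : J → C) [HasCoproduct X] (hX : ∀ j, P (X j)) : P (∐ X) :=
  h.coprod X _ (coproductIsCoproduct X) hX

lemma Loc.retract {P : ObjectProperty C} (h : Loc P) [HasCoproductsOfShape ℕ C] {Y Z : C} (s : Y ⟶ Z) (r : Z ⟶ Y)
    (hsr : s ≫ r = 𝟙 _) (hZ : P Z) : P Y := by
  obtain ⟨e, e_def⟩ : ∃ e : Z ⟶ Z, e = r ≫ s := ⟨_, rfl⟩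
  have ee : e ≫ e = e := by simp [e_def, reassoc_of% hsr]
  have er : e ≫ r = r := by simp [e_def, hsr]
  have se : s ≫ e = s := by simp [e_def, reassoc_of% hsr]
  let F : ℕ → C := fun _ => Z
  let ι : ∀ n : ℕ, Z ⟶ ∐ F := fun n => Sigma.ι F n
  let v : ∐ F ⟶ ∐ F := Limits.Sigma.desc (fun n => e ≫ ι (n+1) + (𝟙 _ - e) ≫ ι n)
  let u : ∐ F ⟶ ∐ F := Limits.Sigma.desc (fun n => (match n with | 0 => 0 | n+1 => e ≫ ι n) + (𝟙 _ - e) ≫ ι n)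
  let t : ∐ F ⟶ Y := Limits.Sigma.desc (fun n => match n with | 0 => r | _+1 => 0)
  have hv : ∀ n, ι n ≫ v = e ≫ ι (n+1) + (𝟙 _ - e) ≫ ι n := fun n => by simp [ι, v]
  have hu0 : ι 0 ≫ u = (𝟙 _ - e) ≫ ι 0 := by simp [ι, u]
  have hu : ∀ n, ι (n+1) ≫ u = e ≫ ι n + (𝟙 _ - e) ≫ ι (n+1) := fun n => by simp [ι, u]
  have ht0 : ι 0 ≫ t = r := by simp [ι, t]
  have ht : ∀ n, ι (n+1) ≫ t = 0 := fun n => by simp [ι, t]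
  have ext : ∀ {A : C} (a b : ∐ F ⟶ A), (∀ n, ι n ≫ a = ι n ≫ b) → a = b := fun a b h => Limits.Sigma.hom_ext _ _ h
  have e0 : e ≫ (𝟙 _ - e) = 0 := by simp [ee]
  have e0' : (𝟙 _ - e) ≫ e = 0 := by simp [ee]
  have e1 : (𝟙 _ - e) ≫ (𝟙 _ - e) = 𝟙 _ - e := by simp [ee]
  have se' : s ≫ (𝟙 _ - e) = 0 := by simp [se]
  have er' : (𝟙 _ - e) ≫ r = 0 := by simp [er]
  let b : BinaryBicone (∐ F) Y :=
    { pt := ∐ F, inl := v, inr := s ≫ ι 0, fst := u, snd := t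
      inl_fst := by
        apply ext
        rintro (_|n)
        · rw [← Category.assoc, hv, Preadditive.add_comp, Category.assoc, Category.assoc, hu, hu0, Preadditive.comp_add,
            reassoc_of% ee, reassoc_of% e0, reassoc_of% e1]; simp
        · rw [← Category.assoc, hv, Preadditive.add_comp, Category.assoc, Category.assoc, hu, hu, Preadditive.comp_add,
            Preadditive.comp_add, reassoc_of% ee, reassoc_of% e0, reassoc_of% e1, reassoc_of% e0']; simp
      inr_snd := by rw [Category.assoc, ht0, hsr]
      inl_snd := by
        apply ext
        rintro (_|n)
        · rw [← Category.assoc, hv, Preadditive.add_comp, Category.assoc, Category.assoc, ht, ht0, er']; simp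
        · rw [← Category.assoc, hv, Preadditive.add_comp, Category.assoc, Category.assoc, ht, ht]; simp
      inr_fst := by rw [Category.assoc, hu0, reassoc_of% se']; simp }
  have hb : b.IsBilimit := isBinaryBilimitOfTotal b (by
    apply ext
    rintro (_|n)
    · dsimp [b]
      rw [Preadditive.comp_add, ← Category.assoc, hu0, Category.assoc, hv, reassoc_of% ht0, Preadditive.comp_add,
        reassoc_of% e0', reassoc_of% e1]
      simp [e_def]
    · dsimp [b]
      rw [Preadditive.comp_add, ← Category.assoc, hu, reassoc_of% ht, Preadditive.add_comp, Category.assoc,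
        Category.assoc, hv, hv, Preadditive.comp_add, Preadditive.comp_add,
        reassoc_of% e0', reassoc_of% e1, reassoc_of% ee, reassoc_of% e0]
      simp)
  have hF : P (∐ F) := h.sigma F fun _ => hZ
  have iso : ∐ F ≅ (∐ F) ⊞ Y := biprod.uniqueUpToIso _ _ hb
  exact h.ext₃ (binaryBiproductTriangle_distinguished (∐ F) Y) hF (h.of_iso iso hF)

end
end S16
end partC

section partD
namespace S16
variable {R : Type} [CommRing R] [HasDerivedCategory.{w} (ModuleCat.{v} R)]
open DerivedCategory

section
variable {C : Type*} [Category C] [Preadditive C] [HasZeroObject C] [HasShift C ℤ]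
  [∀ n : ℤ, (shiftFunctor C n).Additive] [Pretriangulated C] [IsTriangulated C]

lemma Loc.octa {P : ObjectProperty C} (h : Loc P) {X Y Z : C} (u : X ⟶ Y) (g : Y ⟶ Z)
    (h2 : P.trW g) (h3 : P.trW (u ≫ g)) : P.trW u := by
  obtain ⟨Z₂, v₂, w₂, hT₂, hZ₂⟩ := h2
  obtain ⟨Z₃, v₃, w₃, hT₃, hZ₃⟩ := h3
  obtain ⟨Z₁, v₁, w₁, hT₁⟩ := distinguished_cocone_triangle u
  exact ⟨Z₁, v₁, w₁, hT₁, h.ext₁ (Triangulated.someOctahedron rfl hT₁ hT₂ hT₃).mem hZ₃ hZ₂⟩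

end

lemma telescope {P : ObjectProperty (DD.{w, v} R)} (h : Loc P) (Y : ℕ → DD.{w, v} R) (f : ∀ n, Y n ⟶ Y (n+1))
    (hf : ∀ n, P.trW (f n)) (hz : ∀ i : ℤ, ∃ N, ∀ n ≥ N, IsZero ((HH.{w, v} R i).obj (Y n))) : P (Y 0) := by
  have := h.tri
  have := h.iso
  let F : ∀ n, Y 0 ⟶ Y n := fun n => Nat.rec (𝟙 _) (fun n g => g ≫ f n) n
  have F0 : F 0 = 𝟙 _ := rfl
  have FS : ∀ n, F (n+1) = F n ≫ f n := fun n => rfl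
  have hF : ∀ n, P.trW (F n) := by
    intro n
    induction n with
    | zero => rw [F0]; exact P.trW.id_mem _
    | succ n ih => rw [FS]; exact P.trW.comp_mem _ _ ih (hf n)
  let C : ℕ → DD.{w, v} R := fun _ => Y 0
  let g : ∐ C ⟶ ∐ Y := Limits.Sigma.map F
  have hg : P.trW g := by
    choose Z v w hT hZ using hF
    obtain ⟨W, a, b, hW⟩ := distinguished_cocone_triangle g
    obtain ⟨e⟩ := cone_sigma _ _ _ F v w hT W a b hW
    exact ⟨W, a, b, hW, h.of_iso e (h.sigma _ hZ)⟩
  let σ : ∐ Y ⟶ ∐ Y := Limits.Sigma.desc (fun n => f n ≫ Sigma.ι Y (n+1))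
  have hσ : ∀ n, Sigma.ι Y n ≫ σ = f n ≫ Sigma.ι Y (n+1) := fun n => by simp [σ]
  let τ : ∐ C ⟶ ∐ C := Limits.Sigma.desc (fun n => Sigma.ι C (n+1))
  have hτ : ∀ n, Sigma.ι C n ≫ τ = Sigma.ι C (n+1) := fun n => by simp [τ]
  have hiter : ∀ m n, ∃ k : Y n ⟶ Y (n+m), Sigma.ι Y n ≫ ((show End (∐ Y) from σ)^m : End (∐ Y)) = k ≫ Sigma.ι Y (n+m) := by
    intro m
    induction m with
    | zero => intro n; exact ⟨𝟙 _, by simp [End.one_def]⟩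
    | succ m ih =>
      intro n
      obtain ⟨k, hk⟩ := ih n
      refine ⟨k ≫ f (n+m), ?_⟩
      rw [pow_succ', End.mul_def, reassoc_of% hk, hσ, Category.assoc]; rfl
  have hiso : IsIso (𝟙 _ - σ) := by
    rw [DerivedCategory.isIso_iff]
    intro i
    obtain ⟨N, hN⟩ := hz i
    let T : End ((HH.{w, v} R i).obj (∐ Y)) := (HH.{w, v} R i).map σ
    have hT : T ^ N = 0 := by
      have e : T ^ N = (HH.{w, v} R i).map ((show End (∐ Y) from σ)^N : End (∐ Y)) :=
        (map_pow ((HH.{w, v} R i).mapEnd (∐ Y)) (show End (∐ Y) from σ) N).symm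
      rw [e]
      refine ModuleCat.hom_ext (LinearMap.ext fun x => ?_)
      obtain ⟨S, y, rfl⟩ := joint_surj Y _ (coproductIsCoproduct Y) i x
      rw [map_sum]
      simp only [ModuleCat.hom_zero, LinearMap.zero_apply]
      refine Finset.sum_eq_zero fun n _ => ?_
      obtain ⟨k, hk⟩ := hiter N n
      have h1 : (HH.{w, v} R i).map (Sigma.ι Y n) ≫ (HH.{w, v} R i).map ((show End (∐ Y) from σ)^N : End (∐ Y)) = 0 := by
        rw [← Functor.map_comp, hk, Functor.map_comp]
        rw [(hN (n+N) (by omega)).eq_zero_of_tgt ((HH.{w, v} R i).map k), zero_comp]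
      exact congrArg (fun q => q.hom (y n)) h1
    have := (show IsNilpotent T from ⟨N, hT⟩).isUnit_one_sub
    have := (isUnit_iff_isIso _).1 this
    rw [CategoryTheory.Functor.map_sub, CategoryTheory.Functor.map_id]
    exact this
  have hcomm : (𝟙 _ - τ) ≫ g = g ≫ (𝟙 _ - σ) := by
    ext n
    rw [Preadditive.sub_comp, Preadditive.comp_sub, Preadditive.comp_sub, Preadditive.comp_sub, reassoc_of% hτ]
    simp [g, hσ, FS, C]
  have h1 : P.trW (𝟙 _ - τ) := by
    refine h.octa _ g hg ?_
    rw [hcomm]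
    exact P.trW.comp_mem _ _ hg (P.trW_of_isIso _)
  obtain ⟨Z, v, w, hT, hZ⟩ := h1
  let D : ∐ C ⟶ Y 0 := Limits.Sigma.desc (fun n => 𝟙 _)
  have hD : ∀ n, Sigma.ι C n ≫ D = 𝟙 _ := fun n => by simp [D]
  obtain ⟨k, hk⟩ := yo2 hT D (by
    ext n
    rw [Preadditive.sub_comp, Preadditive.comp_sub, reassoc_of% hτ, hD, Category.id_comp, hD, comp_zero]; exact sub_self (𝟙 (Y 0)))
  exact h.retract (Sigma.ι C 0 ≫ v) k (by rw [Category.assoc, ← hk, hD]) hZ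

end S16
end partD

section partE
namespace S16
variable {R : Type} [CommRing R] [HasDerivedCategory.{w} (ModuleCat.{v} R)]
open DerivedCategory

noncomputable def Hshift (n a a' : ℤ) (h : n + a = a') (X : DD.{w, v} R) : (HH.{w, v} R a).obj (X⟦n⟧) ≅ (HH.{w, v} R a').obj X :=
  ((homologyFunctor (ModuleCat.{v} R) 0).shiftIso n a a' h).app X

lemma H_exact₂ {X Y Z : DD.{w, v} R} {f : X ⟶ Y} {g : Y ⟶ Z} {h : Z ⟶ X⟦(1:ℤ)⟧}
    (hT : Triangle.mk f g h ∈ distTriang (DD.{w, v} R)) (n : ℤ) :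
    Function.Exact ((HH.{w, v} R n).map f).hom ((HH.{w, v} R n).map g).hom :=
  (ShortComplex.ShortExact.moduleCat_exact_iff_function_exact _).1 (HomologySequence.exact₂ _ hT n)

lemma H_exact₁₃ {X Y Z : DD.{w, v} R} {f : X ⟶ Y} {g : Y ⟶ Z} {h : Z ⟶ X⟦(1:ℤ)⟧}
    (hT : Triangle.mk f g h ∈ distTriang (DD.{w, v} R)) (n m : ℤ) (hnm : n + 1 = m) :
    ∃ d : (HH.{w, v} R n).obj Z ⟶ (HH.{w, v} R m).obj X,
    Function.Exact ((HH.{w, v} R n).map g).hom d.hom ∧ Function.Exact d.hom ((HH.{w, v} R m).map f).hom := by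
  refine ⟨HomologySequence.δ (Triangle.mk f g h) n m hnm, ?_, ?_⟩
  · exact (ShortComplex.ShortExact.moduleCat_exact_iff_function_exact _).1 (HomologySequence.exact₃ _ hT n m hnm)
  · exact (ShortComplex.ShortExact.moduleCat_exact_iff_function_exact _).1 (HomologySequence.exact₁ _ hT n m hnm)

def SESTri (Φ : ModuleCat.{u} R ⥤ DD.{w, v} R) : Prop :=
  ∀ S : ShortComplex (ModuleCat.{u} R), S.ShortExact →
    ∃ δ : Φ.obj S.X₃ ⟶ (Φ.obj S.X₁)⟦(1:ℤ)⟧, Triangle.mk (Φ.map S.f) (Φ.map S.g) δ ∈ distTriang (DD.{w, v} R)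

lemma resolve_mem {P : ObjectProperty (DD.{w, v} R)} (h : Loc P) (Φ : ModuleCat.{u} R ⥤ DD.{w, v} R) (hΦ : SESTri Φ)
    (b : ℤ) (hb : ∀ N i, b < i → IsZero ((HH.{w, v} R i).obj (Φ.obj N))) (T : ModuleCat.{u} R → Prop)
    (hT : ∀ N, T N → ∃ (K G : ModuleCat.{u} R) (f : K ⟶ G) (g : G ⟶ N) (w : f ≫ g = 0),
      (ShortComplex.mk f g w).ShortExact ∧ T K ∧ P (Φ.obj G)) (N : ModuleCat.{u} R) (hN : T N) : P (Φ.obj N) := by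
  have := h.tri
  have := h.iso
  choose! K hK using hT
  let M : ℕ → ModuleCat.{u} R := fun n => K^[n] N
  have M0 : M 0 = N := rfl
  have MS : ∀ n, M (n+1) = K (M n) := fun n => Function.iterate_succ_apply' K n N
  have hM : ∀ n, T (M n) := by
    intro n
    induction n with
    | zero => exact hN
    | succ n ih => rw [MS]; obtain ⟨G, f, g, w, -, h', -⟩ := hK _ ih; exact h'
  have hδ : ∀ n, ∃ d : Φ.obj (M n) ⟶ (Φ.obj (M (n+1)))⟦(1:ℤ)⟧, P.trW d := by
    intro n
    rw [MS]
    obtain ⟨G, f, g, w, hS, -, hG⟩ := hK _ (hM n)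
    obtain ⟨d, hd⟩ := hΦ _ hS
    exact ⟨d, _, _, _, rot_of_distTriang _ (rot_of_distTriang _ hd), h.shift hG 1⟩
  choose d hd using hδ
  have key := telescope h (fun n => (Φ.obj (M n))⟦(n:ℤ)⟧) (fun n => (d n)⟦(n:ℤ)⟧' ≫
    ((shiftFunctorAdd' (DD.{w, v} R) (1:ℤ) (n:ℤ) ((n+1 : ℕ):ℤ) (by push_cast; ring)).app (Φ.obj (M (n+1)))).inv)
    (fun n => P.trW.comp_mem _ _ ((hd n).shift n) (P.trW_of_isIso _)) (fun i => by
      refine ⟨(b - i + 1).toNat, fun n hn => ?_⟩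
      refine IsZero.of_iso (hb (M n) (n + i) (by omega)) (Hshift n i (n+i) rfl _))
  exact h.of_iso ((shiftFunctorZero (DD.{w, v} R) ℤ).app (Φ.obj N)) key

end S16
end partE

section partF
namespace S16
variable {R : Type} [CommRing R] [HasDerivedCategory.{w} (ModuleCat.{v} R)]
open DerivedCategory

lemma isZero_subs {M : ModuleCat.{v} R} (h : IsZero M) : Subsingleton M := ModuleCat.subsingleton_of_isZero h

noncomputable def Hsingle (n : ℤ) (N : ModuleCat.{v} R) :
    (HH.{w, v} R n).obj ((singleFunctor (ModuleCat.{v} R) n).obj N) ≅ N :=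
  (HH.{w, v} R n).mapIso ((singleFunctorIsoCompQ (ModuleCat.{v} R) n).app N) ≪≫ Hη n _ ≪≫
    (HomologicalComplex.homologyFunctorSingleIso (ModuleCat.{v} R) (ComplexShape.up ℤ) n).app N

lemma bij_iso {M N : ModuleCat.{v} R} (f : M ⟶ N) (hi : Function.Injective f.hom) (hs : Function.Surjective f.hom) :
    Nonempty (M ≅ N) := ⟨(LinearEquiv.ofBijective f.hom ⟨hi, hs⟩).toModuleIso⟩

lemma devissage (S : Set (DD.{w, v} R)) (hiso : ∀ X Y : DD.{w, v} R, (X ≅ Y) → X ∈ S → Y ∈ S)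
    (hext : ∀ (X Y Z : DD.{w, v} R) (f : X ⟶ Y) (g : Y ⟶ Z) (h : Z ⟶ X⟦(1 : ℤ)⟧),
      (Triangle.mk f g h ∈ distTriang (DD.{w, v} R)) → X ∈ S → Z ∈ S → Y ∈ S) (k : ℕ) :
    ∀ (a : ℤ) (M : DD.{w, v} R), M.IsGE a → M.IsLE (a + k) →
      (∀ n, (singleFunctor (ModuleCat.{v} R) n).obj ((HH.{w, v} R n).obj M) ∈ S) → M ∈ S := by
  induction k with
  | zero =>
    intro a M h1 h2 h
    have : M.IsLE a := by simpa using h2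
    obtain ⟨N, ⟨e⟩⟩ := M.exists_iso_singleFunctor_obj_of_isGE_of_isLE a
    exact hiso _ _ ((singleFunctor _ a).mapIso ((HH.{w, v} R a).mapIso e ≪≫ Hsingle a N) ≪≫ e.symm) (h a)
  | succ k ih =>
    intro a M h1 h2 h
    obtain ⟨X, Z, hX, hZ, f, g, d, hT⟩ := (TStructure.t (C := ModuleCat.{v} R)).exists_triangle M a (a+1) rfl
    have hX : X.IsLE a := ⟨hX⟩
    have hZ : Z.IsGE (a+1) := ⟨hZ⟩
    rw [isGE_iff] at h1 hZ
    rw [isLE_iff] at h2 hX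
    have e2 := fun n => H_exact₂ hT n
    have e3 := fun n => H_exact₁₃ hT n (n+1) rfl
    have hX' : ∀ i, i < a → IsZero ((HH.{w, v} R i).obj X) := by
      intro i hi
      obtain ⟨d, -, hd⟩ := H_exact₁₃ hT (i-1) i (by ring)
      have := isZero_subs (hZ (i-1) (by omega))
      have := isZero_subs (h1 i (by omega))
      have : Subsingleton ((HH.{w, v} R i).obj X) := ⟨fun x y => by
        obtain ⟨u, rfl⟩ := (hd x).1 (Subsingleton.elim _ _)
        obtain ⟨v, rfl⟩ := (hd y).1 (Subsingleton.elim _ _)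
        rw [Subsingleton.elim u v]⟩
      exact ModuleCat.isZero_of_subsingleton _
    have eX : Nonempty ((HH.{w, v} R a).obj X ≅ (HH.{w, v} R a).obj M) := by
      refine bij_iso ((HH.{w, v} R a).map f) ?_ ?_
      · obtain ⟨d, -, hd⟩ := H_exact₁₃ hT (a-1) a (by ring)
        have := isZero_subs (hZ (a-1) (by omega))
        rw [injective_iff_map_eq_zero]
        intro x hx
        obtain ⟨u, rfl⟩ := (hd x).1 hx
        rw [Subsingleton.elim u 0, map_zero]
      · have := isZero_subs (hZ a (by omega))
        intro y
        exact (H_exact₂ hT a y).1 (Subsingleton.elim _ _)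
    have eZ : ∀ i, a < i → Nonempty ((HH.{w, v} R i).obj M ≅ (HH.{w, v} R i).obj Z) := by
      intro i hi
      refine bij_iso ((HH.{w, v} R i).map g) ?_ ?_
      · have := isZero_subs (hX i hi)
        rw [injective_iff_map_eq_zero]
        intro x hx
        obtain ⟨u, rfl⟩ := (H_exact₂ hT i x).1 hx
        rw [Subsingleton.elim u 0, map_zero]
      · obtain ⟨d, hd, -⟩ := H_exact₁₃ hT i (i+1) (by ring)
        have := isZero_subs (hX (i+1) (by omega))
        intro y
        exact (hd y).1 (Subsingleton.elim _ _)
    have hXS : X ∈ S := by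
      have i1 : X.IsLE a := by rw [isLE_iff]; exact hX
      have i2 : X.IsGE a := by rw [isGE_iff]; exact hX'
      obtain ⟨N, ⟨e⟩⟩ := X.exists_iso_singleFunctor_obj_of_isGE_of_isLE a
      exact hiso _ _ ((singleFunctor _ a).mapIso (eX.some.symm ≪≫ (HH.{w, v} R a).mapIso e ≪≫ Hsingle a N) ≪≫ e.symm) (h a)
    have hzS : ∀ Y : DD.{w, v} R, IsZero Y → Y ∈ S := by
      intro Y hY
      refine hiso _ _ (?_ : (singleFunctor _ (a-1)).obj ((HH.{w, v} R (a-1)).obj M) ≅ Y) (h (a-1))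
      exact ((singleFunctor (ModuleCat.{v} R) (a-1)).map_isZero (h1 _ (by omega))).iso hY
    refine hext X M Z f g d hT hXS (ih (a+1) Z ?_ ?_ ?_)
    · rw [isGE_iff]; exact hZ
    · rw [isLE_iff]; intro i hi
      exact (h2 i (by push_cast; omega)).of_iso (eZ i (by omega)).some.symm
    · intro n
      by_cases hn : a < n
      · exact hiso _ _ ((singleFunctor _ n).mapIso (eZ n hn).some) (h n)
      · exact hzS _ ((singleFunctor (ModuleCat.{v} R) n).map_isZero (hZ n (by omega)))

end S16
end partF

section partG
namespace S16
variable {R : Type} [CommRing R] [HasDerivedCategory.{w} (ModuleCat.{v} R)]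
open DerivedCategory

def HasPR (X : DD.{w, v} R) : Prop := ∃ (P : Cpx.{v} R) (b : ℤ), P.IsStrictlyLE b ∧ (∀ n, Projective (P.X n)) ∧ Nonempty (X ≅ Q.obj P)

lemma HasPR.of_iso {X Y : DD.{w, v} R} (e : X ≅ Y) (h : HasPR X) : HasPR Y := by
  obtain ⟨P, b, h1, h2, ⟨i⟩⟩ := h
  exact ⟨P, b, h1, h2, ⟨e.symm ≪≫ i⟩⟩

lemma HasPR.shift {X : DD.{w, v} R} (h : HasPR X) (n : ℤ) : HasPR (X⟦n⟧) := by
  obtain ⟨P, b, h1, h2, ⟨i⟩⟩ := h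
  refine ⟨P⟦n⟧, b - n, P.isStrictlyLE_shift b n _ (by ring), fun k => h2 (k + n), ⟨?_⟩⟩
  exact (shiftFunctor _ n).mapIso i ≪≫ (Q.commShiftIso n).symm.app P

lemma cone_proj {P P' : Cpx.{v} R} (φ : P ⟶ P') (h : ∀ n, Projective (P.X n)) (h' : ∀ n, Projective (P'.X n)) (n : ℤ) :
    Projective ((CochainComplex.mappingCone φ).X n) := by
  have := h (n+1)
  have := h' n
  exact Projective.of_iso (HomologicalComplex.homotopyCofiber.XIsoBiprod φ n (n+1) rfl).symm inferInstance

lemma cone_LE {P P' : Cpx.{v} R} (φ : P ⟶ P') (b : ℤ) (h : P.IsStrictlyLE b) (h' : P'.IsStrictlyLE b) :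
    (CochainComplex.mappingCone φ).IsStrictlyLE b := by
  rw [CochainComplex.isStrictlyLE_iff]
  intro i hi
  rw [CochainComplex.mappingCone.isZero_X_iff]
  exact ⟨P.isZero_of_isStrictlyLE b _ (by omega), P'.isZero_of_isStrictlyLE b _ (by omega)⟩

lemma Q_full {P L : Cpx.{v} R} (b : ℤ) (h : P.IsStrictlyLE b) (h' : ∀ n, Projective (P.X n)) (f : Q.obj P ⟶ Q.obj L) :
    ∃ φ : P ⟶ L, Q.map φ = f := by
  have : P.IsKProjective := P.isKProjective_of_projective b
  obtain ⟨g, hg⟩ := (CochainComplex.IsKProjective.Qh_map_bijective P ((HomotopyCategory.quotient _ _).obj L)).surjective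
    ((quotientCompQhIso _).hom.app P ≫ f ≫ (quotientCompQhIso _).inv.app L)
  obtain ⟨φ, rfl⟩ := (HomotopyCategory.quotient _ _).map_surjective g
  refine ⟨φ, ?_⟩
  rw [← cancel_epi ((quotientCompQhIso _).hom.app P), ← (quotientCompQhIso (ModuleCat.{v} R)).hom.naturality]
  simp only [Functor.comp_map]
  rw [hg]
  simp

lemma HasPR.ext {X Y Z : DD.{w, v} R} (f : X ⟶ Y) (g : Y ⟶ Z) (h : Z ⟶ X⟦(1 : ℤ)⟧)
     (hT : Triangle.mk f g h ∈ distTriang (DD.{w, v} R)) (hX : HasPR X) (hZ : HasPR Z) : HasPR Y := by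
  have hT' := inv_rot_of_distTriang _ hT
  obtain ⟨P, b, h1, h2, ⟨i⟩⟩ := hX
  obtain ⟨P', b', h1', h2', ⟨i'⟩⟩ := hZ.shift (-1)
  obtain ⟨φ, hφ⟩ := Q_full b' h1' h2' (i'.inv ≫ (Triangle.mk f g h).invRotate.mor₁ ≫ i.hom)
  have hT2 := mappingCone_triangle_distinguished φ
  obtain ⟨e, -⟩ := exists_iso_of_arrow_iso _ _ hT' hT2 (Arrow.isoMk i' i (by
    change i'.hom ≫ Q.map φ = (Triangle.mk f g h).invRotate.mor₁ ≫ i.hom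
    rw [hφ]; exact Iso.hom_inv_id_assoc i' _))
  refine ⟨CochainComplex.mappingCone φ, max b b', cone_LE φ _ ?_ ?_, cone_proj φ h2' h2, ⟨Triangle.π₃.mapIso e⟩⟩
  · exact P'.isStrictlyLE_of_le _ _ (le_max_right _ _)
  · exact P.isStrictlyLE_of_le _ _ (le_max_left _ _)

lemma HasPR.single (n : ℤ) (N : ModuleCat.{v} R) : HasPR ((singleFunctor (ModuleCat.{v} R) n).obj N) := by
  let r := projectiveResolution N
  have h0 : HasPR ((singleFunctor (ModuleCat.{v} R) 0).obj N) :=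
    ⟨r.cochainComplex, 0, inferInstance, inferInstance, ⟨(singleFunctorIsoCompQ (ModuleCat.{v} R) 0).app N ≪≫ 
      (asIso (Q.map r.π')).symm⟩⟩
  refine HasPR.of_iso ?_ (h0.shift (-n))
  exact ((singleFunctors (ModuleCat.{v} R)).shiftIso (-n) n 0 (by ring)).app N

lemma HasPR.of_bdd (a b : ℤ) (M : DD.{w, v} R) (h1 : M.IsGE a) (h2 : M.IsLE b) : HasPR M := by
  refine devissage {X | HasPR X} (fun X Y e h => HasPR.of_iso e h) (fun X Y Z f g h hT => HasPR.ext f g h hT)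
    (b - a).toNat a M h1 ?_ (fun n => HasPR.single n _)
  rw [isLE_iff] at h2 ⊢
  intro i hi
  exact h2 i (by omega)

end S16
end partG

section partH
namespace S16
set_option linter.unusedSectionVars false
variable {R : Type} [CommRing R] [HasDerivedCategory.{w} (ModuleCat.{v} R)]
open DerivedCategory
open scoped TensorProduct

lemma coprod_crit {J : Type} (K : J → Cpx.{v} R) (L : Cpx.{v} R) (i : ∀ j, K j ⟶ L)
    (hp : ∀ n, ∃ p : ∀ j, L.X n ⟶ (K j).X n, (∀ j, (i j).f n ≫ p j = 𝟙 _) ∧ ∀ j k, j ≠ k → (i j).f n ≫ p k = 0)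
    (hs : ∀ n (x : L.X n), ∃ (S : Finset J) (y : ∀ j, (K j).X n), x = ∑ j ∈ S, ((i j).f n).hom (y j)) :
    Nonempty (IsColimit (Cofan.mk (Q.obj L) (fun j => Q.map (i j)))) := by
  classical
  have hf : ∀ j, Sigma.ι K j ≫ Sigma.desc i = i j := fun j => by simp
  have hf' : ∀ j n, (Sigma.ι K j).f n ≫ (Sigma.desc i).f n = (i j).f n := fun j n => by
    rw [← HomologicalComplex.comp_f, hf]
  have hiso : ∀ n, IsIso ((Sigma.desc i).f n) := by
    intro n
    have h1 : Mono ((Sigma.desc i).f n) := by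
      rw [ModuleCat.mono_iff_injective]
      change Function.Injective ((Sigma.desc i).f n).hom
      rw [injective_iff_map_eq_zero]
      intro z hz
      obtain ⟨p, hp1, hp2⟩ := hp n
      have hpk : ∀ k, (Sigma.desc i).f n ≫ p k = (Sigma.π K k).f n := by
        intro k
        refine eval_ext K n _ _ fun j => ?_
        rw [← Category.assoc, hf', ← HomologicalComplex.comp_f]
        by_cases hjk : j = k
        · subst hjk; rw [hp1]; simp
        · rw [hp2 _ _ hjk, Sigma.ι_π_of_ne _ hjk]; rfl
      obtain ⟨S, hS⟩ := X_coprod K n z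
      rw [hS]
      refine Finset.sum_eq_zero fun j _ => ?_
      have : ((Sigma.π K j).f n).hom z = 0 := by
        rw [← hpk, ModuleCat.hom_comp, LinearMap.comp_apply, hz, map_zero]
      rw [HomologicalComplex.comp_f, ModuleCat.hom_comp, LinearMap.comp_apply, this, map_zero]
    have h2 : Epi ((Sigma.desc i).f n) := by
      rw [ModuleCat.epi_iff_surjective]
      intro x
      obtain ⟨S, y, rfl⟩ := hs n x
      refine ⟨∑ j ∈ S, ((Sigma.ι K j).f n).hom (y j), ?_⟩
      change ((Sigma.desc i).f n).hom _ = _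
      rw [map_sum]
      refine Finset.sum_congr rfl fun j _ => ?_
      rw [← hf', ModuleCat.hom_comp, LinearMap.comp_apply]
    exact isIso_of_mono_of_epi _
  have : IsIso (Sigma.desc i) := HomologicalComplex.Hom.isIso_of_components _
  obtain ⟨hc⟩ := Q_coprod K
  refine ⟨IsColimit.ofIsoColimit hc (Cofan.ext (Q.mapIso (asIso (Sigma.desc i))) fun j => ?_)⟩
  change Q.map _ ≫ Q.map _ = Q.map _
  rw [← Q.map_comp]
  exact congrArg (fun f => Q.map f) (hf j)

lemma Φ_shape (P : Cpx.{v} R) (N : ModuleCat.{0} R) (i j : ℤ) (h : ¬ (ComplexShape.up ℤ).Rel i j) :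
    (P.d i j).hom.lTensor N = 0 := by
  rw [P.shape i j h, ModuleCat.hom_zero, LinearMap.lTensor_zero]

lemma Φ_dd (P : Cpx.{v} R) (N : ModuleCat.{0} R) (i j k : ℤ) :
    ((P.d j k).hom.lTensor N).comp ((P.d i j).hom.lTensor N) = 0 := by
  rw [← LinearMap.lTensor_comp, ← ModuleCat.hom_comp, P.d_comp_d, ModuleCat.hom_zero, LinearMap.lTensor_zero]

noncomputable def ΦO (P : Cpx.{v} R) (N : ModuleCat.{0} R) : Cpx.{v} R where
  X := fun i => ModuleCat.of R (N ⊗[R] P.X i)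
  d := fun i j => ModuleCat.ofHom ((P.d i j).hom.lTensor N)
  shape := fun _ _ h => ModuleCat.hom_ext (Φ_shape P N _ _ h)
  d_comp_d' := fun i j k _ _ => ModuleCat.hom_ext (Φ_dd P N i j k)

noncomputable def ΦM (P : Cpx.{v} R) {N N' : ModuleCat.{0} R} (f : N ⟶ N') : ΦO P N ⟶ ΦO P N' where
  f := fun i => ModuleCat.ofHom (f.hom.rTensor (P.X i))
  comm' := fun i j _ => ModuleCat.hom_ext
    ((LinearMap.lTensor_comp_rTensor _ _ _).trans (LinearMap.rTensor_comp_lTensor _ _ _).symm)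

noncomputable def ΦC (P : Cpx.{v} R) : ModuleCat.{0} R ⥤ Cpx.{v} R where
  obj N := ΦO P N
  map f := ΦM P f
  map_id N := by
    ext i : 1
    exact ModuleCat.hom_ext (LinearMap.rTensor_id _ _)
  map_comp f g := by
    ext i : 1
    exact ModuleCat.hom_ext (LinearMap.rTensor_comp _ _ _)

noncomputable abbrev ΦD (P : Cpx.{v} R) : ModuleCat.{0} R ⥤ DD.{w, v} R := ΦC P ⋙ Q

omit [HasDerivedCategory.{w} (ModuleCat.{v} R)] in
lemma ses_fun {S : ShortComplex (ModuleCat.{u} R)} (hi : Function.Injective S.f.hom) (hs : Function.Surjective S.g.hom)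
    (he : Function.Exact S.f.hom S.g.hom) : S.ShortExact :=
  { exact := (ShortComplex.ShortExact.moduleCat_exact_iff_function_exact S).2 he
    mono_f := (ModuleCat.mono_iff_injective _).2 hi
    epi_g := (ModuleCat.epi_iff_surjective _).2 hs }

lemma ses_tri {S : ShortComplex (Cpx.{v} R)} (h : ∀ i, (S.map (HomologicalComplex.eval _ _ i)).ShortExact) :
    ∃ δ, Triangle.mk (Q.map S.f) (Q.map S.g) δ ∈ distTriang (DD.{w, v} R) :=
  ⟨_, triangleOfSES_distinguished (HomologicalComplex.shortExact_of_degreewise_shortExact S h)⟩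

omit [HasDerivedCategory.{w} (ModuleCat.{v} R)] in
lemma fun_ses {S : ShortComplex (ModuleCat.{u} R)} (h : S.ShortExact) : Function.Injective S.f.hom ∧ Function.Surjective S.g.hom
    ∧ Function.Exact S.f.hom S.g.hom :=
  ⟨(ModuleCat.mono_iff_injective _).1 h.mono_f, (ModuleCat.epi_iff_surjective _).1 h.epi_g,
   (ShortComplex.ShortExact.moduleCat_exact_iff_function_exact S).1 h.exact⟩

lemma ΦD_SES (P : Cpx.{v} R) (hP : ∀ n, Projective (P.X n)) : SESTri (ΦD P) := by
  intro S hS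
  obtain ⟨hi, hs, he⟩ := fun_ses hS
  refine ses_tri (S := ShortComplex.mk ((ΦC P).map S.f) ((ΦC P).map S.g) ?_) fun i => ?_
  · rw [← Functor.map_comp, S.zero]
    ext i : 1
    exact ModuleCat.hom_ext (LinearMap.rTensor_zero _)
  have : Module.Projective R (P.X i) := (IsProjective.iff_projective (P.X i)).2 (hP i)
  exact ses_fun (Module.Flat.rTensor_preserves_injective_linearMap _ hi) (LinearMap.rTensor_surjective _ hs)
    (rTensor_exact _ he hs)

end S16
end partH

section partI
namespace S16
set_option linter.unusedSectionVars false
variable {R : Type} [CommRing R] [HasDerivedCategory.{w} (ModuleCat.{v} R)]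
open DerivedCategory
open scoped TensorProduct

lemma coprod_crit' {J : Type} (K : J → Cpx.{v} R) (L : Cpx.{v} R) (i : ∀ j, K j ⟶ L)
    (hp : ∀ n, ∃ p : ∀ j, L.X n ⟶ (K j).X n, (∀ j, (i j).f n ≫ p j = 𝟙 _) ∧ ∀ j k, j ≠ k → (i j).f n ≫ p k = 0)
    (hs : ∀ n, ⨆ j, LinearMap.range ((i j).f n).hom = ⊤) :
    Nonempty (IsColimit (Cofan.mk (Q.obj L) (fun j => Q.map (i j)))) := by
  classical
  refine coprod_crit K L i hp fun n x => ?_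
  have hx : x ∈ ⨆ j, LinearMap.range ((i j).f n).hom := by rw [hs]; trivial
  rw [Submodule.mem_iSup_iff_exists_finsupp] at hx
  obtain ⟨f, hf, rfl⟩ := hx
  choose y hy using hf
  exact ⟨f.support, y, Finset.sum_congr rfl fun j _ => (hy j).symm⟩

noncomputable abbrev mR (R : Type) [CommRing R] : ModuleCat.{0} R := ModuleCat.of R R
noncomputable abbrev mF (R : Type) [CommRing R] (J : Type) : ModuleCat.{0} R := ModuleCat.of R (J →₀ R)
noncomputable abbrev mI {J : Type} (j : J) : mR R ⟶ mF R J := ModuleCat.ofHom (Finsupp.lsingle j)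

lemma pure1 {J : Type} (j : J) (M : Type v) [AddCommGroup M] [Module R M] :
    (Finsupp.lapply j : (J →₀ R) →ₗ[R] R).rTensor M ∘ₗ (Finsupp.lsingle j : R →ₗ[R] (J →₀ R)).rTensor M = LinearMap.id := by
  rw [← LinearMap.rTensor_comp, ← LinearMap.rTensor_id]
  congr 1
  ext; simp

lemma pure2 {J : Type} {j k : J} (hjk : j ≠ k) (M : Type v) [AddCommGroup M] [Module R M] :
    (Finsupp.lapply k : (J →₀ R) →ₗ[R] R).rTensor M ∘ₗ (Finsupp.lsingle j : R →ₗ[R] (J →₀ R)).rTensor M = 0 := by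
  rw [← LinearMap.rTensor_comp, ← LinearMap.rTensor_zero]
  congr 1
  ext; simp [hjk]

lemma pure3 {J : Type} (M : Type v) [AddCommGroup M] [Module R M] (x : (J →₀ R) ⊗[R] M) :
    x ∈ (⨆ j : J, LinearMap.range ((Finsupp.lsingle j : R →ₗ[R] (J →₀ R)).rTensor M)) := by
  induction x using TensorProduct.induction_on with
  | zero => exact Submodule.zero_mem _
  | add x y hx hy => exact Submodule.add_mem _ hx hy
  | tmul f m =>
    induction f using Finsupp.induction_linear with
    | zero => rw [TensorProduct.zero_tmul]; exact Submodule.zero_mem _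
    | add f g hf hg => rw [TensorProduct.add_tmul]; exact Submodule.add_mem _ hf hg
    | single j r => exact Submodule.mem_iSup_of_mem j ⟨r ⊗ₜ m, by simp⟩

lemma Φ_free (P : Cpx.{v} R) (J : Type) :
    Nonempty (IsColimit (Cofan.mk ((ΦD P).obj (mF R J)) (fun j : J => (ΦD P).map (mI j)))) := by
  classical
  refine coprod_crit' (fun _ : J => ΦO P (mR R)) (ΦO P (mF R J)) (fun j => ΦM P (mI j)) (fun n => ?_) (fun n => ?_)
  · refine ⟨fun j => ModuleCat.ofHom ((Finsupp.lapply j : (J →₀ R) →ₗ[R] R).rTensor (P.X n)), fun j => ?_, fun j k hjk => ?_⟩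
    · exact ModuleCat.hom_ext (pure1 j (P.X n))
    · exact ModuleCat.hom_ext (pure2 hjk (P.X n))
  · rw [eq_top_iff]
    rintro x -
    exact pure3 (P.X n) x

lemma Φ_R (P : Cpx.{v} R) : Nonempty ((ΦD P).obj (mR R) ≅ Q.obj P) := by
  refine ⟨Q.mapIso (HomologicalComplex.Hom.isoOfComponents (fun n => (TensorProduct.lid R (P.X n)).toModuleIso) ?_)⟩
  intro i j _
  refine ModuleCat.hom_ext ?_
  change (P.d i j).hom ∘ₗ (TensorProduct.lid R (P.X i)).toLinearMap = (TensorProduct.lid R (P.X j)).toLinearMap ∘ₗ (P.d i j).hom.lTensor R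
  refine TensorProduct.ext' fun r m => ?_
  simp

lemma Φ_above (P : Cpx.{v} R) (b : ℤ) (hb : P.IsStrictlyLE b) (N : ModuleCat.{0} R) (i : ℤ) (hi : b < i) :
    IsZero ((HH.{w, v} R i).obj ((ΦD P).obj N)) := by
  refine IsZero.of_iso ?_ (Hη i (ΦO P N))
  have h0 : Subsingleton (P.X i) := isZero_subs (P.isZero_of_isStrictlyLE b i hi)
  have : IsZero ((ΦO P N).X i) := by
    have : Subsingleton ((ΦO P N).X i) := by
      change Subsingleton (N ⊗[R] P.X i)
      infer_instance
    exact ModuleCat.isZero_of_subsingleton _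
  exact (HomologicalComplex.ExactAt.of_isZero this).isZero_homology

noncomputable abbrev mK (N : ModuleCat.{0} R) : ModuleCat.{0} R := ModuleCat.of R (LinearMap.ker (Finsupp.linearCombination R (id : N → N)))
noncomputable def mKi (N : ModuleCat.{0} R) : mK N ⟶ mF R N := ModuleCat.ofHom (LinearMap.ker (Finsupp.linearCombination R (id : N → N))).subtype
noncomputable def mFp (N : ModuleCat.{0} R) : mF R N ⟶ N := ModuleCat.ofHom (Finsupp.linearCombination R (id : N → N))
omit [HasDerivedCategory.{w} (ModuleCat.{v} R)] in
lemma mKi_mFp (N : ModuleCat.{0} R) : mKi N ≫ mFp N = 0 := ModuleCat.hom_ext (LinearMap.ext fun x => x.2)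

omit [HasDerivedCategory.{w} (ModuleCat.{v} R)] in
lemma free_se (N : ModuleCat.{0} R) : (ShortComplex.mk (mKi N) (mFp N) (mKi_mFp N)).ShortExact :=
  ses_fun (Submodule.injective_subtype _) (Finsupp.linearCombination_id_surjective R N)
    (LinearMap.exact_subtype_ker_map (Finsupp.linearCombination R (id : N → N)))

lemma SESTri.unb {Φ : ModuleCat.{u} R ⥤ DD.{w, v} R} (h : SESTri Φ) {A B C : ModuleCat.{u} R} {f : A ⟶ B} {g : B ⟶ C} {w : f ≫ g = 0}
    (hS : (ShortComplex.mk f g w).ShortExact) : ∃ δ : Φ.obj C ⟶ (Φ.obj A)⟦(1:ℤ)⟧, Triangle.mk (Φ.map f) (Φ.map g) δ ∈ distTriang (DD.{w, v} R) :=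
  h _ hS

lemma Φ_mem {U : ObjectProperty (DD.{w, v} R)} (h : Loc U) (P : Cpx.{v} R) (b : ℤ) (hb : P.IsStrictlyLE b)
    (hP : ∀ n, Projective (P.X n)) (hU : U (Q.obj P)) (N : ModuleCat.{0} R) : U ((ΦD P).obj N) := by
  refine resolve_mem h (ΦD P) (ΦD_SES P hP) b (fun N i hi => Φ_above P b hb N i hi) (fun _ => True) (fun N _ => ?_) N trivial
  refine ⟨_, _, mKi N, mFp N, mKi_mFp N, free_se N, trivial, ?_⟩
  exact h.coprod _ _ (Φ_free P N).some (fun j => h.of_iso (Φ_R P).some.symm hU)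

end S16
end partI

section partJ
namespace S16
set_option linter.unusedSectionVars false
section nl
variable {R : Type} [CommRing R]
open scoped TensorProduct
def Nl (p : Ideal R) (N : Type*) [AddCommGroup N] [Module R N] : Prop := ∀ m : N, ∃ r ∉ p, r • m = 0

section
variable {p : Ideal R} {M N L : Type*} [AddCommGroup M] [Module R M] [AddCommGroup N] [Module R N] [AddCommGroup L] [Module R L]

lemma Nl.exact [hp : p.IsPrime] {f : M →ₗ[R] N} {g : N →ₗ[R] L} (h : Function.Exact f g) (hM : Nl p M) (hL : Nl p L) : Nl p N := by
  intro n
  obtain ⟨r, hr, h1⟩ := hL (g n)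
  rw [← map_smul] at h1
  obtain ⟨m, hm⟩ := (h _).1 h1
  obtain ⟨s, hs, h2⟩ := hM m
  exact ⟨s * r, fun h => (hp.mem_or_mem h).elim hs hr, by rw [mul_smul, ← hm, ← map_smul, h2, map_zero]⟩

lemma Nl.inj {f : M →ₗ[R] N} (hf : Function.Injective f) (h : Nl p N) : Nl p M := fun m => by
  obtain ⟨r, hr, h1⟩ := h (f m)
  exact ⟨r, hr, hf (by rw [map_smul, h1, map_zero])⟩

lemma Nl.surj {f : M →ₗ[R] N} (hf : Function.Surjective f) (h : Nl p M) : Nl p N := fun n => by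
  obtain ⟨m, rfl⟩ := hf n
  obtain ⟨r, hr, h1⟩ := h m
  exact ⟨r, hr, by rw [← map_smul, h1, map_zero]⟩

lemma Nl.sub [hp : p.IsPrime] [Subsingleton M] : Nl p M := fun m => ⟨1, hp.one_notMem, Subsingleton.elim _ _⟩

lemma Nl.add [hp : p.IsPrime] {m m' : M} (h : ∃ r ∉ p, r • m = 0) (h' : ∃ r ∉ p, r • m' = 0) : ∃ r ∉ p, r • (m + m') = 0 := by
  obtain ⟨r, hr, h1⟩ := h
  obtain ⟨s, hs, h2⟩ := h'
  exact ⟨s * r, fun h => (hp.mem_or_mem h).elim hs hr, by rw [smul_add, mul_smul, h1, mul_comm, mul_smul, h2]; simp⟩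

lemma Nl.sum [hp : p.IsPrime] {J : Type} (S : Finset J) (m : J → M) (h : ∀ j, ∃ r ∉ p, r • m j = 0) : ∃ r ∉ p, r • (∑ j ∈ S, m j) = 0 := by
  classical
  induction S using Finset.induction_on with
  | empty => exact ⟨1, hp.one_notMem, by simp⟩
  | insert a S ha ih => rw [Finset.sum_insert ha]; exact Nl.add (h a) ih

lemma Nl.tensor [hp : p.IsPrime] (h : Nl p M) : Nl p (M ⊗[R] N) := by
  intro x
  induction x using TensorProduct.induction_on with
  | zero => exact ⟨1, hp.one_notMem, by simp⟩
  | add x y hx hy => exact Nl.add hx hy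
  | tmul m n =>
    obtain ⟨r, hr, h1⟩ := h m
    exact ⟨r, hr, by rw [TensorProduct.smul_tmul', h1, TensorProduct.zero_tmul]⟩
end

lemma Nl.iso {p : Ideal R} {M N : ModuleCat.{v} R} (e : M ≅ N) (h : Nl p M) : Nl p N :=
  Nl.surj (f := e.hom.hom) ((ModuleCat.epi_iff_surjective _).1 inferInstance) h

end nl

variable {R : Type} [CommRing R] [HasDerivedCategory.{w} (ModuleCat.{v} R)]
open DerivedCategory
open scoped TensorProduct

lemma hsmul {K : Cpx.{v} R} (f : K ⟶ K) (n : ℤ) (x : R) (hf : ∀ z, (f.f n).hom z = x • z) (y : K.homology n) :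
    (HomologicalComplex.homologyMap f n).hom y = x • y := by
  have hepi : Function.Surjective (K.homologyπ n).hom :=
    (ModuleCat.epi_iff_surjective _).1 inferInstance
  have hmono : Function.Injective (K.iCycles n).hom :=
    (ModuleCat.mono_iff_injective _).1 inferInstance
  obtain ⟨c, rfl⟩ := hepi y
  have h1 : (HomologicalComplex.cyclesMap f n).hom c = x • c := by
    apply hmono
    have := congrArg (fun g => g.hom c) (HomologicalComplex.cyclesMap_i f n)
    simp only [ModuleCat.hom_comp, LinearMap.comp_apply] at this
    rw [this, hf, map_smul]
  have := congrArg (fun g => g.hom c) (HomologicalComplex.homologyπ_naturality f n)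
  simp only [ModuleCat.hom_comp, LinearMap.comp_apply] at this
  rw [this, h1, map_smul]

lemma Hsmul {K : Cpx.{v} R} (f : K ⟶ K) (n : ℤ) (x : R) (hf : ∀ z, (f.f n).hom z = x • z) (y : (HH.{w, v} R n).obj (Q.obj K)) :
    ((HH.{w, v} R n).map (Q.map f)).hom y = x • y := by
  have h1 := congrArg (fun g => g.hom y) (Hη_nat n f)
  simp only [ModuleCat.hom_comp, LinearMap.comp_apply] at h1
  have hinj : Function.Injective (Hη n K).hom.hom := (ModuleCat.mono_iff_injective _).1 inferInstance
  apply hinj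
  rw [map_smul, h1, hsmul _ _ x hf]

lemma HΦ_smul (P : Cpx.{v} R) (g : mR R ⟶ mR R) (x : R) (hg : g.hom = x • LinearMap.id) (n : ℤ) (y : (HH.{w, v} R n).obj ((ΦD P).obj (mR R))) :
    ((HH.{w, v} R n).map ((ΦD P).map g)).hom y = x • y := by
  refine Hsmul (ΦM P g) n x (fun z => ?_) y
  change (g.hom.rTensor (P.X n)) z = x • z
  rw [hg, LinearMap.rTensor_smul, LinearMap.rTensor_id]; rfl

lemma Nl.coprod {p : Ideal R} [hp : p.IsPrime] {J : Type} (X : J → DD.{w, v} R) (c : Cofan X) (hc : IsColimit c) (n : ℤ)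
    (h : ∀ j, Nl p ((HH.{w, v} R n).obj (X j))) : Nl p ((HH.{w, v} R n).obj c.pt) := by
  intro x
  obtain ⟨S, y, rfl⟩ := joint_surj X c hc n x
  refine Nl.sum S _ fun j => ?_
  obtain ⟨r, hr, h1⟩ := h j (y j)
  exact ⟨r, hr, by rw [← map_smul, h1, map_zero]⟩

lemma Nl.homology {p : Ideal R} (K : Cpx.{v} R) (n : ℤ) (h : Nl p (K.X n)) : Nl p ((HH.{w, v} R n).obj (Q.obj K)) := by
  have hepi : Function.Surjective (K.homologyπ n).hom :=
    (ModuleCat.epi_iff_surjective _).1 inferInstance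
  have hmono : Function.Injective (K.iCycles n).hom :=
    (ModuleCat.mono_iff_injective _).1 inferInstance
  exact Nl.iso (Hη n K).symm (Nl.surj hepi (Nl.inj hmono h))

section steps
variable {p : Ideal R} [hp : p.IsPrime] (P : Cpx.{v} R) (b : ℤ) (hb : P.IsStrictlyLE b) (hP : ∀ n, Projective (P.X n))
  (j : ℤ) (hj : ∀ i, j < i → Nl p ((HH.{w, v} R i).obj (Q.obj P)))
include hb hP hj

lemma step1 (k : ℕ) : ∀ (N : ModuleCat.{0} R) (i : ℤ), j < i → b - k < i → Nl p ((HH.{w, v} R i).obj ((ΦD P).obj N)) := by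
  induction k with
  | zero =>
    intro N i _ hi
    have := isZero_subs (Φ_above P b hb N i (by simpa using hi))
    exact Nl.sub
  | succ k ih =>
    intro N i hi hik
    obtain ⟨δ, hT⟩ := (ΦD_SES P hP).unb (free_se N)
    obtain ⟨d, hd, -⟩ := H_exact₁₃ hT i (i+1) rfl
    refine Nl.exact hd ?_ (ih _ (i+1) (by omega) (by push_cast at hik; omega))
    exact Nl.coprod _ _ (Φ_free P N).some i (fun _ => Nl.iso ((HH.{w, v} R i).mapIso (Φ_R P).some.symm) (hj i hi))

lemma step1' (N : ModuleCat.{0} R) (i : ℤ) (hi : j < i) : Nl p ((HH.{w, v} R i).obj ((ΦD P).obj N)) :=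
  step1 P b hb hP j hj (b - j).toNat N i hi (by omega)


omit hb hP hj [HasDerivedCategory.{w} (ModuleCat.{v} R)] in
lemma quotSC_se (I : Ideal R) : (ShortComplex.mk (X₁ := ModuleCat.of R I) (X₂ := mR R) (X₃ := ModuleCat.of R (R ⧸ I))
    (ModuleCat.ofHom (Submodule.subtype I)) (ModuleCat.ofHom (Submodule.mkQ I))
    (ModuleCat.hom_ext (by ext x; exact (Submodule.Quotient.mk_eq_zero I).2 x.2))).ShortExact :=
  ses_fun (Submodule.injective_subtype I) (Submodule.mkQ_surjective I) (LinearMap.exact_subtype_mkQ I)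

lemma step2 (hfin : Module.Finite R ((HH.{w, v} R j).obj (Q.obj P))) (hn : ¬ Nl p ((HH.{w, v} R j).obj (Q.obj P))) :
    ¬ Nl p ((HH.{w, v} R j).obj ((ΦD P).obj (ModuleCat.of R (R ⧸ p)))) := by
  intro h0
  let H : ModuleCat.{v} R := (HH.{w, v} R j).obj ((ΦD P).obj (mR R))
  let eH : H ≅ (HH.{w, v} R j).obj (Q.obj P) := (HH.{w, v} R j).mapIso (Φ_R P).some
  have hfin : Module.Finite R H := Module.Finite.equiv eH.toLinearEquiv.symm
  have key : ∀ x : H, ∃ s ∉ p, s • x ∈ (p • ⊤ : Submodule R H) := by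
    intro x
    obtain ⟨δ, hT⟩ := (ΦD_SES P hP).unb (quotSC_se p)
    obtain ⟨s, hs, h1⟩ := h0 (((HH.{w, v} R j).map ((ΦD P).map (ModuleCat.ofHom (Submodule.mkQ p)))).hom x)
    rw [← map_smul] at h1
    obtain ⟨y, hy⟩ := (H_exact₂ hT j _).1 h1
    obtain ⟨δ', hT'⟩ := (ΦD_SES P hP).unb (free_se (ModuleCat.of R p))
    obtain ⟨d, hd, -⟩ := H_exact₁₃ hT' j (j+1) rfl
    obtain ⟨t, ht, h2⟩ := step1' P b hb hP j hj _ (j+1) (by omega) (d.hom y)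
    rw [← map_smul] at h2
    obtain ⟨z, hz⟩ := (hd _).1 h2
    obtain ⟨S, u, hu⟩ := joint_surj _ _ (Φ_free P (ModuleCat.of R p)).some j z
    refine ⟨t * s, fun h => (hp.mem_or_mem h).elim ht hs, ?_⟩
    rw [mul_smul, ← hy, ← map_smul]
    have hz' := hz.symm
    refine Eq.mpr (congrArg (fun v => ((HH.{w, v} R j).map ((ΦD P).map (ModuleCat.ofHom (Submodule.subtype p)))).hom v ∈ (p • ⊤ : Submodule R H)) hz') ?_
    rw [hu, map_sum, map_sum]
    refine Submodule.sum_mem _ fun k _ => ?_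
    have : ((HH.{w, v} R j).map ((ΦD P).map (ModuleCat.ofHom (Submodule.subtype p)))).hom
      (((HH.{w, v} R j).map ((ΦD P).map (mFp (ModuleCat.of R p)))).hom (((HH.{w, v} R j).map ((ΦD P).map (mI k))).hom (u k)))
      = (k : p).1 • u k := by
      rw [← HΦ_smul P (mI k ≫ mFp (ModuleCat.of R p) ≫ ModuleCat.ofHom (Submodule.subtype p)) (k : p).1 ?_ j (u k)]
      · rw [Functor.map_comp, Functor.map_comp, Functor.map_comp, Functor.map_comp]
        rfl
      · refine LinearMap.ext_ring ?_
        change (Submodule.subtype p) (Finsupp.linearCombination R (id : p → p) (Finsupp.single k 1)) = _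
        simp
    exact this ▸ Submodule.smul_mem_smul k.2 trivial
  apply hn
  have h3 : (⟨p, hp⟩ : PrimeSpectrum R) ∉ Module.support R (H ⧸ (p • ⊤ : Submodule R H)) := by
    rw [Module.notMem_support_iff']
    intro m
    obtain ⟨x, rfl⟩ := Submodule.Quotient.mk_surjective _ m
    obtain ⟨s, hs, h⟩ := key x
    exact ⟨s, hs, by rw [← Submodule.Quotient.mk_smul, Submodule.Quotient.mk_eq_zero]; exact h⟩
  rw [Module.support_quotient] at h3
  have h4 : (⟨p, hp⟩ : PrimeSpectrum R) ∉ Module.support R H := fun h => h3 ⟨h, by simp [PrimeSpectrum.mem_zeroLocus]⟩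
  rw [Module.notMem_support_iff'] at h4
  exact Nl.iso eH h4

end steps
end S16
end partJ

section partK
namespace S16
set_option linter.unusedSectionVars false
variable {R : Type} [CommRing R] [HasDerivedCategory.{w} (ModuleCat.{v} R)]
open DerivedCategory
open scoped TensorProduct

section kap
variable (p : Ideal R) [hp : p.IsPrime]

noncomputable abbrev mκ : ModuleCat.{0} R := ModuleCat.of R p.ResidueField
noncomputable def κi : (R ⧸ p) →ₗ[R] p.ResidueField := (Algebra.linearMap (R ⧸ p) p.ResidueField).restrictScalars R
noncomputable abbrev mT : ModuleCat.{0} R := ModuleCat.of R (p.ResidueField ⧸ LinearMap.range (κi p))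

omit [HasDerivedCategory.{w} (ModuleCat.{v} R)] in
lemma κ_se : (ShortComplex.mk (X₁ := ModuleCat.of R (R ⧸ p)) (X₂ := mκ p) (X₃ := mT p)
    (ModuleCat.ofHom (κi p)) (ModuleCat.ofHom (Submodule.mkQ (LinearMap.range (κi p))))
    (ModuleCat.hom_ext (by ext x; exact (Submodule.Quotient.mk_eq_zero _).2 ⟨_, rfl⟩))).ShortExact :=
  ses_fun (Ideal.injective_algebraMap_quotient_residueField p) (Submodule.mkQ_surjective _) (LinearMap.exact_map_mkQ_range (κi p))

omit [HasDerivedCategory.{w} (ModuleCat.{v} R)] in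
lemma T_Nl : Nl p (mT p) := by
  intro t
  obtain ⟨x, rfl⟩ := Submodule.mkQ_surjective _ t
  obtain ⟨⟨a, b⟩, hab⟩ := IsLocalization.surj (nonZeroDivisors (R ⧸ p)) x
  obtain ⟨r, hr⟩ := Ideal.Quotient.mk_surjective b.1
  refine ⟨r, fun h => ?_, ?_⟩
  · exact nonZeroDivisors.coe_ne_zero b (hr ▸ Ideal.Quotient.eq_zero_iff_mem.2 h)
  · rw [← map_smul]
    refine (Submodule.Quotient.mk_eq_zero _).2 ⟨a, ?_⟩
    refine hab.symm.trans ?_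
    rw [mul_comm, Algebra.smul_def, IsScalarTower.algebraMap_apply R (R ⧸ p) p.ResidueField]
    congr 2
    exact hr.symm

omit [HasDerivedCategory.{w} (ModuleCat.{v} R)] in
lemma κ_smul {r : R} (hr : r ∈ p) (x : p.ResidueField) : r • x = 0 := by
  rw [Algebra.smul_def, (Ideal.algebraMap_residueField_eq_zero).2 hr, zero_mul]

omit [HasDerivedCategory.{w} (ModuleCat.{v} R)] in
lemma T_smul {r : R} (hr : r ∈ p) (t : mT p) : r • t = 0 := by
  obtain ⟨x, rfl⟩ := Submodule.mkQ_surjective _ t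
  rw [← map_smul, κ_smul p hr, map_zero]
noncomputable abbrev mκ2 : ModuleCat.{v} R := ModuleCat.of R (ULift.{v} p.ResidueField)
end kap

section steps
variable {p : Ideal R} [hp : p.IsPrime] (P : Cpx.{v} R) (b : ℤ) (hb : P.IsStrictlyLE b) (hP : ∀ n, Projective (P.X n))
  (j : ℤ) (hj : ∀ i, j < i → Nl p ((HH.{w, v} R i).obj (Q.obj P)))

lemma step3 (hb : P.IsStrictlyLE b) (hP : ∀ n, Projective (P.X n))
   (hj : ∀ i, j < i → Nl p ((HH.{w, v} R i).obj (Q.obj P))) (hfin : Module.Finite R ((HH.{w, v} R j).obj (Q.obj P))) (hn : ¬ Nl p ((HH.{w, v} R j).obj (Q.obj P))) :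
    ¬ Subsingleton ((HH.{w, v} R j).obj ((ΦD P).obj (mκ p))) := by
  intro h0
  obtain ⟨δ, hT⟩ := (ΦD_SES P hP).unb (κ_se p)
  obtain ⟨d, -, hd⟩ := H_exact₁₃ hT (j-1) j (by omega)
  refine step2 P b hb hP j hj hfin hn (Nl.exact hd ?_ Nl.sub)
  exact Nl.homology (ΦO P (mT p)) (j-1) (Nl.tensor (T_Nl p))

lemma not_exact (K : Cpx.{v} R) (j : ℤ) (h : ¬ Subsingleton ((HH.{w, v} R j).obj (Q.obj K))) :
    ∃ z : K.X j, (K.d j (j+1)).hom z = 0 ∧ ∀ y, (K.d (j-1) j).hom y ≠ z := by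
  by_contra hc
  push Not at hc
  apply h
  refine isZero_subs (IsZero.of_iso ?_ (Hη j K))
  rw [← HomologicalComplex.exactAt_iff_isZero_homology, HomologicalComplex.exactAt_iff' _ (j-1) j (j+1) (by simp) (by simp)]
  refine (ShortComplex.ShortExact.moduleCat_exact_iff_function_exact _).2 fun z => ⟨fun hz => ?_, ?_⟩
  · exact hc z hz
  · rintro ⟨y, rfl⟩
    exact congrArg (fun g => g.hom y) (K.d_comp_d (j-1) j (j+1))

noncomputable abbrev sC (R : Type) [CommRing R] (j : ℤ) : ModuleCat.{v} R ⥤ Cpx.{v} R := HomologicalComplex.single _ (ComplexShape.up ℤ) j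

noncomputable def sQ (j : ℤ) (N : ModuleCat.{v} R) : (singleFunctor _ j).obj N ≅ Q.obj ((sC.{v} R j).obj N) :=
  (singleFunctorIsoCompQ _ j).app N

lemma retr (K : Cpx.{v} R) (N : ModuleCat.{v} R) (j : ℤ) (s0 : N ⟶ K.X j) (r0 : K.X j ⟶ N)
    (hs : ∀ k, (ComplexShape.up ℤ).Rel j k → s0 ≫ K.d j k = 0) (hr : ∀ k, (ComplexShape.up ℤ).Rel k j → K.d k j ≫ r0 = 0)
    (hsr : s0 ≫ r0 = 𝟙 _) : ∃ (s : (singleFunctor _ j).obj N ⟶ Q.obj K) (r : Q.obj K ⟶ (singleFunctor _ j).obj N), s ≫ r = 𝟙 _ := by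
  have h : HomologicalComplex.mkHomFromSingle s0 hs ≫ HomologicalComplex.mkHomToSingle r0 hr = 𝟙 ((sC.{v} R j).obj N) := by
    apply HomologicalComplex.from_single_hom_ext
    simp [reassoc_of% hsr]
  refine ⟨(sQ j N).hom ≫ Q.map (HomologicalComplex.mkHomFromSingle s0 hs), Q.map (HomologicalComplex.mkHomToSingle r0 hr) ≫ (sQ j N).inv, ?_⟩
  rw [Category.assoc, ← Category.assoc (Q.map _), ← Q.map_comp, h]
  erw [Q.map_id, Category.id_comp]
  exact (sQ j N).hom_inv_id

lemma step4 (h0 : ¬ Subsingleton ((HH.{w, v} R j).obj ((ΦD P).obj (mκ p)))) :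
    ∃ (s : (singleFunctor _ j).obj (mκ2.{v} p) ⟶ (ΦD P).obj (mκ p)) (r : (ΦD P).obj (mκ p) ⟶ (singleFunctor _ j).obj (mκ2.{v} p)), s ≫ r = 𝟙 _ := by
  obtain ⟨z, hz, hz'⟩ := not_exact (ΦO P (mκ p)) j h0
  let κ := p.ResidueField
  let D (i k : ℤ) : κ ⊗[R] P.X i →ₗ[κ] κ ⊗[R] P.X k := (P.d i k).hom.baseChange κ
  have hD : ∀ i k x, D i k x = (P.d i k).hom.lTensor κ x := fun i k x => rfl
  let z0 : κ ⊗[R] P.X j := z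
  have hz0 : z0 ∉ LinearMap.range (D (j-1) j) := fun ⟨y, hy⟩ => hz' y hy
  obtain ⟨f, hf, hfD⟩ := Submodule.exists_le_ker_of_notMem hz0
  let l : κ ⊗[R] P.X j →ₗ[κ] κ := (f z0)⁻¹ • f
  let s0 : κ →ₗ[R] κ ⊗[R] P.X j := ((LinearMap.toSpanSingleton κ _ z0)).restrictScalars R
  let r0 : κ ⊗[R] P.X j →ₗ[R] κ := l.restrictScalars R
  refine retr (ΦO P (mκ p)) (mκ2.{v} p) j (ModuleCat.ofHom (s0 ∘ₗ (ULift.moduleEquiv : ULift.{v} κ ≃ₗ[R] κ).toLinearMap))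
    (ModuleCat.ofHom ((ULift.moduleEquiv : ULift.{v} κ ≃ₗ[R] κ).symm.toLinearMap ∘ₗ r0)) (fun k hk => ?_) (fun k hk => ?_) ?_
  · obtain rfl : j + 1 = k := hk
    refine ModuleCat.hom_ext (LinearMap.ext fun a => ?_)
    change D j (j+1) (a.down • z0) = 0
    rw [map_smul]
    have : D j (j+1) z0 = 0 := hz
    rw [this, smul_zero]
  · obtain rfl : k = j - 1 := by have : k + 1 = j := hk; omega
    refine ModuleCat.hom_ext (LinearMap.ext fun a => ?_)
    change ULift.up ((f z0)⁻¹ • f (D (j-1) j a)) = 0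
    have : f (D (j-1) j a) = 0 := hfD ⟨a, rfl⟩
    rw [this, smul_zero]; rfl
  · refine ModuleCat.hom_ext (LinearMap.ext fun a => ?_)
    obtain ⟨a⟩ := a
    change ULift.up ((f z0)⁻¹ • f (a • z0)) = ULift.up a
    rw [map_smul, smul_eq_mul, smul_eq_mul, mul_comm a, ← mul_assoc, inv_mul_cancel₀ hf, one_mul]

end steps

lemma Nl_bdd_max {p : Ideal R} [hp : p.IsPrime] (M : DD.{w, v} R) (b i : ℤ) (hM : M.IsLE b) (hi : ¬ Nl p ((HH.{w, v} R i).obj M)) :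
    ∃ j, (∀ i, j < i → Nl p ((HH.{w, v} R i).obj M)) ∧ ¬ Nl p ((HH.{w, v} R j).obj M) := by
  have hb : ∀ k, b < k → Nl p ((HH.{w, v} R k).obj M) := fun k hk => by
    have := isZero_subs (M.isZero_of_isLE b k hk)
    exact Nl.sub
  obtain ⟨j, hj, hj'⟩ := Int.exists_greatest_of_bdd (P := fun k => ¬ Nl p ((HH.{w, v} R k).obj M)) ⟨b, fun k hk => by
    by_contra h; exact hk (hb k (by omega))⟩ ⟨i, hi⟩
  exact ⟨j, fun k hk => by by_contra h; have := hj' k h; omega, hj⟩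

lemma single_shift {U : ObjectProperty (DD.{w, v} R)} (h : Loc U) (N : ModuleCat.{v} R) (j n : ℤ) (hU : U ((singleFunctor _ j).obj N)) :
    U ((singleFunctor _ n).obj N) := by
  have e := ((singleFunctors (ModuleCat.{v} R)).shiftIso (j - n) n j (by omega)).app N
  exact h.of_iso e (h.shift hU (j-n))

lemma κ_mem {U : ObjectProperty (DD.{w, v} R)} (h : Loc U) {p : Ideal R} [hp : p.IsPrime] (M : DD.{w, v} R) (a b i : ℤ) (h1 : M.IsGE a) (h2 : M.IsLE b)
    (hfin : ∀ n, Module.Finite R ((HH.{w, v} R n).obj M)) (hU : U M) (hi : ¬ Nl p ((HH.{w, v} R i).obj M)) (n : ℤ) : U ((singleFunctor _ n).obj (mκ2.{v} p)) := by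
  obtain ⟨j, hj, hj'⟩ := Nl_bdd_max M b i h2 hi
  obtain ⟨P, c, hc, hP, ⟨e⟩⟩ := HasPR.of_bdd a b M h1 h2
  have hQ : U (Q.obj P) := h.of_iso e hU
  have h3 := step3 (p := p) P c j hc hP (fun i hi => Nl.iso ((HH.{w, v} R i).mapIso e) (hj i hi))
    (Module.Finite.equiv ((HH.{w, v} R j).mapIso e).toLinearEquiv) (fun h => hj' (Nl.iso ((HH.{w, v} R j).mapIso e).symm h))
  obtain ⟨s, r, hsr⟩ := step4 P j h3
  exact single_shift h _ j n (h.retract s r hsr (Φ_mem h P c hc hP hQ _))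

end S16
end partK

section partL
namespace S16
set_option linter.unusedSectionVars false
variable {R : Type} [CommRing R] [HasDerivedCategory.{w} (ModuleCat.{v} R)]
open DerivedCategory
open scoped TensorProduct

noncomputable abbrev sΦ (R : Type) [CommRing R] [HasDerivedCategory.{w} (ModuleCat.{v} R)] (n : ℤ) : ModuleCat.{v} R ⥤ DD.{w, v} R := sC.{v} R n ⋙ Q

lemma sΦ_SES (n : ℤ) : SESTri (sΦ.{w, v} R n) := fun _ hS =>
  ⟨_, triangleOfSES_distinguished (hS.map_of_exact (sC.{v} R n))⟩

lemma sΦ_ne (n : ℤ) (N : ModuleCat.{v} R) (i : ℤ) (hi : i ≠ n) : IsZero ((HH.{w, v} R i).obj ((sΦ.{w, v} R n).obj N)) := by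
  refine IsZero.of_iso ?_ (Hη i ((sC.{v} R n).obj N))
  exact (HomologicalComplex.ExactAt.of_isZero (HomologicalComplex.isZero_single_obj_X _ _ _ _ hi)).isZero_homology

def SU (U : ObjectProperty (DD.{w, v} R)) (N : Type v) [AddCommGroup N] [Module R N] : Prop := ∀ n, U ((sΦ.{w, v} R n).obj (ModuleCat.of R N))

variable {U : ObjectProperty (DD.{w, v} R)}

lemma SU.of (h : Loc U) {N : Type v} [AddCommGroup N] [Module R N] (H : ∀ n, U ((singleFunctor _ n).obj (ModuleCat.of R N))) : SU U N :=
  fun n => h.of_iso (sQ n _) (H n)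

lemma SU.single (h : Loc U) {N : Type v} [AddCommGroup N] [Module R N] (H : SU U N) (n : ℤ) : U ((singleFunctor _ n).obj (ModuleCat.of R N)) :=
  h.of_iso (sQ n _).symm (H n)

lemma SU.equiv (h : Loc U) {N N' : Type v} [AddCommGroup N] [Module R N] [AddCommGroup N'] [Module R N'] (e : N ≃ₗ[R] N') (H : SU U N) : SU U N' :=
  fun n => h.of_iso ((sΦ.{w, v} R n).mapIso e.toModuleIso) (H n)

section
variable {A B C : Type v} [AddCommGroup A] [Module R A] [AddCommGroup B] [Module R B] [AddCommGroup C] [Module R C]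
  {f : A →ₗ[R] B} {g : B →ₗ[R] C}

lemma s_se (hf : Function.Injective f) (hg : Function.Surjective g) (hfg : Function.Exact f g) :
  (ShortComplex.mk (ModuleCat.ofHom f) (ModuleCat.ofHom g) (ModuleCat.hom_ext hfg.linearMap_comp_eq_zero)).ShortExact :=
  ses_fun hf hg hfg

lemma SU.ext₂ (h : Loc U) (hf : Function.Injective f) (hg : Function.Surjective g) (hfg : Function.Exact f g) (hA : SU U A) (hC : SU U C) : SU U B := fun n => by
  obtain ⟨δ, hT⟩ := (sΦ_SES n).unb (s_se hf hg hfg)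
  exact h.ext₂ hT (hA n) (hC n)

lemma SU.ext₁ (h : Loc U) (hf : Function.Injective f) (hg : Function.Surjective g) (hfg : Function.Exact f g) (hB : SU U B) (hC : SU U C) : SU U A := fun n => by
  obtain ⟨δ, hT⟩ := (sΦ_SES n).unb (s_se hf hg hfg)
  exact h.ext₁ hT (hB n) (hC n)
end

lemma SU.coprod (h : Loc U) {J : Type} (N : J → ModuleCat.{v} R) (H : ∀ j, SU U (N j)) : SU U (∐ N : ModuleCat.{v} R) := fun n => by
  have h1 : U (Q.obj (∐ fun j => (sC.{v} R n).obj (N j))) := h.coprod _ _ (Q_coprod _).some (fun j => H j n)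
  exact h.of_iso (Q.mapIso (PreservesCoproduct.iso (sC.{v} R n) N).symm) h1

def TU (U : ObjectProperty (DD.{w, v} R)) (N : Type v) [AddCommGroup N] [Module R N] : Prop := ∀ q : Ideal R, q.IsPrime → ¬ Nl q N → SU U (ULift.{v} (R ⧸ q))

lemma Nl_quot (p : Ideal R) [hp : p.IsPrime] : ¬ Nl p (R ⧸ p) := by
  intro h
  obtain ⟨r, hr, h1⟩ := h 1
  apply hr
  rw [Algebra.smul_def, mul_one] at h1
  exact Ideal.Quotient.eq_zero_iff_mem.1 h1

lemma fg_mem [IsNoetherianRing R] (h : Loc U) (N : Type v) [AddCommGroup N] [Module R N] [hN : Module.Finite R N] (hT : TU U N) : SU U N := by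
  induction hN using IsNoetherianRing.induction_on_isQuotientEquivQuotientPrime R with
  | subsingleton N => 
    intro n
    apply h.zero
    exact (sΦ.{w, v} R n).map_isZero (ModuleCat.isZero_of_subsingleton _)
  | quotient N p e =>
    have := p.2
    exact SU.equiv h (ULift.moduleEquiv.trans e.symm) (hT _ p.2 (fun h => Nl_quot p.1 (Nl.surj (f := e.toLinearMap) e.surjective h)))
  | exact N₁ N₂ N₃ f g hf hg hfg h₁ h₃ =>
    exact SU.ext₂ h hf hg hfg (h₁ fun q hq hn => hT q hq (fun h => hn (Nl.inj hf h))) (h₃ fun q hq hn => hT q hq (fun h => hn (Nl.surj hg h)))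

open DirectSum in
lemma any_mem [IsNoetherianRing R] (h : Loc U) (N : ModuleCat.{v} R) (hsm : Small.{0} N) (hT : TU U N) : SU U N := by
  classical
  intro n
  refine resolve_mem h (sΦ.{w, v} R n) (sΦ_SES n) n (fun N i hi => sΦ_ne n N i (by omega)) (fun N => Small.{0} N ∧ TU U N) (fun N hT => ?_) N ⟨hsm, hT⟩
  obtain ⟨hsm, hT⟩ := hT
  let J : Type := Shrink.{0} N
  let x : J → N := (equivShrink N).symm
  let f : (⨁ j : J, Submodule.span R {x j}) →ₗ[R] N := DirectSum.toModule R J N (fun j => (Submodule.span R {x j}).subtype)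
  have hf : Function.Surjective f := fun y => by
    obtain ⟨j, rfl⟩ := (equivShrink N).symm.surjective y
    exact ⟨DirectSum.lof R J (fun j => Submodule.span R {x j}) j ⟨x j, Submodule.mem_span_singleton_self _⟩, by simp [f, x]⟩
  have hG : ∀ q : Ideal R, q.IsPrime → Nl q N → Nl q (⨁ j : J, Submodule.span R {x j}) := by
    intro q hq hn y
    induction y using DirectSum.induction_on with
    | zero => exact ⟨1, hq.one_notMem, by simp⟩
    | add x y hx hy => exact Nl.add hx hy
    | of i y =>
      obtain ⟨r, hr, h1⟩ := hn y
      refine ⟨r, hr, ?_⟩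
      change r • DirectSum.lof R J (fun j => Submodule.span R {x j}) i y = 0
      rw [← map_smul, show r • y = 0 from Subtype.ext h1, map_zero]
  have hsG : Small.{0} (⨁ j : J, Submodule.span R {x j}) :=
    small_of_injective (f := fun (y : ⨁ j : J, Submodule.span R {x j}) (j : J) => y j) DFunLike.coe_injective
  have hse := s_se (A := LinearMap.ker f) (f := (LinearMap.ker f).subtype) (g := f) (Submodule.injective_subtype _) hf (LinearMap.exact_subtype_ker_map f)
  refine ⟨_, _, _, _, _, hse, ⟨small_of_injective (Submodule.injective_subtype (LinearMap.ker f)), fun q hq hn => hT q hq fun h => hn (Nl.inj (Submodule.injective_subtype _) (hG q hq h))⟩, ?_⟩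
  have h1 := SU.coprod h (fun j : J => ModuleCat.of R (Submodule.span R {x j})) (fun j => fg_mem h _ fun q hq hn => hT q hq fun h => hn (Nl.inj (Submodule.injective_subtype _) h))
  exact SU.equiv h (ModuleCat.coprodIsoDirectSum (fun j : J => ModuleCat.of R (Submodule.span R {x j}))).toLinearEquiv h1 n

def uL {A B : Type} [AddCommGroup A] [Module R A] [AddCommGroup B] [Module R B] (f : A →ₗ[R] B) : ULift.{v} A →ₗ[R] ULift.{v} B :=
  ULift.moduleEquiv.symm.toLinearMap ∘ₗ f ∘ₗ ULift.moduleEquiv.toLinearMap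

omit [HasDerivedCategory.{w} (ModuleCat.{v} R)] in
lemma uL_exact {A B C : Type} [AddCommGroup A] [Module R A] [AddCommGroup B] [Module R B] [AddCommGroup C] [Module R C]
    {f : A →ₗ[R] B} {g : B →ₗ[R] C} (h : Function.Exact f g) : Function.Exact (uL.{v} f) (uL.{v} g) := by
  rintro ⟨b⟩
  constructor
  · intro hb
    obtain ⟨a, ha⟩ := (h b).1 (congrArg ULift.down hb)
    exact ⟨⟨a⟩, congrArg ULift.up ha⟩
  · rintro ⟨⟨a⟩, ha⟩
    exact congrArg ULift.up ((h b).2 ⟨a, congrArg ULift.down ha⟩)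

lemma prime_mem [IsNoetherianRing R] (h : Loc U) (S : Set (Ideal R)) (hS : ∀ p ∈ S, ∀ q : Ideal R, q.IsPrime → p ≤ q → q ∈ S)
   (hκ : ∀ p ∈ S, ∀ (hp : p.IsPrime), SU U (ULift.{v} p.ResidueField)) (p : Ideal R) : p ∈ S → p.IsPrime → SU U (ULift.{v} (R ⧸ p)) := by
  induction p using WellFoundedGT.induction with
  | ind p ih =>
    intro hpS hp
    refine SU.ext₁ h (f := uL.{v} (κi p)) (g := uL.{v} (Submodule.mkQ (LinearMap.range (κi p)))) (fun x y hxy => ?_) (fun x => ?_) (uL_exact (LinearMap.exact_map_mkQ_range (κi p))) (hκ p hpS hp) ?_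
    · exact ULift.ext _ _ (Ideal.injective_algebraMap_quotient_residueField p (congrArg ULift.down hxy))
    · obtain ⟨y, hy⟩ := Submodule.mkQ_surjective _ x.down
      exact ⟨⟨y⟩, ULift.ext _ _ hy⟩
    refine any_mem h (ModuleCat.of R (ULift.{v} (mT p))) (small_map (Equiv.ulift : ULift.{v} (mT p) ≃ mT p)) fun q hq hn => ?_
    have hpq : p ≤ q := fun r hr => by
      by_contra hrq
      exact hn fun t => ⟨r, hrq, ULift.ext _ _ (T_smul p hr t.down)⟩
    refine ih q (lt_of_le_of_ne hpq ?_) (hS p hpS q hq hpq) hq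
    rintro rfl
    exact hn (Nl.inj (f := (ULift.moduleEquiv : ULift.{v} (mT p) ≃ₗ[R] (mT p)).toLinearMap) ULift.moduleEquiv.injective (T_Nl p))

end S16
end partL

section partM
namespace S16
set_option linter.unusedSectionVars false
variable {R : Type} [CommRing R] [HasDerivedCategory.{w} (ModuleCat.{v} R)]
open DerivedCategory

lemma ass_iff [IsNoetherianRing R] (N : Type*) [AddCommGroup N] [Module R N] [Module.Finite R N] (p : Ideal R) [hp : p.IsPrime] :
    (∃ q ∈ associatedPrimes R N, q ≤ p) ↔ ¬ Nl p N := by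
  constructor
  · rintro ⟨q, hq, hqp⟩ hn
    obtain ⟨hq1, x, hx⟩ := (isAssociatedPrime_iff_exists_injective_linearMap q N).1 hq
    obtain ⟨r, hr, h1⟩ := hn (x 1)
    rw [← map_smul] at h1
    have h2 := (map_eq_zero_iff x hx).1 h1
    rw [Algebra.smul_def, mul_one] at h2
    exact hr (hqp (Ideal.Quotient.eq_zero_iff_mem.1 h2))
  · intro hn
    have h1 : (⟨p, hp⟩ : PrimeSpectrum R) ∈ Module.support R N := by
      by_contra h
      exact hn (Module.notMem_support_iff'.1 h)
    rw [Module.mem_support_iff_of_finite] at h1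
    obtain ⟨q, hq, hqp⟩ := Ideal.exists_minimalPrimes_le h1
    exact ⟨q, Module.associatedPrimes.minimalPrimes_annihilator_subset_associatedPrimes R N hq, hqp⟩

lemma phi_iff [IsNoetherianRing R] {A : Set (DD.{w, v} R)} (hA : ∀ M ∈ A, memDqc R M) (n : ℤ) (p : PrimeSpectrum R) :
    p ∈ phi R A n ↔ ∃ M ∈ A, ¬ Nl p.asIdeal ((HH.{w, v} R (-n)).obj M) := by
  constructor
  · rintro ⟨M, hM, h⟩
    have : Module.Finite R ((HH.{w, v} R (-n)).obj M) := (hA M hM).1 n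
    exact ⟨M, hM, (ass_iff _ p.asIdeal).1 h⟩
  · rintro ⟨M, hM, h⟩
    have : Module.Finite R ((HH.{w, v} R (-n)).obj M) := (hA M hM).1 n
    exact ⟨M, hM, (ass_iff ((HH.{w, v} R (-n)).obj M) p.asIdeal).2 h⟩

lemma dqc_fin {M : DD.{w, v} R} (h : memDqc R M) (n : ℤ) : Module.Finite R ((HH.{w, v} R n).obj M) := by
  have := h.1 (-n)
  unfold Hh at this
  rwa [neg_neg] at this

lemma dqc_bdd {M : DD.{w, v} R} (h : memDqc R M) : ∃ (a : ℤ) (k : ℕ), M.IsGE a ∧ M.IsLE (a + k) := by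
  obtain ⟨u, hu⟩ := h.2.bddAbove
  obtain ⟨l, hl⟩ := h.2.bddBelow
  have key : ∀ i : ℤ, ¬ IsZero ((HH.{w, v} R i).obj M) → l ≤ -i ∧ -i ≤ u := by
    intro i hi
    have : (-i) ∈ {n : ℤ | ¬ IsZero (Hh R n M)} := by
      change ¬ IsZero ((HH.{w, v} R (- -i)).obj M)
      rwa [neg_neg]
    exact ⟨hl this, hu this⟩
  refine ⟨-u, (u - l).toNat, (M.isGE_iff _).2 fun i hi => ?_, (M.isLE_iff _).2 fun i hi => ?_⟩
  · by_contra h; have := key i h; omega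
  · by_contra h; have := key i h; omega

lemma dqc_mk {M : DD.{w, v} R} (hf : ∀ n, Module.Finite R ((HH.{w, v} R n).obj M)) (a b : ℤ) (h0 : ∀ n, (n < a ∨ b < n) → IsZero ((HH.{w, v} R n).obj M)) : memDqc R M := by
  refine ⟨fun n => hf (-n), (Set.finite_Icc (-b) (-a)).subset fun n hn => ?_⟩
  have h1 : ¬ (-n < a ∨ b < -n) := fun h => hn (h0 _ h)
  rw [Set.mem_Icc]; omega

lemma dqc_shift {M : DD.{w, v} R} (h : memDqc R M) (m : ℤ) : memDqc R (M⟦m⟧) := by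
  obtain ⟨a, k, h1, h2⟩ := dqc_bdd h
  refine dqc_mk (fun n => ?_) (a - m) (a + k - m) fun n hn => ?_
  · have := dqc_fin h (m + n)
    exact Module.Finite.equiv (Hshift m n (m+n) rfl M).toLinearEquiv.symm
  · refine IsZero.of_iso ?_ (Hshift m n (m+n) rfl M)
    rcases hn with hn | hn
    · exact M.isZero_of_isGE a _ (by omega)
    · exact M.isZero_of_isLE (a+k) _ (by omega)

def gen (A : Set (DD.{w, v} R)) : Set (DD.{w, v} R) := {X | ∀ S, IsCocompletePreaisle R S → A ⊆ S → X ∈ S}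

lemma gen_pre (A : Set (DD.{w, v} R)) : IsCocompletePreaisle R (gen A) where
  mem_of_iso _ _ e h S hS hA := hS.mem_of_iso e (h S hS hA)
  shift_mem _ h S hS hA := hS.shift_mem (h S hS hA)
  ext_mem _ _ _ f g k hT h h' S hS hA := hS.ext_mem f g k hT (h S hS hA) (h' S hS hA)
  coproduct_mem _ X c hc h S hS hA := hS.coproduct_mem X c hc (fun i => h i S hS hA)

lemma desusp_pre {S : Set (DD.{w, v} R)} (hS : IsCocompletePreaisle R S) : IsCocompletePreaisle R {X | X⟦(-1:ℤ)⟧ ∈ S} where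
  mem_of_iso _ _ e h := hS.mem_of_iso ((shiftFunctor _ (-1:ℤ)).mapIso e) h
  shift_mem X h := hS.mem_of_iso ((shiftFunctorComm (DD.{w, v} R) (-1:ℤ) 1).app X) (hS.shift_mem h)
  ext_mem _ _ _ f g k hT h h' := hS.ext_mem _ _ _ (Triangle.shift_distinguished _ hT (-1)) h h'
  coproduct_mem _ X c hc h := hS.coproduct_mem _ (Cofan.mk (c.pt⟦(-1:ℤ)⟧) (fun j => (c.inj j)⟦(-1:ℤ)⟧'))
    (isColimitMapCoconeCofanMkEquiv (shiftFunctor (DD.{w, v} R) (-1:ℤ)) _ _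
      (isColimitOfPreserves (shiftFunctor (DD.{w, v} R) (-1:ℤ)) (IsColimit.ofIsoColimit hc (Cofan.ext (Iso.refl _) (by simp))))) h

lemma gen_desusp {A : Set (DD.{w, v} R)} (hA : ∀ M ∈ A, M⟦(-1:ℤ)⟧ ∈ A) {X : DD.{w, v} R} (h : X ∈ gen A) : X⟦(-1:ℤ)⟧ ∈ gen A :=
  h _ (desusp_pre (gen_pre A)) fun M hM _ _ hAS => hAS (hA M hM)

lemma pre_shift {S : Set (DD.{w, v} R)} (hS : IsCocompletePreaisle R S) (h1 : ∀ X ∈ S, X⟦(-1:ℤ)⟧ ∈ S) (n : ℤ) : ∀ X ∈ S, X⟦n⟧ ∈ S := by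
  induction n using Int.induction_on with
  | zero => exact fun X hX => hS.mem_of_iso ((shiftFunctorZero (DD.{w, v} R) ℤ).symm.app X) hX
  | succ n ih => exact fun X hX => hS.mem_of_iso ((shiftFunctorAdd' (DD.{w, v} R) (n:ℤ) 1 _ rfl).symm.app X) (hS.shift_mem (ih X hX))
  | pred n ih => exact fun X hX => hS.mem_of_iso ((shiftFunctorAdd' (DD.{w, v} R) (-n:ℤ) (-1) _ rfl).symm.app X) (h1 _ (ih X hX))

lemma pre_loc {S : Set (DD.{w, v} R)} (hS : IsCocompletePreaisle R S) (h1 : ∀ X ∈ S, X⟦(-1:ℤ)⟧ ∈ S) : Loc (C := DD.{w, v} R) (fun X => X ∈ S) := by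
  have hiso : ObjectProperty.IsClosedUnderIsomorphisms (C := DD.{w, v} R) (fun X => X ∈ S) := ⟨fun e h => hS.mem_of_iso e h⟩
  refine ⟨{ exists_zero := ?_, isStableUnderShiftBy := fun n => ⟨fun X hX => pre_shift hS h1 n X hX⟩, ext₂' := ?_ }, hiso,
    fun X c hc h => hS.coproduct_mem X c hc h⟩
  · obtain ⟨⟨Z, hZ⟩⟩ : HasZeroObject (DD.{w, v} R) := inferInstance
    let X : Empty → DD.{w, v} R := fun e => e.elim
    let c : Cofan X := Cofan.mk Z (fun e => e.elim)
    refine ⟨Z, hZ, hS.coproduct_mem X c ?_ (fun e => e.elim)⟩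
    exact Cofan.IsColimit.mk _ (fun t => hZ.to_ t.pt) (fun _ e => e.elim) (fun _ _ _ => hZ.eq_of_src _ _)
  · intro T hT h h'
    exact ⟨_, hS.ext_mem T.mor₁ T.mor₂ T.mor₃ hT h h', ⟨Iso.refl _⟩⟩

def UV (V : Set (PrimeSpectrum R)) : Set (DD.{w, v} R) := {M | ∀ i, ∀ p : PrimeSpectrum R, p ∉ V → Nl p.asIdeal ((HH.{w, v} R i).obj M)}

lemma UV_shift {V : Set (PrimeSpectrum R)} {M : DD.{w, v} R} (h : M ∈ UV V) (n : ℤ) : M⟦n⟧ ∈ UV V := fun i p hp =>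
  Nl.iso (Hshift n i (n+i) rfl M).symm (h (n+i) p hp)

lemma UV_pre (V : Set (PrimeSpectrum R)) : IsCocompletePreaisle R (UV V) where
  mem_of_iso _ _ e h i p hp := Nl.iso ((HH.{w, v} R i).mapIso e) (h i p hp)
  shift_mem _ h := UV_shift h 1
  ext_mem _ _ _ _ _ _ hT h h' i p hp := Nl.exact (H_exact₂ hT i) (h i p hp) (h' i p hp)
  coproduct_mem _ X c hc h i p hp := Nl.coprod X c hc i (fun j => h j i p hp)

end S16
end partM

section partN
namespace S16
set_option linter.unusedSectionVars false
variable {R : Type} [CommRing R] [HasDerivedCategory.{w} (ModuleCat.{v} R)]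
open DerivedCategory

section
variable {A : Set (DD.{w, v} R)} (hA : IsNullityClass R A) (hd : ∀ M ∈ A, M⟦(-1:ℤ)⟧ ∈ A)

lemma A_dqc (hA : IsNullityClass R A) : ∀ M ∈ A, memDqc R M := by
  obtain ⟨U, hU, rfl⟩ := hA
  exact fun M hM => hM.2

lemma A_gen (hA : IsNullityClass R A) {M : DD.{w, v} R} (hM : M ∈ gen A) (h : memDqc R M) : M ∈ A := by
  obtain ⟨U, hU, rfl⟩ := hA
  exact ⟨hM U hU Set.inter_subset_left, h⟩

lemma gen_le {M : DD.{w, v} R} (hM : M ∈ A) : M ∈ gen A := fun _ _ h => h hM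

include hd in
lemma gen_loc : Loc (C := DD.{w, v} R) (fun X => X ∈ gen A) := pre_loc (gen_pre A) (fun _ h => gen_desusp hd h)

include hA hd in
lemma A_shift (n : ℤ) {M : DD.{w, v} R} (hM : M ∈ A) : M⟦n⟧ ∈ A :=
  A_gen hA ((gen_loc hd).shift (gen_le hM) n) (dqc_shift (A_dqc hA M hM) n)

variable [IsNoetherianRing R]

include hA hd in
lemma phi_mem (n : ℤ) (p : PrimeSpectrum R) : p ∈ phi R A n ↔ ∃ M ∈ A, ∃ i, ¬ Nl p.asIdeal ((HH.{w, v} R i).obj M) := by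
  rw [phi_iff (A_dqc hA)]
  constructor
  · rintro ⟨M, hM, h⟩
    exact ⟨M, hM, _, h⟩
  · rintro ⟨M, hM, i, h⟩
    exact ⟨M⟦i+n⟧, A_shift hA hd _ hM, fun h' => h (Nl.iso (Hshift (i+n) (-n) i (by omega) M) h')⟩

include hA hd in
lemma phi_const (n : ℤ) : phi R A n = phi R A 0 := by
  ext p; rw [phi_mem hA hd, phi_mem hA hd]

include hA hd in
lemma mem_iff {M : DD.{w, v} R} : M ∈ A ↔ memDqc R M ∧ ∀ i (p : PrimeSpectrum R), ¬ Nl p.asIdeal ((HH.{w, v} R i).obj M) → p ∈ phi R A 0 := by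
  refine ⟨fun hM => ⟨A_dqc hA M hM, fun i p hp => (phi_mem hA hd 0 p).2 ⟨M, hM, i, hp⟩⟩, fun ⟨hM, h⟩ => ?_⟩
  have hL := gen_loc hd
  refine A_gen hA ?_ hM
  let S : Set (Ideal R) := {I | ∃ p ∈ phi R A 0, p.asIdeal = I}
  have hS : ∀ p ∈ S, ∀ q : Ideal R, q.IsPrime → p ≤ q → q ∈ S := by
    rintro _ ⟨p, ⟨M, hM, I, hI, hIp⟩, rfl⟩ q hq hpq
    exact ⟨⟨q, hq⟩, ⟨M, hM, I, hI, hIp.trans hpq⟩, rfl⟩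
  have hκ : ∀ p ∈ S, ∀ (_ : p.IsPrime), SU (fun X => X ∈ gen A) (ULift.{v} p.ResidueField) := by
    rintro _ ⟨p, hp, rfl⟩ _
    obtain ⟨M, hM, i, hi⟩ := (phi_mem hA hd 0 p).1 hp
    obtain ⟨a, k, h1, h2⟩ := dqc_bdd (A_dqc hA M hM)
    exact SU.of hL fun n => κ_mem hL M a (a+k) i h1 h2 (dqc_fin (A_dqc hA M hM)) (gen_le hM) hi n
  obtain ⟨a, k, h1, h2⟩ := dqc_bdd hM
  refine devissage (gen A) (fun X Y e hX => (gen_pre A).mem_of_iso e hX) (fun X Y Z f g k hT => (gen_pre A).ext_mem f g k hT) k a M h1 h2 fun n => ?_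
  have := dqc_fin hM n
  refine SU.single hL (fg_mem hL ((HH.{w, v} R n).obj M) fun q hq hn => ?_) n
  exact prime_mem hL S hS hκ q ⟨⟨q, hq⟩, h n ⟨q, hq⟩ hn, rfl⟩ hq

end

variable [IsNoetherianRing R]

lemma sΦ_self (n : ℤ) (N : ModuleCat.{v} R) : Nonempty ((HH.{w, v} R n).obj ((singleFunctor _ n).obj N) ≅ N) := ⟨Hsingle n N⟩

lemma surj_aux (V : Set (PrimeSpectrum R)) (hV : ∀ p ∈ V, ∀ q : PrimeSpectrum R, p.asIdeal ≤ q.asIdeal → q ∈ V) :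
    ∃ A : Set (DD.{w, v} R), IsNullityClass R A ∧ (∀ M ∈ A, M⟦(-1:ℤ)⟧ ∈ A) ∧ phi R A 0 = V := by
  have hA : IsNullityClass R (UV V ∩ {M : DD.{w, v} R | memDqc R M}) := ⟨UV V, UV_pre V, rfl⟩
  have hd : ∀ M ∈ (UV V ∩ {M : DD.{w, v} R | memDqc R M}), M⟦(-1:ℤ)⟧ ∈ (UV V ∩ {M : DD.{w, v} R | memDqc R M}) :=
    fun M hM => ⟨UV_shift hM.1 _, dqc_shift hM.2 _⟩
  refine ⟨_, hA, hd, ?_⟩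
  ext p
  rw [phi_mem hA hd]
  constructor
  · rintro ⟨M, hM, i, hi⟩
    by_contra hp
    exact hi (hM.1 i p hp)
  · intro hp
    let N : ModuleCat.{v} R := ModuleCat.of R (ULift.{v} (R ⧸ p.asIdeal))
    let eN : N ≃ₗ[R] (R ⧸ p.asIdeal) := ULift.moduleEquiv
    have h0 : ∀ i : ℤ, i ≠ 0 → IsZero ((HH.{w, v} R i).obj ((singleFunctor _ 0).obj N)) := fun i hi =>
      (sΦ_ne 0 N i hi).of_iso ((HH.{w, v} R i).mapIso (sQ 0 N))
    let e := Hsingle (R := R) 0 N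
    refine ⟨(singleFunctor _ 0).obj N, ⟨fun i q hq => ?_, dqc_mk (fun i => ?_) 0 0 (fun i hi => h0 i (by omega))⟩, 0, fun h => Nl_quot p.asIdeal (Nl.surj (f := eN.toLinearMap) eN.surjective (Nl.iso e h))⟩
    · by_cases hi : i = 0
      · subst hi
        refine Nl.iso e.symm (Nl.inj (f := eN.toLinearMap) eN.injective ?_)
        have : ¬ p.asIdeal ≤ q.asIdeal := fun h => hq (hV p hp q h)
        obtain ⟨r, hr, hrq⟩ := Set.not_subset.1 this
        intro m
        refine ⟨r, hrq, ?_⟩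
        obtain ⟨m, rfl⟩ := Ideal.Quotient.mk_surjective m
        exact Ideal.Quotient.eq_zero_iff_mem.2 (p.asIdeal.mul_mem_right m hr)
      · have := isZero_subs (h0 i hi)
        exact Nl.sub
    · by_cases hi : i = 0
      · subst hi
        have : Module.Finite R N := Module.Finite.equiv eN.symm
        exact Module.Finite.equiv e.symm.toLinearEquiv
      · have := isZero_subs (h0 i hi)
        infer_instance

end S16
end partN

/-- If `A` is a nullity class in `D_qc(R)` closed under desuspension,
then `φ(A)` is constant, and `A ↦ φ(A)(0)` is an order-preserving bijection between
the nullity classes in `D_qc(R)` closed under desuspension and the subsets of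
`Spec R` closed under specialization. -/
theorem stmt16 (R : Type) [CommRing R] [IsNoetherianRing R]
    [HasDerivedCategory.{w} (ModuleCat R)] :
    (∀ A : Set (DerivedCategory (ModuleCat R)), IsNullityClass R A →
      (∀ M ∈ A, M⟦(-1 : ℤ)⟧ ∈ A) → ∀ n : ℤ, phi R A n = phi R A 0) ∧
    Set.BijOn (fun A => phi R A 0)
      {A : Set (DerivedCategory (ModuleCat R)) |
        IsNullityClass R A ∧ ∀ M ∈ A, M⟦(-1 : ℤ)⟧ ∈ A}
      {V : Set (PrimeSpectrum R) |
        ∀ p ∈ V, ∀ q : PrimeSpectrum R, p.asIdeal ≤ q.asIdeal → q ∈ V} ∧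
    (∀ A ∈ {A : Set (DerivedCategory (ModuleCat R)) |
        IsNullityClass R A ∧ ∀ M ∈ A, M⟦(-1 : ℤ)⟧ ∈ A},
     ∀ A' ∈ {A : Set (DerivedCategory (ModuleCat R)) |
        IsNullityClass R A ∧ ∀ M ∈ A, M⟦(-1 : ℤ)⟧ ∈ A},
      (A ⊆ A' ↔ phi R A 0 ⊆ phi R A' 0)) := by
  refine ⟨fun A hA hd n => S16.phi_const hA hd n, ⟨?_, ?_, ?_⟩, ?_⟩
  · rintro A - p ⟨M, hM, I, hI, hIp⟩ q hpq
    exact ⟨M, hM, I, hI, hIp.trans hpq⟩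
  · rintro A ⟨hA, hd⟩ A' ⟨hA', hd'⟩ h
    have h' : phi R A 0 = phi R A' 0 := h
    ext M
    rw [S16.mem_iff hA hd, S16.mem_iff hA' hd', h']
  · intro V hV
    obtain ⟨A, hA, hd, h⟩ := S16.surj_aux V hV
    exact ⟨A, ⟨hA, hd⟩, h⟩
  · rintro A ⟨hA, hd⟩ A' ⟨hA', hd'⟩
    constructor
    · rintro h p ⟨M, hM, hp⟩
      exact ⟨M, h hM, hp⟩
    · intro h M hM
      rw [S16.mem_iff hA hd] at hM
      exact (S16.mem_iff hA' hd').2 ⟨hM.1, fun i p hp => h (hM.2 i p hp)⟩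
end

section
/- Let R be a commutative Noetherian local ring with maximal ideal m, let p be a prime ideal with p ⊊ m, and let h ∈ m \ p. Then the localization (R/p)[h^{-1}] of R/p at the multiplicative set of powers of h is not finitely generated as an R-module. -/
/-- Let `R` be a commutative Noetherian local ring with maximal ideal `m`,
`p` a prime with `p ⊊ m`, and `h ∈ m \ p`. Then `(R/p)[h⁻¹]`, the localization of `R/p`
at the powers of `h`, is not finitely generated as an `R`-module. -/
theorem stmt17 {R : Type u} [CommRing R] [IsNoetherianRing R] [IsLocalRing R]
    (p : Ideal R) [p.IsPrime] (hp : p < IsLocalRing.maximalIdeal R)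
    (h : R) (hm : h ∈ IsLocalRing.maximalIdeal R) (hnp : h ∉ p) :
    ¬ Module.Finite R (LocalizedModule (Submonoid.powers h) (R ⧸ p)) := by
  intro hfin
  have hle : (⊤ : Submodule R (LocalizedModule (Submonoid.powers h) (R ⧸ p))) ≤
      IsLocalRing.maximalIdeal R • ⊤ := by
    intro x _
    obtain ⟨y, hy⟩ := ((Module.End.isUnit_iff _).mp
      (IsLocalizedModule.map_units (LocalizedModule.mkLinearMap (Submonoid.powers h) (R ⧸ p))
        ⟨h, Submonoid.mem_powers h⟩)).2 x
    rw [← hy]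
    exact Submodule.smul_mem_smul hm Submodule.mem_top
  have hbot := Submodule.eq_bot_of_le_smul_of_le_jacobson_bot (IsLocalRing.maximalIdeal R) ⊤
    hfin.fg_top hle (IsLocalRing.maximalIdeal_le_jacobson ⊥)
  have h0 : LocalizedModule.mkLinearMap (Submonoid.powers h) (R ⧸ p) 1 = 0 := by
    rw [← Submodule.mem_bot R, ← hbot]
    exact Submodule.mem_top
  obtain ⟨⟨c, n, rfl⟩, hc⟩ := (IsLocalizedModule.eq_zero_iff (Submonoid.powers h) _).mp h0
  have hc' : (Ideal.Quotient.mk p) (h ^ n) = 0 := by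
    have : (h ^ n) • (1 : R ⧸ p) = 0 := hc
    rwa [Algebra.smul_def, mul_one] at this
  exact hnp (Ideal.IsPrime.mem_of_pow_mem inferInstance n (Ideal.Quotient.eq_zero_iff_mem.mp hc'))
end

section
/- Let R be a commutative Noetherian ring and let A be an aisle in D_qc(R). Then φ(A) is comonotone: whenever p' ∈ φ(A)(n) and p is a prime maximal among primes strictly contained in p' (i.e., p ⊊ p' and there is no prime q with p ⊊ q ⊊ p'), then p ∈ φ(A)(n+1). -/
open CategoryTheory CategoryTheory.Limits CategoryTheory.Pretriangulated

universe w

namespace S18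

set_option linter.unusedSectionVars false

universe v

open DerivedCategory

section
variable {R : Type} [CommRing R] [HasDerivedCategory.{w} (ModuleCat.{v} R)]

/-- cohomology -/
noncomputable abbrev H (i : ℤ) (X : DerivedCategory (ModuleCat.{v} R)) : ModuleCat.{v} R :=
  (homologyFunctor (ModuleCat.{v} R) i).obj X

noncomputable abbrev Sg (i : ℤ) (N : ModuleCat.{v} R) : DerivedCategory (ModuleCat.{v} R) :=
  (singleFunctor (ModuleCat.{v} R) i).obj N

noncomputable abbrev Hm (i : ℤ) {X Y : DerivedCategory (ModuleCat.{v} R)} (f : X ⟶ Y) :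
    H i X →ₗ[R] H i Y := ((homologyFunctor (ModuleCat.{v} R) i).map f).hom

lemma les2 {T : Triangle (DerivedCategory (ModuleCat.{v} R))} (hT : T ∈ distTriang _) (i : ℤ) :
    Function.Exact (Hm i T.mor₁) (Hm i T.mor₂) := 
  (ShortComplex.ShortExact.moduleCat_exact_iff_function_exact _).1
    (HomologySequence.exact₂ T hT i)

lemma les3 {T : Triangle (DerivedCategory (ModuleCat.{v} R))} (hT : T ∈ distTriang _) (i j : ℤ)
    (h : i + 1 = j) :
    ∃ δ : H i T.obj₃ →ₗ[R] H j T.obj₁, Function.Exact (Hm i T.mor₂) δ ∧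
      Function.Exact δ (Hm j T.mor₁) := 
  ⟨(HomologySequence.δ T i j h).hom,
   (ShortComplex.ShortExact.moduleCat_exact_iff_function_exact _).1
    (HomologySequence.exact₃ T hT i j h),
   (ShortComplex.ShortExact.moduleCat_exact_iff_function_exact _).1
    (HomologySequence.exact₁ T hT i j h)⟩

lemma aux_smul {A B : ModuleCat.{v} R} (φ : A ⟶ A) (e : A ≅ B) (ψ : B ⟶ B) (r : R)
    (h : φ ≫ e.hom = e.hom ≫ ψ) (h' : ψ = r • 𝟙 B) : φ = r • 𝟙 A := by
  subst h'
  rw [← cancel_mono e.hom, h]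
  simp

lemma Hm_smul_id (i : ℤ) (X : DerivedCategory (ModuleCat.{v} R)) (r : R) :
    (homologyFunctor (ModuleCat.{v} R) i).map (r • 𝟙 X) = r • 𝟙 _ := by
  let K := Q.objPreimage X
  let e : Q.obj K ≅ X := Q.objObjPreimageIso X
  have h1 : (r • 𝟙 X) = e.inv ≫ Q.map (r • 𝟙 K) ≫ e.hom := by
    rw [Functor.map_smul, Linear.smul_comp, Linear.comp_smul]; simp
  have h2 : HomologicalComplex.homologyMap (r • 𝟙 K) i = r • 𝟙 _ := by
    have := ShortComplex.homologyMap_smul (𝟙 (K.sc i)) r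
    rw [ShortComplex.homologyMap_id] at this
    exact this
  have h4 : (homologyFunctor (ModuleCat.{v} R) i).map (Q.map (r • 𝟙 K)) = r • 𝟙 _ :=
    aux_smul _ ((homologyFunctorFactors (ModuleCat.{v} R) i).app K) _ r
      (homologyFunctorFactors_hom_naturality (r • 𝟙 K) i) h2
  rw [h1, Functor.map_comp, Functor.map_comp, h4, Linear.smul_comp, Linear.comp_smul,
    Category.id_comp, ← Functor.map_comp, e.inv_hom_id, CategoryTheory.Functor.map_id]

lemma Hm_smul (i : ℤ) {X Y : DerivedCategory (ModuleCat.{v} R)} (f : X ⟶ Y) (r : R) :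
    Hm i (r • f) = r • Hm i f := by
  have : r • f = (r • 𝟙 X) ≫ f := by simp
  unfold Hm
  rw [this, Functor.map_comp, Hm_smul_id]
  simp

lemma Hm_comp (i : ℤ) {X Y Z : DerivedCategory (ModuleCat.{v} R)} (f : X ⟶ Y) (g : Y ⟶ Z) :
    Hm i (f ≫ g) = Hm i g ∘ₗ Hm i f := by
  unfold Hm
  rw [Functor.map_comp]
  simp

lemma Hm_add (i : ℤ) {X Y : DerivedCategory (ModuleCat.{v} R)} (f g : X ⟶ Y) :
    Hm i (f + g) = Hm i f + Hm i g := by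
  unfold Hm
  rw [Functor.map_add]
  simp

lemma Hm_zero (i : ℤ) {X Y : DerivedCategory (ModuleCat.{v} R)} :
    Hm i (0 : X ⟶ Y) = 0 := by
  unfold Hm
  rw [Functor.map_zero]
  simp

noncomputable def Hiso (i : ℤ) {X Y : DerivedCategory (ModuleCat.{v} R)} (e : X ≅ Y) : H i X ≃ₗ[R] H i Y :=
  ((homologyFunctor (ModuleCat.{v} R) i).mapIso e).toLinearEquiv

noncomputable def Hshift (k i j : ℤ) (h : k + i = j) (X : DerivedCategory (ModuleCat.{v} R)) :
    H i (X⟦k⟧) ≃ₗ[R] H j X :=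
  (((homologyFunctor (ModuleCat.{v} R) 0).shiftIso k i j h).app X).toLinearEquiv

noncomputable def Hsingle (i : ℤ) (N : ModuleCat.{v} R) : H i (Sg i N) ≃ₗ[R] N :=
  ((singleFunctorCompHomologyFunctorIso (ModuleCat.{v} R) i).app N).toLinearEquiv

noncomputable def Sgshift (k i j : ℤ) (h : k + i = j) (N : ModuleCat.{v} R) :
    (Sg j N)⟦k⟧ ≅ Sg i N :=
  ((singleFunctors (ModuleCat.{v} R)).shiftIso k i j h).app N

lemma Hsub (i j : ℤ) (hij : i ≠ j) (N : ModuleCat.{v} R) : Subsingleton (H i (Sg j N)) := by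
  apply ModuleCat.subsingleton_of_isZero
  rcases lt_or_gt_of_ne hij with h | h
  · exact isZero_of_isGE _ j i h
  · exact isZero_of_isLE _ j i h

lemma sgTri {S : ShortComplex (ModuleCat.{v} R)} (hS : S.ShortExact) (j : ℤ) :
    ∃ δ, Triangle.mk ((singleFunctor (ModuleCat.{v} R) j).map S.f)
      ((singleFunctor (ModuleCat.{v} R) j).map S.g) δ ∈ distTriang _ := 
  ⟨_, triangleOfSES_distinguished (hS.map_of_exact
    (HomologicalComplex.single (ModuleCat.{v} R) (ComplexShape.up ℤ) j))⟩

lemma trunc (Y : DerivedCategory (ModuleCat.{v} R)) (m : ℤ) :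
    ∃ (X Z : DerivedCategory (ModuleCat.{v} R)) (f : X ⟶ Y) (g : Y ⟶ Z) (h : Z ⟶ X⟦(1 : ℤ)⟧),
      Triangle.mk f g h ∈ distTriang _ ∧
      (∀ i, i ≤ m → Nonempty (H i X ≃ₗ[R] H i Y)) ∧ (∀ i, m < i → Subsingleton (H i X)) ∧ 
      (∀ i, m < i → Nonempty (H i Z ≃ₗ[R] H i Y)) ∧ (∀ i, i ≤ m → Subsingleton (H i Z)) := by
  obtain ⟨X, Z, hX, hZ, f, g, h, hT⟩ := (TStructure.t (C := ModuleCat.{v} R)).exists_triangle Y m (m+1) rfl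
  have hX' : ∀ i, m < i → Subsingleton (H i X) := fun i hi => 
    ModuleCat.subsingleton_of_isZero ((isLE_iff X m).1 ⟨hX⟩ i hi)
  have hZ' : ∀ i, i ≤ m → Subsingleton (H i Z) := fun i hi => 
    ModuleCat.subsingleton_of_isZero ((isGE_iff Z (m+1)).1 ⟨hZ⟩ i (by lia))
  refine ⟨X, Z, f, g, h, hT, ?_, hX', ?_, hZ'⟩
  · intro i hi
    refine ⟨LinearEquiv.ofBijective (Hm i f) ⟨?_, ?_⟩⟩
    · obtain ⟨δ, h1, h2⟩ := les3 hT (i-1) i (by lia)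
      have := hZ' (i-1) (by lia)
      rw [injective_iff_map_eq_zero]
      intro a ha
      obtain ⟨b, rfl⟩ := (h2 a).1 ha
      rw [Subsingleton.elim (α := H (i-1) Z) b 0]
      exact δ.map_zero
    · intro a
      have := hZ' i hi
      exact (les2 hT i a).1 (Subsingleton.elim (α := H i Z) _ _)
  · intro i hi
    refine ⟨(LinearEquiv.ofBijective (Hm i g) ⟨?_, ?_⟩).symm⟩
    · rw [injective_iff_map_eq_zero]
      intro a ha
      obtain ⟨b, rfl⟩ := (les2 hT i a).1 ha
      have := hX' i hi
      rw [Subsingleton.elim (α := H i X) b 0]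
      exact (Hm i f).map_zero
    · intro a
      obtain ⟨δ, h1, h2⟩ := les3 hT i (i+1) rfl
      have := hX' (i+1) (by lia)
      exact (h1 a).1 (Subsingleton.elim (α := H (i+1) X) _ _)

lemma iso_single (Y : DerivedCategory (ModuleCat.{v} R)) (m : ℤ)
    (h : ∀ i, i ≠ m → Subsingleton (H i Y)) : Nonempty (Y ≅ Sg m (H m Y)) := by
  have : Y.IsGE m := (isGE_iff _ _).2 fun i hi => 
    @ModuleCat.isZero_of_subsingleton _ _ _ (h i (by lia))
  have : Y.IsLE m := (isLE_iff _ _).2 fun i hi => 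
    @ModuleCat.isZero_of_subsingleton _ _ _ (h i (by lia))
  obtain ⟨N, ⟨e⟩⟩ := exists_iso_singleFunctor_obj_of_isGE_of_isLE Y m
  exact ⟨e ≪≫ (singleFunctor (ModuleCat.{v} R) m).mapIso ((Hiso m e).trans (Hsingle m N)).symm.toModuleIso⟩

lemma isZero_of (Y : DerivedCategory (ModuleCat.{v} R)) 
    (h : ∀ i, Subsingleton (H i Y)) : IsZero Y := by
  have : Y.IsGE 1 := (isGE_iff _ _).2 fun i hi => 
    @ModuleCat.isZero_of_subsingleton _ _ _ (h i)
  have : Y.IsLE 0 := (isLE_iff _ _).2 fun i hi => 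
    @ModuleCat.isZero_of_subsingleton _ _ _ (h i)
  exact TStructure.t.isZero Y 0 1
end

section
variable {R : Type} [CommRing R] [HasDerivedCategory.{w} (ModuleCat.{v} R)]

def V (P : PrimeSpectrum R) (b X : DerivedCategory (ModuleCat.{v} R)) : Prop :=
  ∃ s : R, s ∉ P.asIdeal ∧ ∀ φ : X ⟶ b, s • φ = 0

variable {P : PrimeSpectrum R} {b : DerivedCategory (ModuleCat.{v} R)}

lemma V_of_zero {X : DerivedCategory (ModuleCat.{v} R)} (h : ∀ φ : X ⟶ b, φ = 0) : V P b X :=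
  ⟨1, fun h => P.2.ne_top ((Ideal.eq_top_iff_one _).2 h), fun φ => by rw [h φ, smul_zero]⟩

lemma V_iso {X Y : DerivedCategory (ModuleCat.{v} R)} (e : X ≅ Y) (h : V P b X) : V P b Y := by
  obtain ⟨s, hs, h⟩ := h
  refine ⟨s, hs, fun φ => ?_⟩
  have := h (e.hom ≫ φ)
  rw [← Linear.comp_smul] at this
  rw [← cancel_epi e.hom, this, comp_zero]

lemma V_ext {T : Triangle (DerivedCategory (ModuleCat.{v} R))} (hT : T ∈ distTriang _)
    (h1 : V P b T.obj₁) (h3 : V P b T.obj₃) : V P b T.obj₂ := by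
  obtain ⟨s, hs, h1⟩ := h1
  obtain ⟨t, ht, h3⟩ := h3
  refine ⟨t * s, P.2.mul_notMem ht hs, fun φ => ?_⟩
  obtain ⟨g, hg⟩ := Triangle.yoneda_exact₂ T hT (s • φ) (by rw [Linear.comp_smul, h1])
  rw [mul_smul, hg, ← Linear.comp_smul, h3, comp_zero]

lemma V_three {T : Triangle (DerivedCategory (ModuleCat.{v} R))} (hT : T ∈ distTriang _)
    (h1 : V P b (T.obj₁⟦(1:ℤ)⟧)) (h2 : V P b T.obj₂) : V P b T.obj₃ := 
  V_ext (rot_of_distTriang _ hT) h2 h1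

lemma V_inv {T : Triangle (DerivedCategory (ModuleCat.{v} R))} (hT : T ∈ distTriang _)
    (h3 : V P b (T.obj₃⟦(-1:ℤ)⟧)) (h2 : V P b T.obj₂) : V P b T.obj₁ := 
  V_ext (inv_rot_of_distTriang _ hT) h3 h2

lemma V_sg_iso (i : ℤ) {N N' : ModuleCat.{v} R} (e : N ≃ₗ[R] N') (h : V P b (Sg i N)) :
    V P b (Sg i N') :=
  V_iso ((singleFunctor (ModuleCat.{v} R) i).mapIso e.toModuleIso) h

lemma sg_smul (i : ℤ) {N : ModuleCat.{v} R} (s : R) (φ : Sg i N ⟶ b) :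
    s • φ = (singleFunctor (ModuleCat.{v} R) i).map (s • 𝟙 N) ≫ φ := by
  rw [Functor.map_smul]; simp

lemma V_sg_killed (i : ℤ) {N : ModuleCat.{v} R} (s : R) (hs : s ∉ P.asIdeal)
    (h : ∀ n : N, s • n = 0) : V P b (Sg i N) := by
  refine ⟨s, hs, fun φ => ?_⟩
  have : s • 𝟙 N = 0 := by
    ext n
    exact h n
  rw [sg_smul, this, Functor.map_zero, zero_comp]

lemma V_sg_sub (i : ℤ) {N : ModuleCat.{v} R} (h : Subsingleton N) : V P b (Sg i N) :=
  V_sg_killed i 1 (fun h => P.2.ne_top ((Ideal.eq_top_iff_one _).2 h)) 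
    (fun _ => Subsingleton.elim _ _)

lemma V_sg_supp (i : ℤ) {N : ModuleCat.{v} R} [Module.Finite R N]
    (h : P ∉ Module.support R N) : V P b (Sg i N) := by
  rw [Module.mem_support_iff_of_finite, SetLike.le_def] at h
  push Not at h
  obtain ⟨s, hs, hs'⟩ := h
  exact V_sg_killed i s hs' (fun n => Module.mem_annihilator.1 hs n)

/-- dévissage -/
lemma dev (k : ℕ) : ∀ (lo : ℤ) (Y : DerivedCategory (ModuleCat.{v} R)) 
    (_ : ∀ i, i < lo ∨ lo + k ≤ i → Subsingleton (H i Y))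
    (_ : ∀ i, V P b (Sg i (H i Y))), V P b Y := by
  induction k with
  | zero => 
    intro lo Y h _
    exact V_of_zero fun φ => (isZero_of Y fun i => h i (by grind)).eq_of_src _ _
  | succ k ih =>
    intro lo Y h hV
    obtain ⟨X, Z, f, g, d, hT, hX, hX', hZ, hZ'⟩ := trunc Y (lo + k - 1)
    refine V_ext hT (ih lo X ?_ ?_) ?_
    · rintro i (hi | hi)
      · have := h i (.inl hi)
        exact (hX i (by lia)).some.toEquiv.subsingleton
      · exact hX' i (by lia)
    · intro i
      rcases le_or_gt i (lo + k - 1) with hi | hi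
      · exact V_sg_iso i (hX i hi).some.symm (hV i)
      · exact V_sg_sub i (hX' i hi)
    · obtain ⟨e⟩ := iso_single Z (lo + k) (by
        intro i hi
        rcases le_or_gt i (lo + k - 1) with hi' | hi'
        · exact hZ' i hi'
        · have := h i (.inr (by push_cast; lia))
          exact (hZ i hi').some.toEquiv.subsingleton)
      refine V_iso e.symm (V_sg_iso _ (hZ _ (by lia)).some.symm (hV _))

def TT (P : PrimeSpectrum R) (N : Type v) [AddCommGroup N] [Module R N] : Prop :=
  ∀ q ∈ Module.support R N, q ≤ P → q = P

lemma sesOf {N₁ N₂ N₃ : Type v} [AddCommGroup N₁] [Module R N₁] [AddCommGroup N₂] [Module R N₂]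
    [AddCommGroup N₃] [Module R N₃] (f : N₁ →ₗ[R] N₂) (g : N₂ →ₗ[R] N₃)
    (hf : Function.Injective f) (hg : Function.Surjective g) (hfg : Function.Exact f g) (j : ℤ) :
    ∃ δ, Triangle.mk ((singleFunctor (ModuleCat.{v} R) j).map (ModuleCat.ofHom f))
      ((singleFunctor (ModuleCat.{v} R) j).map (ModuleCat.ofHom g)) δ ∈ distTriang _ := by
  let S : ShortComplex (ModuleCat.{v} R) := ShortComplex.mk (ModuleCat.ofHom f) (ModuleCat.ofHom g) 
    (by ext x; exact hfg.apply_apply_eq_zero x)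
  have hS : S.ShortExact :=
    { exact := (ShortComplex.ShortExact.moduleCat_exact_iff_function_exact S).2 hfg
      mono_f := (ModuleCat.mono_iff_injective _).2 hf
      epi_g := (ModuleCat.epi_iff_surjective _).2 hg }
  exact sgTri hS j

lemma V_sg_T [IsNoetherianRing R] (j : ℤ) 
    (h : ∀ N : ModuleCat.{v} R, Nonempty (N ≃ₗ[R] R ⧸ P.asIdeal) → V P b (Sg j N))
    (N : Type v) [AddCommGroup N] [Module R N] [hN : Module.Finite R N] : 
    TT P N → V P b (Sg j (ModuleCat.of R N)) := by
  induction hN using IsNoetherianRing.induction_on_isQuotientEquivQuotientPrime R with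
  | subsingleton N => intro _; exact V_sg_sub j ‹_›
  | quotient N q e => 
    intro hN
    by_cases hq : q ≤ P
    · have : q ∈ Module.support R N := by
        rw [e.support_eq, Module.mem_support_iff_of_finite, Ideal.annihilator_quotient]
      obtain rfl := hN q this hq
      exact h _ ⟨e⟩
    · apply V_sg_supp
      show P ∉ Module.support R N
      rwa [e.support_eq, Module.mem_support_iff_of_finite, Ideal.annihilator_quotient]
  | exact N₁ N₂ N₃ f g hf hg hfg h1 h3 => 
    intro hN
    have hs := Module.support_of_exact hfg hf hg
    obtain ⟨δ, hT⟩ := sesOf f g hf hg hfg j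
    exact V_ext hT (h1 fun q hq => hN q (hs ▸ .inl hq)) (h3 fun q hq => hN q (hs ▸ .inr hq))

lemma step1 (j : ℤ) (X : DerivedCategory (ModuleCat.{v} R)) 
    (hf : ∀ i, Module.Finite R (H i X)) (lo hi : ℤ)
    (hb : ∀ i, i < lo ∨ hi < i → Subsingleton (H i X)) (hT : ∀ i, TT P (H i X))
    (hP : ∀ i, j < i → P ∉ Module.support R (H i X)) (hz : ∀ φ : X ⟶ b, φ = 0)
    (hQ : ∀ i, i < j → ∀ (N : Type v) [AddCommGroup N] [Module R N] [Module.Finite R N],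
      TT P N → V P b (Sg i (ModuleCat.of R N))) : V P b (Sg j (H j X)) := by
  obtain ⟨X1, X2, f, g, d, hTr, h1, h1', h2, h2'⟩ := trunc X (j-1)
  have hV2 : V P b X2 := by
    refine V_three hTr ?_ (V_of_zero hz)
    refine dev (j - lo).toNat (lo - 1) _ ?_ ?_
    · intro i hi
      refine @Equiv.subsingleton _ _ (Hshift 1 i (i+1) (by lia) X1).toEquiv ?_
      rcases le_or_gt (i+1) (j-1) with h | h
      · have := hb (i+1) (by lia)
        exact (h1 (i+1) h).some.toEquiv.subsingleton
      · exact h1' _ h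
    · intro i
      refine V_sg_iso i (Hshift 1 i (i+1) (by lia) X1).symm ?_
      rcases le_or_gt (i+1) (j-1) with h | h
      · refine V_sg_iso i (h1 _ h).some.symm ?_
        have := hf (i+1)
        exact hQ i (by lia) _ (hT (i+1))
      · exact V_sg_sub _ (h1' _ h)
  obtain ⟨X3, X4, f, g, d, hTr, h3, h3', h4, h4'⟩ := trunc X2 j
  have hV3 : V P b X3 := by
    refine V_inv hTr ?_ hV2
    refine dev (hi + 1 - j).toNat (j + 1) _ ?_ ?_
    · intro i hi
      refine @Equiv.subsingleton _ _ (Hshift (-1) i (i-1) (by lia) X4).toEquiv ?_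
      rcases le_or_gt (i-1) j with h | h
      · exact h4' _ h
      · have := hb (i-1) (by lia)
        exact ((h4 (i-1) h).some.trans (h2 (i-1) (by lia)).some).toEquiv.subsingleton
    · intro i
      refine V_sg_iso i (Hshift (-1) i (i-1) (by lia) X4).symm ?_
      rcases le_or_gt (i-1) j with h | h
      · exact V_sg_sub _ (h4' _ h)
      · refine V_sg_iso i ((h4 (i-1) h).some.trans (h2 (i-1) (by lia)).some).symm ?_
        have := hf (i-1)
        exact V_sg_supp _ (hP _ h)
  obtain ⟨e⟩ := iso_single X3 j (by
    intro i hi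
    rcases le_or_gt i j with h | h
    · have := h2' i (by lia)
      exact (h3 i h).some.toEquiv.subsingleton
    · exact h3' _ h)
  exact V_sg_iso j ((h3 j le_rfl).some.trans (h2 j (by lia)).some) (V_iso e hV3)

lemma step2 [IsNoetherianRing R] (j : ℤ) (M : Type v) [AddCommGroup M] [Module R M] 
    [Module.Finite R M] (hT : TT P M) (hP : P ∈ Module.support R M)
    (hV : V P b (Sg j (ModuleCat.of R M)))
    (hQ : ∀ (N : Type v) [AddCommGroup N] [Module R N] [Module.Finite R N],
      TT P N → V P b (Sg (j-1) (ModuleCat.of R N))) : 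
    ∀ N : ModuleCat.{v} R, Nonempty (N ≃ₗ[R] R ⧸ P.asIdeal) → V P b (Sg j N) := by
  obtain ⟨K, hK, hmax⟩ := WellFounded.has_min (r := ((· > ·) : Submodule R M → Submodule R M → Prop))
    (wellFounded_gt) {K | P ∈ Module.support R (M ⧸ K)} 
    ⟨⊥, by
      show P ∈ Module.support R (M ⧸ (⊥ : Submodule R M))
      rwa [(Submodule.quotEquivOfEqBot ⊥ rfl).support_eq]⟩
  have hexK : Function.Exact K.subtype K.mkQ := LinearMap.exact_subtype_mkQ K
  have hVL : V P b (Sg j (ModuleCat.of R (M ⧸ K))) := by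
    obtain ⟨δ, hTr⟩ := sesOf K.subtype K.mkQ K.injective_subtype K.mkQ_surjective hexK j
    refine V_three hTr ?_ hV
    refine V_iso (Sgshift 1 (j-1) j (by lia) _).symm (hQ K fun q hq => hT q ?_)
    exact Module.support_subset_of_injective _ K.injective_subtype hq
  have hnt : Nontrivial (M ⧸ K) := Module.nonempty_support_iff.1 ⟨P, hK⟩
  obtain ⟨q, hq⟩ := associatedPrimes.nonempty R (M ⧸ K)
  obtain ⟨hqp, l, hl⟩ := (isAssociatedPrime_iff_exists_injective_linearMap q (M ⧸ K)).1 hq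
  have hsurj : ∃ s : R, s ∉ P.asIdeal ∧ ∀ y : M ⧸ K, ∃ z, l z = s • y := by
    have hlt : K < (LinearMap.range l).comap K.mkQ := by
      refine lt_of_le_of_ne ?_ ?_
      · intro m hm
        rw [Submodule.mem_comap, Submodule.mkQ_apply, (Submodule.Quotient.mk_eq_zero K).2 hm]
        exact zero_mem _
      · intro hKe
        obtain ⟨m, hm⟩ := K.mkQ_surjective (l 1)
        have h1 : m ∈ (LinearMap.range l).comap K.mkQ := by
          rw [Submodule.mem_comap, hm]; exact ⟨1, rfl⟩
        rw [← hKe] at h1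
        have h2 : K.mkQ m = 0 := (Submodule.Quotient.mk_eq_zero K).2 h1
        rw [h2] at hm
        have h3 : (1 : R ⧸ q) = 0 := hl (by rw [← hm, map_zero])
        have := Ideal.Quotient.nontrivial_iff.2 hqp.ne_top
        exact one_ne_zero h3
    have h1 : P ∉ Module.support R (M ⧸ (LinearMap.range l).comap K.mkQ) := fun h => hmax _ h hlt
    rw [Module.mem_support_iff_of_finite, SetLike.le_def] at h1
    push Not at h1
    obtain ⟨s, hs, hs'⟩ := h1
    refine ⟨s, hs', fun y => ?_⟩
    obtain ⟨m, rfl⟩ := K.mkQ_surjective y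
    have h2 := Module.mem_annihilator.1 hs (Submodule.Quotient.mk m)
    rw [← Submodule.Quotient.mk_smul, Submodule.Quotient.mk_eq_zero] at h2
    obtain ⟨z, hz⟩ := h2
    exact ⟨z, by rw [hz, map_smul]⟩
  obtain ⟨s, hs, hs'⟩ := hsurj
  have hqP : q ≤ P.asIdeal := by
    intro t ht
    by_contra htP
    refine P.2.mul_notMem htP hs (Module.annihilator_le_of_mem_support hK ?_)
    rw [Module.mem_annihilator]
    intro y
    obtain ⟨z, hz⟩ := hs' y
    obtain ⟨r, rfl⟩ := Ideal.Quotient.mk_surjective z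
    rw [mul_smul, ← hz, ← map_smul]
    have : t • (Ideal.Quotient.mk q r) = 0 := by
      rw [Algebra.smul_def, Ideal.Quotient.algebraMap_eq, Ideal.Quotient.eq_zero_iff_mem.2 ht,
        zero_mul]
    rw [this, map_zero]
  have hqs : (⟨q, hqp⟩ : PrimeSpectrum R) ∈ Module.support R M := by
    refine Module.support_subset_of_surjective _ K.mkQ_surjective
      (Module.support_subset_of_injective l hl ?_)
    rw [Module.mem_support_iff_of_finite, Ideal.annihilator_quotient]
  obtain rfl : (⟨q, hqp⟩ : PrimeSpectrum R) = P := hT _ hqs hqP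
  rintro N ⟨e⟩
  let i : N →ₗ[R] M ⧸ K := l ∘ₗ e.toLinearMap
  have hi : Function.Injective i := hl.comp e.injective
  have hr : ∀ y, s • y ∈ LinearMap.range i := by
    intro y
    obtain ⟨z, hz⟩ := hs' y
    exact ⟨e.symm z, by simp [i, hz]⟩
  let m : (M ⧸ K) →ₗ[R] N := (LinearEquiv.ofInjective i hi).symm.toLinearMap ∘ₗ
    (LinearMap.codRestrict (LinearMap.range i) (s • LinearMap.id) hr)
  have him : m ∘ₗ i = s • LinearMap.id := by
    ext x
    apply hi
    show i ((LinearEquiv.ofInjective i hi).symm _) = _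
    rw [← LinearEquiv.ofInjective_apply (h := hi), LinearEquiv.apply_symm_apply]
    simp
  have him' : (ModuleCat.ofHom i) ≫ ModuleCat.ofHom m = s • 𝟙 N := by
    ext x
    exact LinearMap.congr_fun him x
  obtain ⟨t, ht, hVL⟩ := hVL
  refine ⟨t * s, Ideal.IsPrime.mul_notMem hqp ht hs, fun φ => ?_⟩
  rw [mul_smul, sg_smul j s, ← him', Functor.map_comp, Category.assoc, ← Linear.comp_smul, hVL,
    comp_zero]

/-- finite bounded homology -/
def FB (X : DerivedCategory (ModuleCat.{v} R)) : Prop :=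
  (∀ i, Module.Finite R (H i X)) ∧ ∃ lo hi : ℤ, ∀ i, i < lo ∨ hi < i → Subsingleton (H i X)

lemma FB_iff (X : DerivedCategory (ModuleCat.{v} R)) : memDqc R X ↔ FB X := by
  constructor
  · rintro ⟨h1, h2⟩
    refine ⟨fun i => ?_, ?_⟩
    · have := h1 (-i)
      unfold Hh at this
      rwa [neg_neg] at this
    · obtain ⟨l, hl⟩ := h2.bddBelow
      obtain ⟨u, hu⟩ := h2.bddAbove
      refine ⟨-u, -l, fun i hi => ?_⟩
      apply ModuleCat.subsingleton_of_isZero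
      by_contra hc
      have hm : -i ∈ {n : ℤ | ¬ IsZero (Hh R n X)} := by
        simp only [Set.mem_ofPred_eq, Hh, neg_neg]
        exact hc
      have := hl hm
      have := hu hm
      lia
  · rintro ⟨h1, lo, hi, h2⟩
    refine ⟨fun i => h1 (-i), (Set.finite_Icc (-hi) (-lo)).subset fun i hi' => ?_⟩
    by_contra hc
    apply hi'
    rw [Set.mem_Icc] at hc
    exact @ModuleCat.isZero_of_subsingleton _ _ _ (h2 (-i) (by lia))

lemma FB_three [IsNoetherianRing R] {T : Triangle (DerivedCategory (ModuleCat.{v} R))}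
    (hT : T ∈ distTriang _) (h1 : FB T.obj₁) (h2 : FB T.obj₂) : FB T.obj₃ := by
  obtain ⟨f1, l1, u1, b1⟩ := h1
  obtain ⟨f2, l2, u2, b2⟩ := h2
  refine ⟨fun i => ?_, min l2 (l1 - 1), max u2 u1, fun i hi => ?_⟩
  · obtain ⟨δ, hδ, -⟩ := les3 hT i (i+1) rfl
    have := f1 (i+1)
    have := f2 i
    have := isNoetherian_of_range_eq_ker (Hm i T.mor₂) δ hδ.linearMap_ker_eq.symm
    infer_instance
  · obtain ⟨δ, hδ, -⟩ := les3 hT i (i+1) rfl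
    have := b1 (i+1) (by lia)
    have := b2 i (by lia)
    refine subsingleton_of_forall_eq 0 fun y => ?_
    obtain ⟨z, rfl⟩ := (hδ y).1 (Subsingleton.elim _ _)
    rw [Subsingleton.elim z 0, map_zero]

lemma FB_shift {X : DerivedCategory (ModuleCat.{v} R)} (h : FB X) : FB (X⟦(1:ℤ)⟧) := by
  obtain ⟨f, l, u, b⟩ := h
  refine ⟨fun i => ?_, l - 1, u - 1, fun i hi => ?_⟩
  · have := f (i+1)
    exact Module.Finite.equiv (Hshift 1 i (i+1) (by lia) X).symm
  · have := b (i+1) (by lia)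
    exact (Hshift 1 i (i+1) (by lia) X).toEquiv.subsingleton

lemma FB_single (j : ℤ) (N : ModuleCat.{v} R) [Module.Finite R N] : FB (Sg j N) := by
  refine ⟨fun i => ?_, j, j, fun i hi => Hsub _ _ (by lia) _⟩
  by_cases h : i = j
  · subst h
    exact Module.Finite.equiv (Hsingle i N).symm
  · have := Hsub i j h N
    infer_instance

lemma les2' {X Y Z : DerivedCategory (ModuleCat.{v} R)} {f : X ⟶ Y} {g : Y ⟶ Z}
    {h : Z ⟶ X⟦(1:ℤ)⟧} (hT : Triangle.mk f g h ∈ distTriang _) (i : ℤ) :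
    Function.Exact (Hm i f) (Hm i g) := les2 hT i

lemma les3' {X Y Z : DerivedCategory (ModuleCat.{v} R)} {f : X ⟶ Y} {g : Y ⟶ Z}
    {h : Z ⟶ X⟦(1:ℤ)⟧} (hT : Triangle.mk f g h ∈ distTriang _) (i j : ℤ) (hij : i + 1 = j) :
    ∃ δ : H i Z →ₗ[R] H j X, Function.Exact (Hm i g) δ ∧ Function.Exact δ (Hm j f) :=
  les3 hT i j hij

open Pointwise in
/-- one Koszul step -/
lemma koszul [IsNoetherianRing R] (U : Set (DerivedCategory (ModuleCat.{v} R)))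
    (hU : IsCocompletePreaisle R U) (P : PrimeSpectrum R) (j : ℤ)
    (X : DerivedCategory (ModuleCat.{v} R)) (hX : X ∈ U) (hF : FB X)
    (hP : P ∈ Module.support R (H j X)) (hP' : ∀ i, j < i → P ∉ Module.support R (H i X))
    (S : Finset R) : (∀ x ∈ S, x ∈ P.asIdeal) →
    ∃ Y ∈ U, FB Y ∧ P ∈ Module.support R (H j Y) ∧ (∀ i, j < i → P ∉ Module.support R (H i Y)) ∧
      ∀ x ∈ S, ∀ i, ∀ q ∈ Module.support R (H i Y), x ∈ q.asIdeal := by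
  classical
  induction S using Finset.induction_on with
  | empty => exact fun _ => ⟨X, hX, hF, hP, hP', by simp⟩
  | insert x S _ ih =>
    intro hS
    obtain ⟨Y, hY, hF, hP, hP', hYS⟩ := ih fun y hy => hS y (Finset.mem_insert_of_mem hy)
    obtain ⟨C, g, d, hT⟩ := distinguished_cocone_triangle (x • 𝟙 Y)
    have hx1 : ∀ i (y : H i Y), Hm i (x • 𝟙 Y) y = x • y := by
      intro i y
      rw [Hm_smul]
      simp [Hm]
    have hsub : ∀ i, ∀ q ∈ Module.support R (H i C),
        q ∈ Module.support R (H i Y) ∨ q ∈ Module.support R (H (i+1) Y) := by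
      intro i q hq
      by_contra! hc
      rw [Module.notMem_support_iff', Module.notMem_support_iff'] at hc
      revert hq
      rw [imp_false, Module.notMem_support_iff']
      intro m
      obtain ⟨δ, h1, h2⟩ := les3' hT i (i+1) rfl
      obtain ⟨r, hr, hr'⟩ := hc.2 (δ m)
      rw [← map_smul] at hr'
      obtain ⟨z, hz⟩ := (h1 _).1 hr'
      obtain ⟨r2, hr2, hr2'⟩ := hc.1 z
      refine ⟨r2 * r, q.2.mul_notMem hr2 hr, ?_⟩
      rw [mul_smul, ← hz, ← map_smul, hr2']
      exact map_zero _
    have hkill : ∀ i, ∀ q ∈ Module.support R (H i C), x ∈ q.asIdeal := by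
      intro i q hq
      have : x * x ∈ Module.annihilator R (H i C) := by
        rw [Module.mem_annihilator]
        intro m
        obtain ⟨δ, h1, h2⟩ := les3' hT i (i+1) rfl
        have h3 : δ (x • m) = 0 := by
          rw [map_smul]
          exact (hx1 _ _).symm.trans ((h2 _).2 ⟨m, rfl⟩)
        obtain ⟨z, hz⟩ := (h1 _).1 h3
        rw [mul_smul, ← hz, ← map_smul]
        refine (les2' hT i _).2 ⟨z, hx1 _ _⟩
      have := Module.annihilator_le_of_mem_support hq this
      exact (q.2.mem_or_mem this).elim id id
    refine ⟨C, hU.ext_mem _ _ _ (rot_of_distTriang _ hT) hY (hU.shift_mem hY), FB_three hT hF hF,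
      ?_, ?_, ?_⟩
    · have := hF.1 j
      have h1 : P ∈ Module.support R (QuotSMulTop x (H j Y)) := by
        rw [Module.support_quotSMulTop]
        refine ⟨hP, ?_⟩
        simpa using hS x (Finset.mem_insert_self _ _)
      have hle : x • (⊤ : Submodule R (H j Y)) ≤ LinearMap.ker (Hm j g) := by
        rintro _ ⟨y, -, rfl⟩
        exact (les2' hT j _).2 ⟨y, hx1 _ _⟩
      refine Module.support_subset_of_injective (Submodule.liftQ _ (Hm j g) hle) ?_ h1
      rw [← LinearMap.ker_eq_bot]
      apply Submodule.ker_liftQ_eq_bot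
      intro y hy
      obtain ⟨z, hz⟩ := (les2' hT j y).1 hy
      exact ⟨z, trivial, (hx1 _ _).symm.trans hz⟩
    · intro i hi hc
      rcases hsub i P hc with h | h
      · exact hP' i hi h
      · exact hP' (i+1) (by lia) h
    · intro y hy i q hq
      rcases Finset.mem_insert.1 hy with rfl | hy
      · exact hkill i q hq
      · rcases hsub i q hq with h | h
        · exact hYS y hy _ q h
        · exact hYS y hy _ q h

end

section
variable {R : Type} [CommRing R] [HasDerivedCategory.{w} (ModuleCat.{v} R)]

lemma gen0 [IsNoetherianRing R] (U : Set (DerivedCategory (ModuleCat.{v} R)))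
    (hU : IsCocompletePreaisle R U) (P : PrimeSpectrum R) (c : ℤ)
    (X : DerivedCategory (ModuleCat.{v} R)) (hX : X ∈ U) (hF : FB X)
    (hP : P ∈ Module.support R (H c X)) : ∃ j, c ≤ j ∧ ∃ Y ∈ U, FB Y ∧
      P ∈ Module.support R (H j Y) ∧ (∀ i, j < i → P ∉ Module.support R (H i Y)) ∧
      ∀ i, TT P (H i Y) := by
  obtain ⟨lo, hi, hb⟩ := hF.2
  obtain ⟨j, hj, hjm⟩ := Int.exists_greatest_of_bdd
    (P := fun i => P ∈ Module.support R (H i X))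
    ⟨hi, fun i h => by
      by_contra hc
      have h1 := hb i (.inr (by lia))
      have h2 : Nontrivial (H i X) := Module.nonempty_support_iff.1 ⟨P, h⟩
      exact not_subsingleton _ h1⟩ ⟨c, hP⟩
  obtain ⟨S, hS⟩ := (IsNoetherian.noetherian P.asIdeal : P.asIdeal.FG)
  obtain ⟨Y, hY, hFY, h1, h2, h3⟩ := koszul U hU P j X hX hF hj
    (fun i hi hc => by have := hjm i hc; lia) S
    (fun x hx => by rw [← hS]; exact Submodule.subset_span hx)
  refine ⟨j, hjm c hP, Y, hY, hFY, h1, h2, fun i q hq hqP => le_antisymm hqP ?_⟩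
  show P.asIdeal ≤ q.asIdeal
  rw [← hS]
  exact Submodule.span_le.2 fun x hx => h3 x hx i q hq

lemma gen1 (U : Set (DerivedCategory (ModuleCat.{v} R)))
    (hU : IsCocompletePreaisle R U) (P : PrimeSpectrum R) (j : ℤ) (k : ℕ)
    (h : ∃ Y ∈ U, FB Y ∧
      P ∈ Module.support R (H j Y) ∧ (∀ i, j < i → P ∉ Module.support R (H i Y)) ∧
      ∀ i, TT P (H i Y)) : ∃ Y ∈ U, FB Y ∧
      P ∈ Module.support R (H (j-k) Y) ∧ (∀ i, j-k < i → P ∉ Module.support R (H i Y)) ∧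
      ∀ i, TT P (H i Y) := by
  induction k with
  | zero =>
    have e : j - ((0:ℕ):ℤ) = j := by simp
    rw [e]
    exact h
  | succ k ih =>
    obtain ⟨Y, hY, hF, h1, h2, h3⟩ := ih
    have hs : ∀ i, Module.support R (H i (Y⟦(1:ℤ)⟧)) = Module.support R (H (i+1) Y) :=
      fun i => (Hshift 1 i (i+1) (by lia) Y).support_eq
    refine ⟨_, hU.shift_mem hY, FB_shift hF, ?_, ?_, ?_⟩
    · rw [hs]
      have : j - (k+1:ℕ) + 1 = j - k := by push_cast; lia
      rwa [this]
    · intro i hi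
      rw [hs]
      exact h2 _ (by push_cast at hi; lia)
    · intro i q hq
      rw [hs] at hq
      exact h3 _ q hq

lemma Qlow {P : PrimeSpectrum R} {b : DerivedCategory (ModuleCat.{v} R)} (lo j : ℤ) (hj : j < lo)
    (hb : ∀ i, i < lo → Subsingleton (H i b)) (N : ModuleCat.{v} R) : V P b (Sg j N) := by
  have : b.IsGE lo := (isGE_iff _ _).2 fun i hi =>
    @ModuleCat.isZero_of_subsingleton _ _ _ (hb i hi)
  exact V_of_zero fun φ => TStructure.t.zero φ j lo hj

lemma Qall [IsNoetherianRing R] {P : PrimeSpectrum R} {b : DerivedCategory (ModuleCat.{v} R)}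
    (lo c : ℤ) (hb : ∀ i, i < lo → Subsingleton (H i b))
    (hX : ∀ j, j ≤ c → ∃ Y : DerivedCategory (ModuleCat.{v} R), (∀ φ : Y ⟶ b, φ = 0) ∧ FB Y ∧
      P ∈ Module.support R (H j Y) ∧ (∀ i, j < i → P ∉ Module.support R (H i Y)) ∧
      ∀ i, TT P (H i Y)) (k : ℕ) : ∀ j, j ≤ c → j < lo + k → 
      ∀ (N : Type v) [AddCommGroup N] [Module R N] [Module.Finite R N],
      TT P N → V P b (Sg j (ModuleCat.of R N)) := by
  induction k with
  | zero => intro j _ hj N _ _ _ _; exact Qlow lo j (by simpa using hj) hb _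
  | succ k ih =>
    intro j hjc hj N _ _ _ hN
    obtain ⟨Y, hz, ⟨hf, l, u, hlu⟩, h1, h2, h3⟩ := hX j hjc
    have hV := step1 j Y hf l u hlu h3 h2 hz 
      (fun i hi N _ _ _ hN => ih i (by lia) (by push_cast at hj; lia) N hN)
    have := hf j
    exact V_sg_T j (step2 j (H j Y) (h3 j) h1 hV (fun N _ _ _ hN => 
      ih (j-1) (by lia) (by push_cast at hj; lia) N hN)) N hN

end

section
variable {R : Type} [CommRing R] [HasDerivedCategory.{w} (ModuleCat.{v} R)]

def EE (j : ℤ) (X b : DerivedCategory (ModuleCat.{v} R)) (e : H j X) : Submodule R (H j b) where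
  carrier := Set.range fun g : X ⟶ b => Hm j g e
  add_mem' := by
    rintro _ _ ⟨g, rfl⟩ ⟨g', rfl⟩
    exact ⟨g + g', by simp only [Hm_add]; rfl⟩
  zero_mem' := ⟨0, by simp only [Hm_zero]; rfl⟩
  smul_mem' := by
    rintro r _ ⟨g, rfl⟩
    exact ⟨r • g, by simp only [Hm_smul]; rfl⟩

lemma divT0 {T : Triangle (DerivedCategory (ModuleCat.{v} R))} (hT : T ∈ distTriang _)
    {b : DerivedCategory (ModuleCat.{v} R)} (s : R) (h1 : ∀ φ : T.obj₁ ⟶ b, s • φ = 0)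
    (φ : T.obj₂ ⟶ b) : ∃ g : T.obj₃ ⟶ b, s • φ = T.mor₂ ≫ g :=
  Triangle.yoneda_exact₂ T hT (s • φ) (by rw [Linear.comp_smul, h1])

lemma divT {X Y Z b : DerivedCategory (ModuleCat.{v} R)} {f : X ⟶ Y} {g : Y ⟶ Z}
    {h : Z ⟶ X⟦(1:ℤ)⟧} (hT : Triangle.mk f g h ∈ distTriang _) (s : R)
    (h1 : ∀ φ : Z⟦(-1:ℤ)⟧ ⟶ b, s • φ = 0) (φ : X ⟶ b) : ∃ g : Y ⟶ b, s • φ = f ≫ g :=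
  divT0 (inv_rot_of_distTriang _ hT) s h1 φ

open Pointwise in
lemma key1 [IsNoetherianRing R] {P p : PrimeSpectrum R} {b : DerivedCategory (ModuleCat.{v} R)}
    (hlt : p.asIdeal < P.asIdeal)
    (hmax : ∀ q : PrimeSpectrum R, p.asIdeal < q.asIdeal → ¬ q.asIdeal < P.asIdeal)
    (c : ℤ) (hb : Module.Finite R (H (c-1) b)) 
    (hQ : ∀ (N : Type v) [AddCommGroup N] [Module R N] [Module.Finite R N],
      TT P N → V P b (Sg c (ModuleCat.of R N)))
    (e : H (c-1) (Sg (c-1) (ModuleCat.of R (ULift.{v} (R ⧸ p.asIdeal))))) :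
    ∃ t ∉ P.asIdeal, ∀ g : Sg (c-1) (ModuleCat.of R (ULift.{v} (R ⧸ p.asIdeal))) ⟶ b,
      t • Hm (c-1) g e = 0 := by
  obtain ⟨x, hxP, hxp⟩ := SetLike.exists_of_lt hlt
  let L := ULift.{v} (R ⧸ p.asIdeal)
  let f : L →ₗ[R] L := x • LinearMap.id
  have hann : ∀ r ∈ p.asIdeal, ∀ y : L, r • y = 0 := by
    rintro r hr ⟨y⟩
    obtain ⟨y, rfl⟩ := Ideal.Quotient.mk_surjective y
    apply ULift.down_injective
    show r • (Ideal.Quotient.mk p.asIdeal y) = 0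
    rw [Algebra.smul_def, Ideal.Quotient.algebraMap_eq, Ideal.Quotient.eq_zero_iff_mem.2 hr,
        zero_mul]
  have hf : Function.Injective f := by
    rw [injective_iff_map_eq_zero]
    rintro ⟨y⟩ hy
    apply ULift.down_injective
    have h1 : x • y = 0 := congrArg ULift.down hy
    rw [Algebra.smul_def, Ideal.Quotient.algebraMap_eq] at h1
    rcases mul_eq_zero.1 h1 with h | h
    · exact absurd (Ideal.Quotient.eq_zero_iff_mem.1 h) hxp
    · exact h
  let N := L ⧸ LinearMap.range f
  have hTN : TT P N := by
    intro q hq hqP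
    have h1 : p.asIdeal ≤ q.asIdeal := fun r hr => Module.annihilator_le_of_mem_support hq (by
      rw [Module.mem_annihilator]
      intro y
      obtain ⟨y, rfl⟩ := Submodule.Quotient.mk_surjective _ y
      rw [← Submodule.Quotient.mk_smul, hann r hr, Submodule.Quotient.mk_zero])
    have h2 : x ∈ q.asIdeal := Module.annihilator_le_of_mem_support hq (by
      rw [Module.mem_annihilator]
      intro y
      obtain ⟨y, rfl⟩ := Submodule.Quotient.mk_surjective _ y
      rw [← Submodule.Quotient.mk_smul, Submodule.Quotient.mk_eq_zero]
      exact ⟨y, rfl⟩)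
    have h3 : p.asIdeal < q.asIdeal := lt_of_le_of_ne h1 fun h => hxp (h ▸ h2)
    by_contra hne
    exact hmax q h3 (lt_of_le_of_ne hqP fun h => hne (PrimeSpectrum.ext h))
  have hV : V P b ((Sg (c-1) (ModuleCat.of R N))⟦(-1:ℤ)⟧) :=
    V_iso (Sgshift (-1) c (c-1) (by lia) _).symm (hQ N hTN)
  obtain ⟨δ, hT⟩ := sesOf f (LinearMap.range f).mkQ hf (Submodule.mkQ_surjective _)
    (LinearMap.exact_map_mkQ_range f) (c-1)
  obtain ⟨s, hs, hV⟩ := hV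
  have hfx : ModuleCat.ofHom f = x • 𝟙 (ModuleCat.of R L) := by
    ext y; rfl
  have hdiv : ∀ g : Sg (c-1) (ModuleCat.of R L) ⟶ b, ∃ g₁ : Sg (c-1) (ModuleCat.of R L) ⟶ b,
      s • g = x • g₁ := by
    intro g
    obtain ⟨g₁, hg⟩ := divT hT s hV g
    refine ⟨g₁, ?_⟩
    rw [hg, sg_smul, ← hfx]
  let E := EE (c-1) (Sg (c-1) (ModuleCat.of R L)) b e
  have hE : P ∉ Module.support R E := by
    intro hPE
    have h1 : P ∈ Module.support R (QuotSMulTop x E) := by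
      rw [Module.support_quotSMulTop]
      exact ⟨hPE, by simpa using hxP⟩
    refine hs (Module.annihilator_le_of_mem_support h1 ?_)
    rw [Module.mem_annihilator]
    intro y
    obtain ⟨⟨_, g, rfl⟩, rfl⟩ := Submodule.Quotient.mk_surjective _ y
    rw [← Submodule.Quotient.mk_smul, Submodule.Quotient.mk_eq_zero]
    obtain ⟨g₁, hg⟩ := hdiv g
    refine ⟨⟨_, g₁, rfl⟩, trivial, ?_⟩
    apply Subtype.ext
    show x • Hm (c-1) g₁ e = s • Hm (c-1) g e
    rw [← LinearMap.smul_apply, ← LinearMap.smul_apply, ← Hm_smul, ← Hm_smul, hg]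
  have : Module.Finite R E := inferInstance
  rw [Module.mem_support_iff_of_finite, SetLike.le_def] at hE
  push Not at hE
  obtain ⟨t, ht, ht'⟩ := hE
  exact ⟨t, ht', fun g => congrArg Subtype.val (Module.mem_annihilator.1 ht ⟨_, g, rfl⟩)⟩

lemma ass_of_ann [IsNoetherianRing R] (p : PrimeSpectrum R) (M : ModuleCat.{v} R)
    [Module.Finite R M] (h : p ∈ Module.support R M) : 
    ∃ q ∈ associatedPrimes R M, q ≤ p.asIdeal := by
  have h1 := Module.annihilator_le_of_mem_support h
  obtain ⟨q, hq, hqp⟩ := Ideal.exists_minimalPrimes_le h1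
  exact ⟨q, Module.associatedPrimes.minimalPrimes_annihilator_subset_associatedPrimes R M hq, hqp⟩

lemma main [IsNoetherianRing R]
    (A : Set (DerivedCategory (ModuleCat.{v} R))) (hA : IsNullityClass R A)
    (haisle : ∀ M : DerivedCategory (ModuleCat.{v} R), memDqc R M →
      ∃ (a b : DerivedCategory (ModuleCat.{v} R)) (f : a ⟶ M) (g : M ⟶ b) (h : b ⟶ a⟦(1 : ℤ)⟧),
        (Triangle.mk f g h ∈ distTriang (DerivedCategory (ModuleCat.{v} R))) ∧ a ∈ A ∧
        ∀ x ∈ A, ∀ φ : x ⟶ b, φ = 0)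
    (n : ℤ) (p' p : PrimeSpectrum R) (hp' : p' ∈ phi R A n)
    (hlt : p.asIdeal < p'.asIdeal)
    (hmax : ∀ q : PrimeSpectrum R, p.asIdeal < q.asIdeal → ¬ q.asIdeal < p'.asIdeal) :
    p ∈ phi R A (n + 1) := by
  obtain ⟨U, hU, rfl⟩ := hA
  obtain ⟨M, ⟨hMU, hMf⟩, q, hq, hqp⟩ := hp'
  have hMf' := (FB_iff M).1 hMf
  have hfin : Module.Finite R (H (-n) M) := hMf'.1 _
  have hP : p' ∈ Module.support R (H (-n) M) := by
    rw [Module.mem_support_iff_of_finite]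
    have hq' : q ∈ associatedPrimes R (H (-n) M) := hq
    rw [← Submodule.annihilator_top]
    exact (IsAssociatedPrime.annihilator_le hq').trans hqp
  obtain ⟨j, hj, hY⟩ := gen0 U hU p' (-n) M hMU hMf' hP
  have hgen : ∀ i, i ≤ -n → ∃ Y ∈ U, FB Y ∧
      p' ∈ Module.support R (H i Y) ∧ (∀ k, i < k → p' ∉ Module.support R (H k Y)) ∧
      ∀ k, TT p' (H k Y) := by
    intro i hi
    have := gen1 U hU p' j (j - i).toNat hY
    have e : j - ((j-i).toNat : ℤ) = i := by lia
    rwa [e] at this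
  let L := ModuleCat.of R (ULift.{v} (R ⧸ p.asIdeal))
  have hLf : Module.Finite R L := 
    Module.Finite.equiv (ULift.moduleEquiv (R := R) (M := R ⧸ p.asIdeal)).symm
  have hFL : FB (Sg (-n-1) L) := FB_single _ _
  obtain ⟨a, b, f, g, h, hT, ⟨haU, haf⟩, hort⟩ := haisle (Sg (-n-1) L) ((FB_iff _).2 hFL)
  have haf' := (FB_iff a).1 haf
  have hFb : FB b := FB_three hT haf' hFL
  obtain ⟨hbf, lo, hi, hb⟩ := hFb
  have hQ := Qall (P := p') (b := b) lo (-n) (fun i hi => hb i (.inl hi)) (by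
    intro i hi
    obtain ⟨Y, hYU, hYF, h⟩ := hgen i hi
    exact ⟨Y, fun φ => hort Y ⟨hYU, (FB_iff Y).2 hYF⟩ φ, hYF, h⟩) (-n + 1 - lo).toNat (-n) le_rfl
      (by lia)
  let e1 : H (-n-1) (Sg (-n-1) L) := (Hsingle (-n-1) L).symm (ULift.up 1)
  obtain ⟨t, htP, ht⟩ := key1 hlt hmax (-n) (hbf _) (fun N _ _ _ hN => hQ N hN) e1
  obtain ⟨α, hα⟩ := (les2' hT (-n-1) (t • e1)).1 (by rw [map_smul]; exact ht g)
  have hfa : Module.Finite R (H (-n-1) a) := haf'.1 _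
  have hsup : p ∈ Module.support R (H (-n-1) a) := by
    rw [Module.mem_support_iff_of_finite]
    intro r hr
    have h1 : r • α = 0 := Module.mem_annihilator.1 hr α
    have h2 : (r * t) • e1 = 0 := by rw [mul_smul, ← hα, ← map_smul, h1, map_zero]
    have h3 : (r * t) • (ULift.up 1 : ULift.{v} (R ⧸ p.asIdeal)) = 0 := by
      have := congrArg (Hsingle (-n-1) L) h2
      rw [map_smul, map_zero, LinearEquiv.apply_symm_apply] at this
      exact this
    have h4 : (r * t) • (1 : R ⧸ p.asIdeal) = 0 := congrArg ULift.down h3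
    rw [Algebra.smul_def, mul_one, Ideal.Quotient.algebraMap_eq, 
      Ideal.Quotient.eq_zero_iff_mem] at h4
    exact (p.2.mem_or_mem h4).resolve_right fun h => htP (hlt.le h)
  obtain ⟨q, hq, hqp⟩ := ass_of_ann p (H (-n-1) a) hsup
  refine ⟨a, ⟨haU, haf⟩, q, ?_, hqp⟩
  unfold Hh
  have e : -(n+1) = -n-1 := by lia
  rw [e]
  exact hq

end
end S18

/-- Let `A` be an aisle in `D_qc(R)` (a nullity class such that for every
`M ∈ D_qc(R)` there is a distinguished triangle `a ⟶ M ⟶ b ⟶ s a` with `a ∈ A` and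
`Hom(x, b) = 0` for all `x ∈ A`). Then `φ(A)` is comonotone: if `p' ∈ φ(A)(n)` and `p` is
maximal among primes strictly contained in `p'`, then `p ∈ φ(A)(n+1)`. -/
theorem stmt18 (R : Type) [CommRing R] [IsNoetherianRing R]
    [HasDerivedCategory.{w} (ModuleCat R)]
    (A : Set (DerivedCategory (ModuleCat R))) (hA : IsNullityClass R A)
    (haisle : ∀ M : DerivedCategory (ModuleCat R), memDqc R M →
      ∃ (a b : DerivedCategory (ModuleCat R)) (f : a ⟶ M) (g : M ⟶ b) (h : b ⟶ a⟦(1 : ℤ)⟧),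
        (Triangle.mk f g h ∈ distTriang (DerivedCategory (ModuleCat R))) ∧ a ∈ A ∧
        ∀ x ∈ A, ∀ φ : x ⟶ b, φ = 0)
    (n : ℤ) (p' p : PrimeSpectrum R) (hp' : p' ∈ phi R A n)
    (hlt : p.asIdeal < p'.asIdeal)
    (hmax : ∀ q : PrimeSpectrum R, p.asIdeal < q.asIdeal → ¬ q.asIdeal < p'.asIdeal) :
    p ∈ phi R A (n + 1) := by
  exact S18.main A hA haisle n p' p hp' hlt hmax
end

section
/- Let A and B be abelian groups with Hom_ℤ(A, B) = 0. Regard A and B as objects of D(ℤ) concentrated in homological degree 0, and let C̄(A) be the smallest cocomplete preaisle in D(ℤ) containing A. Then Hom_{D(ℤ)}(X, B) = 0 for every X ∈ C̄(A); in particular, if B ≠ 0 then B ∉ C̄(A). -/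
open CategoryTheory CategoryTheory.Limits CategoryTheory.Pretriangulated

universe w

def orthB [HasDerivedCategory.{w} (ModuleCat ℤ)] (B : ModuleCat ℤ) :
    Set (DerivedCategory (ModuleCat ℤ)) :=
  {X | ∀ m : ℤ, 0 ≤ m → ∀ φ : X ⟶ (DerivedCategory.singleFunctor (ModuleCat ℤ) m).obj B, φ = 0}

theorem orthB_preaisle [HasDerivedCategory.{w} (ModuleCat ℤ)] (B : ModuleCat ℤ) :
    IsCocompletePreaisle ℤ (orthB B) where
  mem_of_iso X Y e hX m hm φ := by
    rw [← cancel_epi e.hom, hX m hm (e.hom ≫ φ), comp_zero]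
  shift_mem X hX m hm φ := by
    let e := ((DerivedCategory.singleFunctors (ModuleCat ℤ)).shiftIso 1 m (1 + m) rfl).app B
    obtain ⟨ψ, hψ⟩ := (shiftFunctor (DerivedCategory (ModuleCat ℤ)) (1 : ℤ)).map_surjective
      (φ ≫ e.inv)
    rw [hX (1 + m) (by omega) ψ, Functor.map_zero] at hψ
    rw [← cancel_mono e.inv, ← hψ, zero_comp]
  ext_mem X Y Z f g h hT hX hZ m hm φ := by
    obtain ⟨ψ, hψ⟩ := Triangle.yoneda_exact₂ _ hT φ (hX m hm _)
    have hψ' : φ = g ≫ (show Z ⟶ _ from ψ) := hψ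
    rw [hψ', hZ m hm (show Z ⟶ _ from ψ), comp_zero]
  coproduct_mem ι X c hc hX m hm φ := by
    refine Cofan.IsColimit.hom_ext hc _ _ fun i => ?_
    rw [hX i m hm (c.inj i ≫ φ), comp_zero]

theorem mem_orthB [HasDerivedCategory.{w} (ModuleCat ℤ)] (A B : ModuleCat ℤ)
    (h : ∀ f : A ⟶ B, f = 0) :
    (DerivedCategory.singleFunctor (ModuleCat ℤ) 0).obj A ∈ orthB B := by
  intro m hm φ
  rcases hm.eq_or_lt with rfl | hm
  · obtain ⟨f, rfl⟩ := (DerivedCategory.singleFunctor (ModuleCat ℤ) 0).map_surjective φ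
    rw [h f, Functor.map_zero]
  · exact DerivedCategory.TStructure.t.zero φ 0 m hm

/-- Let `A`, `B` be abelian groups with `Hom_ℤ(A, B) = 0`, regarded as
objects of `D(ℤ)` in homological degree `0`, and let `C̄(A)` be the smallest cocomplete
preaisle of `D(ℤ)` containing `A`. Then `Hom_{D(ℤ)}(X, B) = 0` for every `X ∈ C̄(A)`;
in particular, if `B ≠ 0` then `B ∉ C̄(A)`. -/
theorem stmt19 [HasDerivedCategory.{w} (ModuleCat ℤ)]
    (A B : Type) [AddCommGroup A] [AddCommGroup B]
    (hAB : ∀ f : A →+ B, f = 0) :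
    (∀ X : DerivedCategory (ModuleCat ℤ),
      (∀ S : Set (DerivedCategory (ModuleCat ℤ)), IsCocompletePreaisle ℤ S →
        sdeg ℤ 0 (ModuleCat.of ℤ A) ∈ S → X ∈ S) →
      ∀ φ : X ⟶ sdeg ℤ 0 (ModuleCat.of ℤ B), φ = 0) ∧
    (Nontrivial B →
      ¬ ∀ S : Set (DerivedCategory (ModuleCat ℤ)), IsCocompletePreaisle ℤ S →
        sdeg ℤ 0 (ModuleCat.of ℤ A) ∈ S → sdeg ℤ 0 (ModuleCat.of ℤ B) ∈ S) := by
  have hA : sdeg ℤ 0 (ModuleCat.of ℤ A) ∈ orthB (ModuleCat.of ℤ B) := by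
    refine mem_orthB _ _ fun f => ?_
    ext x
    exact DFunLike.congr_fun (hAB f.hom.toAddMonoidHom) x
  have key : ∀ X : DerivedCategory (ModuleCat ℤ),
      (∀ S : Set (DerivedCategory (ModuleCat ℤ)), IsCocompletePreaisle ℤ S →
        sdeg ℤ 0 (ModuleCat.of ℤ A) ∈ S → X ∈ S) →
      ∀ φ : X ⟶ sdeg ℤ 0 (ModuleCat.of ℤ B), φ = 0 := fun X hX φ =>
    hX _ (orthB_preaisle (ModuleCat.of ℤ B)) hA 0 le_rfl φ
  refine ⟨key, fun hB hmem => ?_⟩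
  have h0 := key _ hmem (𝟙 _)
  have h1 : (𝟙 (ModuleCat.of ℤ B)) = 0 := by
    apply (DerivedCategory.singleFunctor (ModuleCat ℤ) (-0)).map_injective
    rw [Functor.map_zero, CategoryTheory.Functor.map_id]
    exact h0
  obtain ⟨b, hb⟩ := exists_ne (0 : B)
  apply hb
  have := congrArg (fun f : ModuleCat.of ℤ B ⟶ ModuleCat.of ℤ B => f.hom b) h1
  simpa using this
end
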